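/- Let M be a matroid without large uniform minors. Then M is representable over some field if and only if M is representable over 𝔽₃ or representable over 𝔽₄. -/

import Mathlib

universe u v w

open Matroid Set

namespace Paper

/-- The deletion of the set `D` from the matroid `M`. -/
def delete {α : Type u} (M : Matroid α) (D : Set α) : Matroid α := M ↾ (M.E \ D)

/-- The contraction of the set `C` in the matroid `M`. -/
def contract {α : Type u} (M : Matroid α) (C : Set α) : Matroid α := (delete M✶ C)✶

/-- `N` is a minor of `M`: it is obtained from `M` by a sequence of deletions and
contractions, equivalently by a single contraction followed by a single deletion. -/
def IsMinor {α : Type u} (N M : Matroid α) : Prop :=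
  ∃ C D : Set α, N = delete (contract M C) D

/-- `M` is a copy of the uniform matroid `U(r,n)`: its ground set has `n` elements and its
independent sets are exactly the subsets of the ground set with at most `r` elements. -/
def IsUniform {α : Type u} (M : Matroid α) (r n : ℕ) : Prop :=
  M.E.Finite ∧ M.E.ncard = n ∧ ∀ I ⊆ M.E, (M.Indep I ↔ I.ncard ≤ r)

/-- `M` has a minor isomorphic to the uniform matroid `U(r,n)`. -/
def HasUniformMinor {α : Type u} (M : Matroid α) (r n : ℕ) : Prop :=
  ∃ N : Matroid α, IsMinor N M ∧ IsUniform N r n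

/-- `M` is without large uniform minors: no minor of `M` is isomorphic to `U(2,5)` or
`U(3,5)`. -/
def NoLargeUniformMinors {α : Type u} (M : Matroid α) : Prop :=
  ¬ HasUniformMinor M 2 5 ∧ ¬ HasUniformMinor M 3 5

/-- `M` is isomorphic to the Fano matroid `F₇`, the matroid on the seven nonzero vectors of
`(𝔽₂)³` whose independent sets are the `𝔽₂`-linearly independent subsets. -/
def IsFano {α : Type u} (M : Matroid α) : Prop :=
  ∃ f : α → (Fin 3 → ZMod 2),
    Set.BijOn f M.E {x | x ≠ 0} ∧
    ∀ I ⊆ M.E, (M.Indep I ↔ Set.InjOn f I ∧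
      LinearIndependent (ZMod 2) (fun x : (f '' I) => (x : Fin 3 → ZMod 2)))

/-- `M` has a minor isomorphic to the Fano matroid `F₇`. -/
def HasFanoMinor {α : Type u} (M : Matroid α) : Prop :=
  ∃ N : Matroid α, IsMinor N M ∧ IsFano N

/-- `M` has a minor isomorphic to the dual Fano matroid `F₇*`. -/
def HasFanoDualMinor {α : Type u} (M : Matroid α) : Prop :=
  ∃ N : Matroid α, IsMinor N M ∧ IsFano N✶

/-- `M` is representable over the field `K`: there are a `K`-vector space `V` and a map
`φ` from the ground type to `V` such that a set `I ⊆ M.E` is independent in `M` if and only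
if the family `φ` restricted to `I` is linearly independent over `K` (equivalently, `φ` is
injective on `I` and the image `φ '' I` is linearly independent). -/
def Representable {α : Type u} (M : Matroid α) (K : Type v) [Field K] : Prop :=
  ∃ (V : Type (max u v)) (_ : AddCommGroup V) (_ : Module K V) (φ : α → V),
    ∀ I ⊆ M.E, (M.Indep I ↔ LinearIndependent K (fun x : I => φ x))

end Paper

set_option linter.unusedSectionVars false

namespace Paper

section PivotSystem

variable {K F α : Type*} [Field K] [Field F] [DecidableEq α]

/-- The finset obtained from `B` by removing `x` and adding `y`. -/
def swap (B : Finset α) (x y : α) : Finset α := insert y (B.erase x)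

lemma mem_swap {B : Finset α} {x y z : α} : z ∈ swap B x y ↔ z = y ∨ z ≠ x ∧ z ∈ B := by
  simp [swap]

lemma swap_swap {B : Finset α} {x y : α} (hx : x ∈ B) (hy : y ∉ B) :
    swap (swap B x y) y x = B := by
  ext z
  simp only [mem_swap]
  by_cases h1 : z = x <;> by_cases h2 : z = y <;> grind

/-- An abstract form of the collection of all standard matrices `[I | A]` representing a
matroid over `K`: for each base `B`, `coef B x y` is the coordinate at `x ∈ B` of the element
`y ∉ B`. -/
structure PivotSystem (K α : Type*) [Field K] [DecidableEq α] where
  /-- The bases. -/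
  IsBase : Finset α → Prop
  /-- The entries of the standard matrices. -/
  coef : Finset α → α → α → K
  swap_iff : ∀ {B x y}, IsBase B → x ∈ B → y ∉ B → (IsBase (swap B x y) ↔ coef B x y ≠ 0)
  coef_new : ∀ {B x y}, IsBase B → x ∈ B → y ∉ B → coef B x y ≠ 0 →
    coef (swap B x y) y x = (coef B x y)⁻¹
  coef_row : ∀ {B x y e}, IsBase B → x ∈ B → y ∉ B → coef B x y ≠ 0 → e ∉ B → e ≠ y →
    coef (swap B x y) y e = coef B x e / coef B x y
  coef_col : ∀ {B x y i}, IsBase B → x ∈ B → y ∉ B → coef B x y ≠ 0 → i ∈ B → i ≠ x →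
    coef (swap B x y) i x = -coef B i y / coef B x y
  coef_rest : ∀ {B x y i e}, IsBase B → x ∈ B → y ∉ B → coef B x y ≠ 0 → i ∈ B → i ≠ x →
    e ∉ B → e ≠ y →
    coef (swap B x y) i e = coef B i e - coef B i y * coef B x e / coef B x y
  exists_row : ∀ {B B' x}, IsBase B → IsBase B' → x ∈ B → x ∉ B' →
    ∃ y ∈ B', y ∉ B ∧ coef B x y ≠ 0
  exists_col : ∀ {B B' y}, IsBase B → IsBase B' → y ∉ B → y ∈ B' →
    ∃ x ∈ B, x ∉ B' ∧ coef B x y ≠ 0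

/-- `B` and `B₀` agree outside `S`. The bases agreeing with `B₀` outside `S` correspond to the
bases of a minor on the ground set `S`. -/
def Agree (S B B₀ : Finset α) : Prop := ∀ z ∉ S, z ∈ B ↔ z ∈ B₀

namespace Agree

variable {S T B B' B₀ : Finset α} {p q : α}

lemma refl (S B : Finset α) : Agree S B B := fun _ _ => Iff.rfl

lemma symm (h : Agree S B B₀) : Agree S B₀ B := fun z hz => (h z hz).symm

lemma trans (h : Agree S B B') (h' : Agree S B' B₀) : Agree S B B₀ :=
  fun z hz => (h z hz).trans (h' z hz)

lemma mono (hST : S ⊆ T) (h : Agree S B B₀) : Agree T B B₀ := fun z hz => h z fun hs => hz (hST hs)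

lemma swap_left (h : Agree S B B₀) (hp : p ∈ S) (hq : q ∈ S) : Agree S (swap B p q) B₀ := by
  intro z hz
  rw [← h z hz, mem_swap]
  grind

end Agree

namespace PivotSystem

variable (P : PivotSystem K α)

lemma swap_isBase {P : PivotSystem K α} {B : Finset α} {x y : α} (h : P.IsBase B) (hx : x ∈ B)
    (hy : y ∉ B) (hxy : P.coef B x y ≠ 0) : P.IsBase (swap B x y) :=
  (P.swap_iff h hx hy).2 hxy

theorem face_induction {P : PivotSystem K α} {S B₀ : Finset α} (h₀ : P.IsBase B₀)
    {motive : Finset α → Prop} (base : motive B₀)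
    (step : ∀ B p q, P.IsBase B → Agree S B B₀ → motive B → p ∈ B → p ∈ S → q ∉ B → q ∈ S →
      P.coef B p q ≠ 0 → motive (swap B p q))
    {B : Finset α} (hB : P.IsBase B) (hA : Agree S B B₀) : motive B := by
  induction hn : (B \ B₀).card using Nat.strong_induction_on generalizing B with
  | _ n ih =>
  by_cases hsub : B ⊆ B₀
  · have : B = B₀ := by
      refine hsub.antisymm fun y hy => ?_
      by_contra hyB
      obtain ⟨x, hx, hx', -⟩ := P.exists_col hB h₀ hyB hy
      exact hx' (hsub hx)
    rwa [this]
  · obtain ⟨x, hx, hx'⟩ := Finset.not_subset.1 hsub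
    obtain ⟨y, hy, hy', hxy⟩ := P.exists_row hB h₀ hx hx'
    have hxS : x ∈ S := by
      by_contra h
      exact hx' ((hA x h).1 hx)
    have hyS : y ∈ S := by
      by_contra h
      exact hy' ((hA y h).2 hy)
    have hB1 := swap_isBase hB hx hy' hxy
    have hA1 := hA.swap_left hxS hyS
    have hm := ih (swap B x y \ B₀).card (by
      rw [← hn]
      apply Finset.card_lt_card
      rw [Finset.ssubset_iff_of_subset]
      · refine ⟨x, by simp [hx, hx'], ?_⟩
        simp only [Finset.mem_sdiff, mem_swap]
        grind
      · intro z
        simp only [Finset.mem_sdiff, mem_swap]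
        grind) hB1 hA1 rfl
    have h3 : x ∉ swap B x y := by rw [mem_swap]; grind
    have := step (swap B x y) y x hB1 hA1 hm (by rw [mem_swap]; exact Or.inl rfl) hyS h3 hxS
      (by rw [P.coef_new hB hx hy' hxy]; exact inv_ne_zero hxy)
    rwa [swap_swap hx hy'] at this

lemma card_swap {B : Finset α} {x y : α} (hx : x ∈ B) (hy : y ∉ B) :
    (swap B x y).card = B.card := by
  rw [swap, Finset.card_insert_of_notMem (by simp [hy]), Finset.card_erase_add_one hx]

lemma card_eq {P : PivotSystem K α} {B B' : Finset α} (h : P.IsBase B) (h' : P.IsBase B') :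
    B.card = B'.card := by
  classical
  refine face_induction (S := B ∪ B') (motive := fun C => C.card = B'.card) h' rfl ?_ h ?_
  · intro C p q _ _ hC hp _ hq _ _
    rw [card_swap hp hq, hC]
  · intro z hz
    simp only [Finset.mem_union, not_or] at hz
    simp [hz]

/-- The dual system. -/
def dual [Fintype α] (P : PivotSystem K α) : PivotSystem K α where
  IsBase B := P.IsBase Bᶜ
  coef B x y := -P.coef Bᶜ y x
  swap_iff {B x y} h hx hy := by
    have : (swap B x y)ᶜ = swap Bᶜ y x := by
      ext z; simp only [Finset.mem_compl, mem_swap]; grind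
    rw [this, P.swap_iff h (by simpa) (by simpa)]
    simp
  coef_new {B x y} h hx hy hxy := by
    have : (swap B x y)ᶜ = swap Bᶜ y x := by
      ext z; simp only [Finset.mem_compl, mem_swap]; grind
    rw [this, P.coef_new h (by simpa) (by simpa) (by simpa using hxy), inv_neg]
  coef_row {B x y e} h hx hy hxy he hne := by
    have : (swap B x y)ᶜ = swap Bᶜ y x := by
      ext z; simp only [Finset.mem_compl, mem_swap]; grind
    rw [this, P.coef_col h (by simpa) (by simpa) (by simpa using hxy) (by simpa) hne]
    ring
  coef_col {B x y e} h hx hy hxy he hne := by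
    have : (swap B x y)ᶜ = swap Bᶜ y x := by
      ext z; simp only [Finset.mem_compl, mem_swap]; grind
    rw [this, P.coef_row h (by simpa) (by simpa) (by simpa using hxy) (by simpa) hne]
    ring
  coef_rest {B x y i e} h hx hy hxy hi hix he hne := by
    have : (swap B x y)ᶜ = swap Bᶜ y x := by
      ext z; simp only [Finset.mem_compl, mem_swap]; grind
    rw [this, P.coef_rest h (by simpa) (by simpa) (by simpa using hxy) (by simpa) hne (by simpa) hix]
    ring
  exists_row {B B' x} h h' hx hx' := by
    obtain ⟨y, h1, h2, h3⟩ := P.exists_col h h' (by simpa) (by simpa)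
    exact ⟨y, by simpa using h2, by simpa using h1, by simpa using h3⟩
  exists_col {B B' x} h h' hx hx' := by
    obtain ⟨y, h1, h2, h3⟩ := P.exists_row h h' (by simpa) (by simpa)
    exact ⟨y, by simpa using h2, by simpa using h1, by simpa using h3⟩

end PivotSystem

end PivotSystem

section VectorSystem

variable {F α V : Type*} [Field F] [DecidableEq α] [AddCommGroup V] [Module F V]

/-- The family `φ` restricted to `B` is a basis of the span of the range of `φ`. -/
def IsVectorBase (F : Type*) [Field F] [Module F V] (φ : α → V) (B : Finset α) : Prop :=
  LinearIndepOn F φ (B : Set α) ∧ ∀ e, φ e ∈ Submodule.span F (φ '' (B : Set α))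

open Classical in
/-- The coordinate of `φ y` at `φ x` with respect to the basis `φ '' B`. -/
noncomputable def vectorCoef (F : Type*) [Field F] [Module F V] (φ : α → V) (B : Finset α)
    (x y : α) : F :=
  if h : ∃ c : α → F, φ y = ∑ z ∈ B, c z • φ z then h.choose x else 0

lemma mem_span_image_finset {φ : α → V} {B : Finset α} {v : V} :
    v ∈ Submodule.span F (φ '' (B : Set α)) ↔ ∃ c : α → F, v = ∑ z ∈ B, c z • φ z := by
  classical
  rw [Submodule.mem_span_image_finset_iff_exists_fun]
  constructor
  · rintro ⟨c, rfl⟩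
    refine ⟨fun z => if h : z ∈ B then c ⟨z, h⟩ else 0, ?_⟩
    rw [← Finset.sum_coe_sort B]
    simp
  · rintro ⟨c, rfl⟩
    exact ⟨fun z => c z, Finset.sum_coe_sort B fun z => c z • φ z⟩

lemma linearIndepOn_finset_unique {φ : α → V} {B : Finset α} (h : LinearIndepOn F φ (B : Set α))
    {c d : α → F} (hcd : ∑ z ∈ B, c z • φ z = ∑ z ∈ B, d z • φ z) {x : α} (hx : x ∈ B) :
    c x = d x := by
  rw [linearIndepOn_finset_iff] at h
  have := h (fun z => c z - d z) (by simp [sub_smul, hcd]) x hx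
  exact sub_eq_zero.1 this

namespace IsVectorBase

variable {φ : α → V} {B B' : Finset α} {x y e : α}

lemma coef_spec (h : IsVectorBase F φ B) (y : α) :
    φ y = ∑ z ∈ B, vectorCoef F φ B z y • φ z := by
  have h1 := mem_span_image_finset.1 (h.2 y)
  simp only [vectorCoef, dif_pos h1]
  exact h1.choose_spec

lemma coef_unique (h : IsVectorBase F φ B) {c : α → F} (hc : φ y = ∑ z ∈ B, c z • φ z)
    (hx : x ∈ B) : vectorCoef F φ B x y = c x :=
  linearIndepOn_finset_unique h.1 ((h.coef_spec y).symm.trans hc) hx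

lemma notMem_span_erase (h : LinearIndepOn F φ (B : Set α)) (hx : x ∈ B) :
    φ x ∉ Submodule.span F (φ '' (B.erase x : Set α)) := by
  rw [linearIndepOn_iff_notMem_span] at h
  simpa using h x hx

lemma expand_swap (h : IsVectorBase F φ B) (hx : x ∈ B) (hy : y ∉ B)
    (hxy : vectorCoef F φ B x y ≠ 0) {c : α → F} {v : V} (hc : v = ∑ z ∈ B, c z • φ z) :
    v = ∑ z ∈ swap B x y, (if z = y then c x / vectorCoef F φ B x y else
      c z - vectorCoef F φ B z y * c x / vectorCoef F φ B x y) • φ z := by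
  rw [swap, Finset.sum_insert (by simp [hy]), if_pos rfl]
  have h1 : ∑ z ∈ B.erase x, (if z = y then c x / vectorCoef F φ B x y else
      c z - vectorCoef F φ B z y * c x / vectorCoef F φ B x y) • φ z =
      ∑ z ∈ B.erase x, (c z • φ z - (c x / vectorCoef F φ B x y) •
        (vectorCoef F φ B z y • φ z)) := by
    refine Finset.sum_congr rfl fun z hz => ?_
    rw [if_neg (by rintro rfl; exact hy (Finset.mem_of_mem_erase hz)), smul_smul, ← sub_smul]
    congr 1
    ring
  rw [h1, Finset.sum_sub_distrib, ← Finset.smul_sum, hc]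
  have h2 := h.coef_spec y
  rw [← Finset.add_sum_erase _ _ hx] at h2 ⊢
  rw [h2, smul_add, smul_smul, div_mul_cancel₀ _ hxy]
  abel

lemma swap_iff (h : IsVectorBase F φ B) (hx : x ∈ B) (hy : y ∉ B) :
    IsVectorBase F φ (swap B x y) ↔ vectorCoef F φ B x y ≠ 0 := by
  have hye : y ∉ (B.erase x : Set α) := by simp [hy]
  constructor
  · intro h' h0
    have h1 := h'.1
    rw [swap, Finset.coe_insert, linearIndepOn_insert hye] at h1
    refine h1.2 (mem_span_image_finset.2 ⟨fun z => vectorCoef F φ B z y, ?_⟩)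
    conv_lhs => rw [h.coef_spec y, ← Finset.add_sum_erase _ _ hx, h0]
    simp
  · intro hxy
    refine ⟨?_, fun e => mem_span_image_finset.2 ⟨_, h.expand_swap hx hy hxy (h.coef_spec e)⟩⟩
    rw [swap, Finset.coe_insert, linearIndepOn_insert hye]
    refine ⟨h.1.mono (by simp), fun hmem => hxy ?_⟩
    obtain ⟨d, hd⟩ := mem_span_image_finset.1 hmem
    have := h.coef_unique (x := x) (y := y) (c := fun z => if z = x then 0 else d z) (by
      rw [← Finset.add_sum_erase _ _ hx, hd]
      simp only [if_true, zero_smul, zero_add]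
      exact Finset.sum_congr rfl fun z hz => by rw [if_neg (Finset.ne_of_mem_erase hz)]) hx
    simpa using this

lemma coef_swap (h : IsVectorBase F φ B) (hx : x ∈ B) (hy : y ∉ B)
    (hxy : vectorCoef F φ B x y ≠ 0) {c : α → F} (hc : φ e = ∑ z ∈ B, c z • φ z) {i : α}
    (hi : i ∈ swap B x y) : vectorCoef F φ (swap B x y) i e =
      if i = y then c x / vectorCoef F φ B x y else
      c i - vectorCoef F φ B i y * c x / vectorCoef F φ B x y :=
  ((h.swap_iff hx hy).2 hxy).coef_unique (h.expand_swap hx hy hxy hc) hi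

lemma exists_row (h : IsVectorBase F φ B) (h' : IsVectorBase F φ B') (hx : x ∈ B) :
    ∃ y ∈ B', (y = x ∨ y ∉ B) ∧ (y ∉ B → vectorCoef F φ B x y ≠ 0) := by
  by_contra! hcon
  apply notMem_span_erase h.1 hx
  refine (Submodule.span_le.2 ?_) (h'.2 x)
  rintro _ ⟨y, hy, rfl⟩
  by_cases hyB : y ∈ B
  · refine Submodule.subset_span ⟨y, ?_, rfl⟩
    have : y ≠ x := by
      rintro rfl
      exact (hcon y hy (Or.inl rfl)).1 hyB
    simp [this, hyB]
  · refine mem_span_image_finset.2 ⟨fun z => vectorCoef F φ B z y, ?_⟩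
    conv_lhs => rw [h.coef_spec y, ← Finset.add_sum_erase _ _ hx, (hcon y hy (Or.inr hyB)).2]
    simp

lemma exists_col (h : IsVectorBase F φ B) (h' : LinearIndepOn F φ (B' : Set α)) (hy : y ∉ B)
    (hy' : y ∈ B') : ∃ x ∈ B, x ∉ B' ∧ vectorCoef F φ B x y ≠ 0 := by
  by_contra! hcon
  apply notMem_span_erase h' hy'
  rw [h.coef_spec y]
  refine Submodule.sum_mem _ fun z hz => ?_
  by_cases hzB : z ∈ B'
  · refine Submodule.smul_mem _ _ (Submodule.subset_span ⟨z, ?_, rfl⟩)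
    have : z ≠ y := by rintro rfl; exact hy hz
    simp [this, hzB]
  · rw [hcon z hz hzB, zero_smul]
    exact Submodule.zero_mem _

end IsVectorBase

/-- The system of standard matrices of a family of vectors. -/
noncomputable def vectorSystem (F : Type*) [Field F] [Module F V] (φ : α → V) :
    PivotSystem F α where
  IsBase := IsVectorBase F φ
  coef := vectorCoef F φ
  swap_iff h hx hy := h.swap_iff hx hy
  coef_new {B x y} h hx hy hxy := by
    rw [h.coef_swap hx hy hxy (c := fun z => if z = x then 1 else 0) (by simp [hx])
      (mem_swap.2 (Or.inl rfl))]
    simp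
  coef_row {B x y e} h hx hy hxy he hne := by
    rw [h.coef_swap hx hy hxy (h.coef_spec e) (mem_swap.2 (Or.inl rfl)), if_pos rfl]
  coef_col {B x y i} h hx hy hxy hi hne := by
    rw [h.coef_swap hx hy hxy (c := fun z => if z = x then 1 else 0) (by simp [hx])
      (mem_swap.2 (Or.inr ⟨hne, hi⟩)), if_neg (by rintro rfl; exact hy hi), if_neg hne]
    simp [neg_div]
  coef_rest {B x y i e} h hx hy hxy hi hne _ _ := by
    rw [h.coef_swap hx hy hxy (h.coef_spec e) (mem_swap.2 (Or.inr ⟨hne, hi⟩)),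
      if_neg (by rintro rfl; exact hy hi)]
  exists_row {B B' x} h h' hx hx' := by
    obtain ⟨y, h1, h2, h3⟩ := h.exists_row h' hx
    rcases h2 with rfl | h2
    · exact absurd h1 hx'
    · exact ⟨y, h1, h2, h3 h2⟩
  exists_col h h' hy hy' := h.exists_col h'.1 hy hy'

/-- The columns of the standard matrix `[I | A]` with identity columns indexed by `B`. -/
def matrixVector (B : Finset α) (A : α → α → F) (e x : α) : F :=
  if e ∈ B then (if e = x then 1 else 0) else if x ∈ B then A x e else 0

lemma matrixVector_spec {B : Finset α} {A : α → α → F} {e : α} (he : e ∉ B) :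
    matrixVector B A e = ∑ z ∈ B, A z e • matrixVector B A z := by
  ext x
  rw [Finset.sum_apply, matrixVector, if_neg he]
  trans ∑ z ∈ B, if z = x then A z e else 0
  · simp
  · refine Finset.sum_congr rfl fun z hz => ?_
    simp [matrixVector, hz]

lemma isVectorBase_matrixVector (B : Finset α) (A : α → α → F) :
    IsVectorBase F (matrixVector B A) B := by
  refine ⟨linearIndepOn_finset_iff.2 fun c hc x hx => ?_, fun e => ?_⟩
  · have := congrFun hc x
    rw [Finset.sum_apply] at this
    trans ∑ z ∈ B, if z = x then c z else 0
    · simp [hx]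
    · refine Eq.trans (Finset.sum_congr rfl fun z hz => ?_) this
      simp [matrixVector, hz]
  · by_cases he : e ∈ B
    · exact Submodule.subset_span ⟨e, he, rfl⟩
    · exact mem_span_image_finset.2 ⟨_, matrixVector_spec he⟩

/-- The system of the standard matrix `[I | A]` with identity columns indexed by `B`. -/
noncomputable def matrixSystem (B : Finset α) (A : α → α → F) : PivotSystem F α :=
  vectorSystem F (matrixVector B A)

lemma matrixSystem_isBase (B : Finset α) (A : α → α → F) : (matrixSystem B A).IsBase B :=
  isVectorBase_matrixVector B A

lemma matrixSystem_coef {B : Finset α} {A : α → α → F} {x e : α} (hx : x ∈ B) (he : e ∉ B) :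
    (matrixSystem B A).coef B x e = A x e :=
  (isVectorBase_matrixVector B A).coef_unique (c := fun z => A z e) (matrixVector_spec he) hx

end VectorSystem

section Geodesic

variable {α : Type*} {G : SimpleGraph α}

lemma exists_walk_of_chain (p : ℕ → α) {a b : ℕ} (hab : a ≤ b)
    (h : ∀ i, a ≤ i → i < b → G.Adj (p i) (p (i + 1))) :
    ∃ W : G.Walk (p a) (p b), W.length = b - a := by
  induction b, hab using Nat.le_induction with
  | base => exact ⟨SimpleGraph.Walk.nil, by simp⟩
  | succ b hab ih =>
    obtain ⟨W, hW⟩ := ih fun i h1 h2 => h i h1 (by omega)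
    refine ⟨W.concat (h b hab (by omega)), ?_⟩
    rw [SimpleGraph.Walk.length_concat, hW]
    omega

lemma dist_le_of_chain (p : ℕ → α) {a b : ℕ} (hab : a ≤ b)
    (h : ∀ i, a ≤ i → i < b → G.Adj (p i) (p (i + 1))) :
    G.Reachable (p a) (p b) ∧ G.dist (p a) (p b) ≤ b - a := by
  obtain ⟨W, hW⟩ := exists_walk_of_chain p hab h
  exact ⟨W.reachable, hW ▸ SimpleGraph.dist_le W⟩

lemma exists_geodesic {x y : α} (h : G.Reachable x y) :
    ∃ p : ℕ → α, p 0 = x ∧ p (G.dist x y) = y ∧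
      (∀ i < G.dist x y, G.Adj (p i) (p (i + 1))) ∧
      ∀ i ≤ G.dist x y, G.dist x (p i) = i := by
  obtain ⟨W, hW⟩ := h.exists_walk_length_eq_dist
  have h0 : W.getVert 0 = x := by simp
  have hn : W.getVert (G.dist x y) = y := by rw [← hW]; simp
  have hadj : ∀ i < G.dist x y, G.Adj (W.getVert i) (W.getVert (i + 1)) := fun i hi =>
    W.adj_getVert_succ (by rwa [hW])
  refine ⟨W.getVert, h0, hn, hadj, fun i hi => ?_⟩
  obtain ⟨r1, d1⟩ := dist_le_of_chain (G := G) W.getVert (Nat.zero_le i)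
    fun j _ hj => hadj j (by omega)
  obtain ⟨r2, d2⟩ := dist_le_of_chain (G := G) W.getVert hi fun j _ hj => hadj j hj
  rw [h0] at r1 d1
  rw [hn] at r2 d2
  obtain ⟨W1, hW1⟩ := r1.exists_walk_length_eq_dist
  obtain ⟨W2, hW2⟩ := r2.exists_walk_length_eq_dist
  have e2 := SimpleGraph.dist_le (W1.append W2)
  rw [SimpleGraph.Walk.length_append] at e2
  omega

lemma dist_le_succ_of_adj {x p q : α} (hp : G.Reachable x p) (h : G.Adj p q) :
    G.dist x q ≤ G.dist x p + 1 := by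
  obtain ⟨W, hW⟩ := hp.exists_walk_length_eq_dist
  have := SimpleGraph.dist_le (W.concat h)
  rwa [SimpleGraph.Walk.length_concat, hW] at this

end Geodesic

section Scaling

variable {K F α : Type*} [Field K] [Field F] [DecidableEq α]

namespace PivotSystem

/-- The cross ratio of the rows `x`, `y` and the columns `u`, `v` in the standard matrix
of `B`. -/
def cr (P : PivotSystem K α) (B : Finset α) (x y u v : α) : K :=
  P.coef B x u * P.coef B y v / (P.coef B x v * P.coef B y u)

/-- The bipartite graph on `S` of the nonzero entries of the standard matrix of `B`. -/
def graph (P : PivotSystem K α) (S B : Finset α) : SimpleGraph α where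
  Adj p q := p ∈ S ∧ q ∈ S ∧
    (p ∈ B ∧ q ∉ B ∧ P.coef B p q ≠ 0 ∨ q ∈ B ∧ p ∉ B ∧ P.coef B q p ≠ 0)
  symm := ⟨fun p q h => ⟨h.2.1, h.1, h.2.2.symm⟩⟩
  loopless := ⟨fun p h => by grind⟩

lemma graph_adj {P : PivotSystem K α} {S B : Finset α} {p q : α} : (P.graph S B).Adj p q ↔
    p ∈ S ∧ q ∈ S ∧ (p ∈ B ∧ q ∉ B ∧ P.coef B p q ≠ 0 ∨ q ∈ B ∧ p ∉ B ∧ P.coef B q p ≠ 0) :=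
  Iff.rfl

lemma chain_mem_iff {P : PivotSystem K α} {S B : Finset α} {p : ℕ → α} {n : ℕ}
    (h : ∀ i < n, (P.graph S B).Adj (p i) (p (i + 1))) (h0 : p 0 ∈ B) :
    ∀ i ≤ n, (p i ∈ B ↔ Even i) := by
  intro i hi
  induction i with
  | zero => simp [h0]
  | succ i ih =>
    have h1 := h i (by omega)
    rw [graph_adj] at h1
    rw [Nat.even_add_one, ← ih (by omega)]
    grind

/-- The standard matrix of `B` in `R` is obtained from the one in `Q` by scaling with `σ`, on
the ground set `S`. -/
def Scaled (σ : α → F) (Q R : PivotSystem F α) (S B : Finset α) : Prop :=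
  ∀ p ∈ B, p ∈ S → ∀ q ∉ B, q ∈ S → R.coef B p q = Q.coef B p q * σ q / σ p

namespace Scaled

variable {σ τ : α → F} {Q R : PivotSystem F α} {S T B B₀ : Finset α}

lemma symm (hσ : ∀ z, σ z ≠ 0) (h : Scaled σ Q R S B) : Scaled (fun z => (σ z)⁻¹) R Q S B := by
  intro p hp hpS q hq hqS
  rw [h p hp hpS q hq hqS]
  have := hσ p
  have := hσ q
  field_simp

lemma coef_eq_zero (hσ : ∀ z, σ z ≠ 0) (h : Scaled σ Q R S B) {p q : α} (hp : p ∈ B)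
    (hpS : p ∈ S) (hq : q ∉ B) (hqS : q ∈ S) : R.coef B p q = 0 ↔ Q.coef B p q = 0 := by
  rw [h p hp hpS q hq hqS]
  simp [hσ p, hσ q]

lemma face (hσ : ∀ z, σ z ≠ 0) (hR : R.IsBase B₀) (h : Scaled σ Q R S B₀)
    (hQ : Q.IsBase B₀) (hB : Q.IsBase B) (hA : Agree S B B₀) :
    R.IsBase B ∧ Scaled σ Q R S B := by
  refine face_induction (P := Q) (S := S) (motive := fun B => R.IsBase B ∧ Scaled σ Q R S B)
    hQ ⟨hR, h⟩ ?_ hB hA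
  rintro B p q hB hA ⟨hRB, hs⟩ hp hpS hq hqS hpq
  have hRpq : R.coef B p q ≠ 0 := fun h0 => hpq ((hs.coef_eq_zero hσ hp hpS hq hqS).1 h0)
  refine ⟨swap_isBase hRB hp hq hRpq, ?_⟩
  have h1 := hσ p
  have h2 := hσ q
  intro i hi hiS e he heS
  have h3 := hσ i
  have h4 := hσ e
  have he' : e = p ∨ e ≠ p ∧ e ∉ B := by rw [mem_swap] at he; grind
  have heq : e ≠ q := by rw [mem_swap] at he; grind
  have E1 := hs p hp hpS q hq hqS
  rcases mem_swap.1 hi with rfl | ⟨hip, hiB⟩ <;> rcases he' with rfl | ⟨hep, heB⟩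
  · rw [R.coef_new hRB hp hq hRpq, Q.coef_new hB hp hq hpq, E1]
    field_simp
  · rw [R.coef_row hRB hp hq hRpq heB heq, Q.coef_row hB hp hq hpq heB heq, E1,
      hs p hp hpS e heB heS]
    field_simp
  · rw [R.coef_col hRB hp hq hRpq hiB hip, Q.coef_col hB hp hq hpq hiB hip, E1,
      hs i hiB hiS q hq hqS]
    field_simp
  · rw [R.coef_rest hRB hp hq hRpq hiB hip heB heq, Q.coef_rest hB hp hq hpq hiB hip heB heq, E1,
      hs i hiB hiS q hq hqS, hs p hp hpS e heB heS, hs i hiB hiS e heB heS]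
    field_simp

lemma isBase_iff (hσ : ∀ z, σ z ≠ 0) (hR : R.IsBase B₀) (h : Scaled σ Q R S B₀)
    (hQ : Q.IsBase B₀) (hA : Agree S B B₀) : Q.IsBase B ↔ R.IsBase B :=
  ⟨fun hB => (h.face hσ hR hQ hB hA).1,
    fun hB => ((h.symm hσ).face (fun z => inv_ne_zero (hσ z)) hQ hR hB hA).1⟩

lemma cr_eq (hσ : ∀ z, σ z ≠ 0) (h : Scaled σ Q R S B) {x y u v : α} (hx : x ∈ B) (hxS : x ∈ S)
    (hy : y ∈ B) (hyS : y ∈ S) (hu : u ∉ B) (huS : u ∈ S) (hv : v ∉ B) (hvS : v ∈ S) :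
    R.cr B x y u v = Q.cr B x y u v := by
  simp only [cr]
  rw [h x hx hxS u hu huS, h y hy hyS v hv hvS, h x hx hxS v hv hvS, h y hy hyS u hu huS]
  have := hσ x
  have := hσ y
  have := hσ u
  have := hσ v
  by_cases h1 : Q.coef B x v = 0
  · simp [h1]
  by_cases h2 : Q.coef B y u = 0
  · simp [h2]
  field_simp

end Scaled

/-- Matching ratios of a column `u` along connected rows. -/
private lemma ratio_eq {Q R : PivotSystem F α} {T W B₀ : Finset α} {u : α} {τ : α → F}
    (hTW : T ⊆ W) (hV : ∀ z ∈ W, z ∉ T → z ∉ B₀)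
    (hV1 : ∀ z ∈ W, z ∉ T → ∀ z' ∈ W, z' ∉ T → z = z') (huW : u ∉ W) (huB : u ∉ B₀)
    (hQ : Q.IsBase B₀) (hR : R.IsBase B₀) (hτ0 : ∀ z, τ z ≠ 0) (hτ : Scaled τ Q R W B₀)
    (hsupp : ∀ B, Q.IsBase B → Agree T B B₀ → ∀ p ∈ B, p ∈ T →
      (Q.coef B p u = 0 ↔ R.coef B p u = 0))
    (hcr : ∀ B, Q.IsBase B → Agree T B B₀ → ∀ x y e, x ∈ B → x ∈ T → y ∈ B → y ∈ T → e ∉ B →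
      e ∈ W → Q.coef B x u ≠ 0 → Q.coef B y u ≠ 0 → Q.coef B x e ≠ 0 → Q.coef B y e ≠ 0 →
      Q.cr B x y u e = R.cr B x y u e) (n : ℕ) :
    ∀ B, Q.IsBase B → Agree T B B₀ → ∀ x y, x ∈ B → x ∈ T → y ∈ B → y ∈ T →
      Q.coef B x u ≠ 0 → Q.coef B y u ≠ 0 → (Q.graph W B).Reachable x y →
      (Q.graph W B).dist x y = n →
      R.coef B x u * τ x / Q.coef B x u = R.coef B y u * τ y / Q.coef B y u := by
  induction n using Nat.strong_induction_on with
  | _ n ih =>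
  intro B hB hA x y hx hxT hy hyT hxu hyu hreach hdist
  have hAW := hA.mono hTW
  obtain ⟨hRB, hs⟩ := hτ.face hτ0 hR hQ hB hAW
  have huB' : u ∉ B := by rw [hA u (fun h => huW (hTW h))]; exact huB
  obtain ⟨p, hp0, hpn, hadj, hd⟩ := exists_geodesic hreach
  rw [hdist] at hpn hadj hd
  have hpar := chain_mem_iff hadj (hp0 ▸ hx)
  have hn : Even n := (hpar n le_rfl).1 (hpn ▸ hy)
  -- the base case of a common column
  have hcommon : ∀ x y e, x ∈ B → x ∈ T → y ∈ B → y ∈ T → e ∉ B → e ∈ W → Q.coef B x u ≠ 0 →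
      Q.coef B y u ≠ 0 → Q.coef B x e ≠ 0 → Q.coef B y e ≠ 0 →
      R.coef B x u * τ x / Q.coef B x u = R.coef B y u * τ y / Q.coef B y u := by
    intro x y e hx hxT hy hyT he heW hxu hyu hxe hye
    have h1 := hcr B hB hA x y e hx hxT hy hyT he heW hxu hyu hxe hye
    have h2 : R.coef B y u ≠ 0 := fun h => hyu ((hsupp B hB hA y hy hyT).2 h)
    simp only [cr] at h1
    rw [hs y hy (hTW hyT) e he heW, hs x hx (hTW hxT) e he heW] at h1
    have := hτ0 x
    have := hτ0 y
    have := hτ0 e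
    field_simp at h1 ⊢
    linear_combination -h1
  -- pivoting near the end `x`
  have hpivot : ∀ (x y : α) (p : ℕ → α), x ∈ B → x ∈ T → y ∈ B → y ∈ T → Q.coef B x u ≠ 0 →
      Q.coef B y u ≠ 0 → 4 ≤ n → p 0 = x → p n = y →
      (∀ i < n, (Q.graph W B).Adj (p i) (p (i + 1))) →
      (∀ i j, i ≤ n → j ≤ n → i + 1 < j → ¬ (Q.graph W B).Adj (p i) (p j)) →
      p 1 ∈ T → Q.coef B (p 2) u = 0 →
      R.coef B x u * τ x / Q.coef B x u = R.coef B y u * τ y / Q.coef B y u := by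
    intro x y p hx hxT hy hyT hxu hyu hn4 hp0 hpn hadj hfar h1T h2u
    have hpar := chain_mem_iff hadj (hp0 ▸ hx)
    have h1B : p 1 ∉ B := by rw [hpar 1 (by omega)]; decide
    have h2B : p 2 ∈ B := by rw [hpar 2 (by omega)]; decide
    have h3B : p 3 ∉ B := by rw [hpar 3 (by omega)]; decide
    have a01 := hadj 0 (by omega)
    have a12 := hadj 1 (by omega)
    have a23 := hadj 2 (by omega)
    simp only [graph_adj, hp0, Nat.reduceAdd, zero_add] at a01 a12 a23
    have c21 : Q.coef B (p 2) (p 1) ≠ 0 := by grind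
    have c01 : Q.coef B x (p 1) ≠ 0 := by grind
    have c23 : Q.coef B (p 2) (p 3) ≠ 0 := by grind
    have h2T : p 2 ∈ T := by
      by_contra h
      exact hV _ a12.2.1 h ((hA _ h).1 h2B)
    have hB' := swap_isBase hB h2B h1B c21
    have hA' := hA.swap_left h2T h1T
    have hRc21 : R.coef B (p 2) (p 1) ≠ 0 := fun h =>
      c21 ((hs.coef_eq_zero hτ0 h2B (hTW h2T) h1B (hTW h1T)).1 h)
    have hR2u : R.coef B (p 2) u = 0 := (hsupp B hB hA _ h2B h2T).1 h2u
    have hu1 : u ≠ p 1 := fun h => huW (h ▸ hTW h1T)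
    have hrow : ∀ z ∈ B, z ≠ p 2 → Q.coef (swap B (p 2) (p 1)) z u = Q.coef B z u ∧
        R.coef (swap B (p 2) (p 1)) z u = R.coef B z u := by
      intro z hz hz2
      rw [Q.coef_rest hB h2B h1B c21 hz hz2 huB' hu1, R.coef_rest hRB h2B h1B hRc21 hz hz2 huB' hu1,
        h2u, hR2u]
      simp
    have hx2 : x ≠ p 2 := fun h => hxu (h ▸ h2u)
    have hy2 : y ≠ p 2 := fun h => hyu (h ▸ h2u)
    have hpne : ∀ i j, i ≤ n → j ≤ n → i + 1 < j → p i ≠ p j := by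
      intro i j hi hj hij h
      rcases Nat.lt_or_ge j n with hjn | hjn
      · exact hfar i (j + 1) hi (by omega) (by omega) (h ▸ hadj j hjn)
      · have : j = n := by omega
        subst this
        rcases Nat.eq_zero_or_pos i with h0 | h0
        · subst h0
          have := hadj (j - 1) (by omega)
          rw [show j - 1 + 1 = j by omega, ← h] at this
          exact hfar 0 (j - 1) (by omega) (by omega) (by omega) this.symm
        · have := hadj (i - 1) (by omega)
          rw [show i - 1 + 1 = i by omega, h] at this
          exact hfar (i - 1) j (by omega) (by omega) (by omega) this
    -- adjacency in the new graph
    have key : ∀ i, 3 ≤ i → i < n → (Q.graph W (swap B (p 2) (p 1))).Adj (p i) (p (i + 1)) := by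
      have entry : ∀ i j, 3 ≤ i → i ≤ n → 3 ≤ j → j ≤ n → p i ∈ B → p j ∉ B →
          Q.coef B (p i) (p j) ≠ 0 → Q.coef (swap B (p 2) (p 1)) (p i) (p j) ≠ 0 := by
        intro i j h3i hin h3j hjn hiB hjB hc
        rw [Q.coef_rest hB h2B h1B c21 hiB (hpne 2 i (by omega) hin (by grind)).symm hjB
          (hpne 1 j (by omega) hjn (by omega)).symm]
        have : Q.coef B (p i) (p 1) = 0 := by
          by_contra h
          exact hfar 1 i (by omega) hin (by omega)
            (graph_adj.2 ⟨a01.2.1, by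
              have := hadj (i - 1) (by omega)
              rw [show i - 1 + 1 = i by omega] at this
              exact this.2.1, Or.inr ⟨hiB, h1B, h⟩⟩)
        simpa [this] using hc
      have memi : ∀ i, 3 ≤ i → i ≤ n → p i ≠ p 1 := fun i h3 hi =>
        (hpne 1 i (by omega) hi (by omega)).symm
      have memi2 : ∀ i, 3 ≤ i → i ≤ n → p i ≠ p 2 := fun i h3 hi h => by
        rcases Nat.lt_or_ge 3 i with h4 | h4
        · exact hpne 2 i (by omega) hi (by omega) h.symm
        · have : i = 3 := by omega
          subst this
          exact h3B (h ▸ h2B)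
      intro i h3i hin
      have hi1 := hadj i hin
      rw [graph_adj] at hi1 ⊢
      refine ⟨hi1.1, hi1.2.1, ?_⟩
      simp only [mem_swap]
      have e1 := memi i h3i hin.le
      have e2 := memi (i + 1) (by omega) hin
      have e3 := memi2 i h3i hin.le
      have e4 := memi2 (i + 1) (by omega) hin
      rcases hi1.2.2 with ⟨h1, h2, h3⟩ | ⟨h1, h2, h3⟩
      · refine Or.inl ⟨Or.inr ⟨e3, h1⟩, by grind, ?_⟩
        exact entry i (i + 1) h3i hin.le (by omega) hin h1 h2 h3
      · refine Or.inr ⟨Or.inr ⟨e4, h1⟩, by grind, ?_⟩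
        exact entry (i + 1) i (by omega) hin h3i hin.le h1 h2 h3
    have h31 : p 3 ≠ p 1 := (hpne 1 3 (by omega) (by omega) (by omega)).symm
    have key0 : (Q.graph W (swap B (p 2) (p 1))).Adj x (p 3) := by
      rw [graph_adj]
      refine ⟨a01.1, a23.2.1, Or.inl ⟨mem_swap.2 (Or.inr ⟨hx2, hx⟩), ?_, ?_⟩⟩
      · rw [mem_swap]
        grind
      · rw [Q.coef_rest hB h2B h1B c21 hx hx2 h3B h31]
        have : Q.coef B x (p 3) = 0 := by
          by_contra h
          exact hfar 0 3 (by omega) (by omega) (by omega)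
            (graph_adj.2 ⟨hp0 ▸ a01.1, a23.2.1, Or.inl ⟨hp0 ▸ hx, h3B, hp0 ▸ h⟩⟩)
        rw [this, zero_sub, neg_ne_zero]
        exact div_ne_zero (mul_ne_zero c01 c23) c21
    obtain ⟨r1, d1⟩ := dist_le_of_chain p (show 3 ≤ n by omega) key
    rw [hpn] at r1 d1
    obtain ⟨W1, hW1⟩ := r1.exists_walk_length_eq_dist
    have hlen : (Q.graph W (swap B (p 2) (p 1))).dist x y ≤ n - 2 := by
      have := SimpleGraph.dist_le (SimpleGraph.Walk.cons key0 W1)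
      rw [SimpleGraph.Walk.length_cons, hW1] at this
      omega
    have := ih _ (show (Q.graph W (swap B (p 2) (p 1))).dist x y < n by omega) _ hB' hA' x y
      (mem_swap.2 (Or.inr ⟨hx2, hx⟩)) hxT (mem_swap.2 (Or.inr ⟨hy2, hy⟩)) hyT
      (by rwa [(hrow x hx hx2).1]) (by rwa [(hrow y hy hy2).1])
      (SimpleGraph.Walk.cons key0 W1).reachable rfl
    rwa [(hrow x hx hx2).1, (hrow y hy hy2).1, (hrow x hx hx2).2, (hrow y hy hy2).2] at this
  rcases Nat.eq_zero_or_pos n with h0 | hpos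
  · subst h0
    rw [hp0] at hpn
    rw [hpn]
  have hn2 : 2 ≤ n := by
    rcases hn with ⟨k, rfl⟩
    omega
  have hW : ∀ i ≤ n, p i ∈ W := by
    intro i hi
    rcases Nat.lt_or_ge i n with h | h
    · exact (hadj i h).1
    · have := (hadj (i - 1) (by omega)).2.1
      rwa [show i - 1 + 1 = i by omega] at this
  have hrowT : ∀ i ≤ n, Even i → p i ∈ T := by
    intro i hi he
    by_contra h
    exact hV _ (hW i hi) h ((hA _ h).1 ((hpar i hi).2 he))
  have hreachp : ∀ i ≤ n, (Q.graph W B).Reachable x (p i) := by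
    intro i hi
    have := (dist_le_of_chain (G := Q.graph W B) p (Nat.zero_le i)
      fun j _ hj => hadj j (by omega)).1
    rwa [hp0] at this
  have hfar : ∀ i j, i ≤ n → j ≤ n → i + 1 < j → ¬ (Q.graph W B).Adj (p i) (p j) := by
    intro i j hi hj hij h
    have := dist_le_succ_of_adj (hreachp i hi) h
    rw [hd i hi, hd j hj] at this
    omega
  -- an interior row of the geodesic meeting `u`
  by_cases hint : ∃ i, 0 < i ∧ i < n ∧ Even i ∧ Q.coef B (p i) u ≠ 0
  · obtain ⟨i, hi0, hin, hie, hiu⟩ := hint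
    have hiB := (hpar i hin.le).2 hie
    have e1 := ih i hin B hB hA x (p i) hx hxT hiB (hrowT i hin.le hie) hxu hiu
      (hreachp i hin.le) (hd i hin.le)
    have hlt : (Q.graph W B).dist (p i) y < n := by
      have := (dist_le_of_chain (G := Q.graph W B) p hin.le fun j _ hj => hadj j hj).2
      rw [hpn] at this
      omega
    have e2 := ih _ hlt B hB hA (p i) y hiB (hrowT i hin.le hie) hy hyT hiu hyu
      ((hreachp i hin.le).symm.trans hreach) rfl
    exact e1.trans e2
  push Not at hint
  have h1B : p 1 ∉ B := by rw [hpar 1 (by omega)]; decide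
  rcases Nat.lt_or_ge n 4 with hn4 | hn4
  · have : n = 2 := by
      rcases hn with ⟨k, rfl⟩
      omega
    subst this
    have a01 := hadj 0 (by omega)
    have a12 := hadj 1 (by omega)
    simp only [graph_adj, hp0, hpn, Nat.reduceAdd, zero_add] at a01 a12
    exact hcommon x y (p 1) hx hxT hy hyT h1B a01.2.1 hxu hyu (by grind) (by grind)
  · by_cases h1T : p 1 ∈ T
    · exact hpivot x y p hx hxT hy hyT hxu hyu hn4 hp0 hpn hadj hfar h1T
        (hint 2 (by omega) (by omega) even_two)
    · have hlast : p (n - 1) ∈ T := by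
        by_contra h
        have := hV1 _ (hW 1 (by omega)) h1T _ (hW (n - 1) (by omega)) h
        have h2 := hd 1 (by omega)
        rw [this, hd (n - 1) (by omega)] at h2
        omega
      refine (hpivot y x (fun i => p (n - i)) hy hyT hx hxT hyu hxu hn4 (by simpa using hpn)
        (by simpa using hp0) (fun i hi => ?_) (fun i j hi hj hij h => ?_) hlast
        (hint (n - 2) (by omega) (by omega) ?_)).symm
      · have := hadj (n - (i + 1)) (by omega)
        rw [show n - (i + 1) + 1 = n - i by omega] at this
        exact this.symm
      · exact hfar (n - j) (n - i) (by omega) (by omega) (by omega) h.symm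
      · rw [Nat.even_sub (by omega)]
        simpa using hn

theorem exists_scaled {Q R : PivotSystem F α} {T W B₀ : Finset α} {u : α} {τ : α → F}
    (hTW : T ⊆ W) (hV : ∀ z ∈ W, z ∉ T → z ∉ B₀)
    (hV1 : ∀ z ∈ W, z ∉ T → ∀ z' ∈ W, z' ∉ T → z = z') (huW : u ∉ W) (huB : u ∉ B₀)
    (hQ : Q.IsBase B₀) (hR : R.IsBase B₀) (hτ0 : ∀ z, τ z ≠ 0) (hτ : Scaled τ Q R W B₀)
    (hsupp : ∀ B, Q.IsBase B → Agree T B B₀ → ∀ p ∈ B, p ∈ T →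
      (Q.coef B p u = 0 ↔ R.coef B p u = 0))
    (hcr : ∀ B, Q.IsBase B → Agree T B B₀ → ∀ x y e, x ∈ B → x ∈ T → y ∈ B → y ∈ T → e ∉ B →
      e ∈ W → Q.coef B x u ≠ 0 → Q.coef B y u ≠ 0 → Q.coef B x e ≠ 0 → Q.coef B y e ≠ 0 →
      Q.cr B x y u e = R.cr B x y u e) :
    ∃ σ : α → F, (∀ z, σ z ≠ 0) ∧ Scaled σ Q R (insert u W) B₀ := by
  classical
  have hrat : ∀ x y, x ∈ B₀ → x ∈ T → y ∈ B₀ → y ∈ T → Q.coef B₀ x u ≠ 0 →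
      Q.coef B₀ y u ≠ 0 → (Q.graph W B₀).Reachable x y →
      R.coef B₀ x u * τ x / Q.coef B₀ x u = R.coef B₀ y u * τ y / Q.coef B₀ y u :=
    fun x y hx hxT hy hyT hxu hyu hr =>
      ratio_eq hTW hV hV1 huW huB hQ hR hτ0 hτ hsupp hcr _ B₀ hQ (Agree.refl _ _) x y hx hxT hy hyT
        hxu hyu hr rfl
  let good : α → α → Prop := fun z x =>
    x ∈ B₀ ∧ x ∈ T ∧ Q.coef B₀ x u ≠ 0 ∧ (Q.graph W B₀).Reachable z x
  let ρ : α → F := fun x => R.coef B₀ x u * τ x / Q.coef B₀ x u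
  let κ : α → F := fun z => if h : ∃ x, good z x then ρ h.choose else 1
  have hκ : ∀ z x, good z x → κ z = ρ x := by
    intro z x hg
    have h : ∃ x, good z x := ⟨x, hg⟩
    simp only [κ, dif_pos h]
    obtain ⟨h1, h2, h3, h4⟩ := h.choose_spec
    obtain ⟨g1, g2, g3, g4⟩ := hg
    exact hrat _ _ h1 h2 g1 g2 h3 g3 (h4.symm.trans g4)
  have hρ0 : ∀ z x, good z x → ρ x ≠ 0 := by
    intro z x ⟨h1, h2, h3, _⟩
    have : R.coef B₀ x u ≠ 0 := fun h => h3 ((hsupp B₀ hQ (Agree.refl _ _) x h1 h2).2 h)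
    exact div_ne_zero (mul_ne_zero this (hτ0 x)) h3
  have hκ0 : ∀ z, κ z ≠ 0 := by
    intro z
    by_cases h : ∃ x, good z x
    · obtain ⟨x, hx⟩ := h
      rw [hκ z x hx]
      exact hρ0 z x hx
    · simp [κ, dif_neg h]
  have hκadj : ∀ p q, (Q.graph W B₀).Adj p q → κ p = κ q := by
    intro p q hpq
    by_cases h : ∃ x, good q x
    · obtain ⟨x, hx⟩ := h
      rw [hκ q x hx, hκ p x ⟨hx.1, hx.2.1, hx.2.2.1, hpq.reachable.trans hx.2.2.2⟩]
    · have h' : ¬ ∃ x, good p x := by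
        rintro ⟨x, hx⟩
        exact h ⟨x, hx.1, hx.2.1, hx.2.2.1, hpq.symm.reachable.trans hx.2.2.2⟩
      simp only [κ, dif_neg h, dif_neg h']
  refine ⟨fun z => if z = u then 1 else τ z / κ z, fun z => ?_, ?_⟩
  · dsimp only
    split_ifs
    · exact one_ne_zero
    · exact div_ne_zero (hτ0 z) (hκ0 z)
  · intro p hp hpS q hq hqS
    have hpu : p ≠ u := fun h => huB (h ▸ hp)
    have hpW : p ∈ W := (Finset.mem_insert.1 hpS).resolve_left hpu
    have hpT : p ∈ T := by
      by_contra h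
      exact hV p hpW h hp
    have h1 := hκ0 p
    have h2 := hτ0 p
    dsimp only
    rw [if_neg hpu]
    by_cases hqu : q = u
    · subst hqu
      rw [if_pos rfl]
      by_cases h0 : Q.coef B₀ p q = 0
      · rw [h0, (hsupp B₀ hQ (Agree.refl _ _) p hp hpT).1 h0]
        simp
      · rw [hκ p p ⟨hp, hpT, h0, SimpleGraph.Reachable.refl _⟩]
        have : R.coef B₀ p q ≠ 0 := fun h => h0 ((hsupp B₀ hQ (Agree.refl _ _) p hp hpT).2 h)
        simp only [ρ]
        field_simp
    · have hqW : q ∈ W := (Finset.mem_insert.1 hqS).resolve_left hqu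
      rw [if_neg hqu, hτ p hp hpW q hq hqW]
      by_cases h0 : Q.coef B₀ p q = 0
      · simp [h0]
      · have h3 := hκ0 q
        rw [hκadj p q (graph_adj.2 ⟨hpW, hqW, Or.inl ⟨hp, hq, h0⟩⟩)]
        field_simp

end PivotSystem
end Scaling

section Lifting

variable {K F α : Type*} [Field K] [Field F] [DecidableEq α]

/-- A map of fields compatible with the symmetries of cross ratios. -/
structure IsCrossRatioMap (lam : K → F) : Prop where
  map_zero : lam 0 = 0
  map_one : lam 1 = 1
  eq_zero : ∀ {x}, lam x = 0 → x = 0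
  eq_one : ∀ {x}, lam x = 1 → x = 1
  map_one_sub : ∀ x, lam (1 - x) = 1 - lam x
  map_inv : ∀ x, lam x⁻¹ = (lam x)⁻¹
  map_neg_one : lam (-1) = -1

namespace PivotSystem

variable {P : PivotSystem K α} {Q R : PivotSystem F α} {S T B B₀ : Finset α} {lam : K → F}
  {σ : α → F} {x y u v : α}

lemma cr_self_left (h1 : P.coef B x u ≠ 0) (h2 : P.coef B x v ≠ 0) : P.cr B x x u v = 1 := by
  simp only [cr]
  field_simp

lemma cr_self_right (h1 : P.coef B x u ≠ 0) (h2 : P.coef B y u ≠ 0) : P.cr B x y u u = 1 := by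
  simp only [cr]
  field_simp

lemma cr_eq_one_iff (h2 : P.coef B x v ≠ 0) (h3 : P.coef B y u ≠ 0) :
    P.cr B x y u v = 1 ↔ P.coef B x u * P.coef B y v = P.coef B x v * P.coef B y u := by
  rw [cr, div_eq_one_iff_eq (mul_ne_zero h2 h3)]

lemma cr_ne_zero (h1 : P.coef B x u ≠ 0) (h2 : P.coef B x v ≠ 0) (h3 : P.coef B y u ≠ 0)
    (h4 : P.coef B y v ≠ 0) : P.cr B x y u v ≠ 0 :=
  div_ne_zero (mul_ne_zero h1 h4) (mul_ne_zero h2 h3)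

lemma cr_swap_left : P.cr B y x u v = (P.cr B x y u v)⁻¹ := by
  simp only [cr, inv_div]
  ring

lemma cr_swap_right : P.cr B x y v u = (P.cr B x y u v)⁻¹ := by
  simp only [cr, inv_div]

/-- Bases obtained by exchanging two elements. -/
lemma isBase_swap_swap_iff (hB : P.IsBase B) (hx : x ∈ B) (hy : y ∈ B) (hxy : x ≠ y) (hu : u ∉ B)
    (hv : v ∉ B) (huv : u ≠ v) (hxu : P.coef B x u ≠ 0) : P.IsBase (swap (swap B x u) y v) ↔
      P.coef B x u * P.coef B y v ≠ P.coef B x v * P.coef B y u := by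
  have hB' := swap_isBase hB hx hu hxu
  rw [P.swap_iff hB' (by rw [mem_swap]; grind) (by rw [mem_swap]; grind),
    P.coef_rest hB hx hu hxu hy hxy.symm hv huv.symm, ne_eq, sub_eq_zero, not_iff_not,
    eq_div_iff hxu]
  constructor <;> intro h <;> linear_combination h

/-- `Q` has the same bases as `P` on the ground set `S`, and its cross ratios are the images
of those of `P` under `lam`. -/
def Lifts (lam : K → F) (P : PivotSystem K α) (Q : PivotSystem F α) (S B₀ : Finset α) : Prop :=
  (∀ B, Agree S B B₀ → (P.IsBase B ↔ Q.IsBase B)) ∧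
  ∀ B, Agree S B B₀ → P.IsBase B → ∀ x y u v, x ∈ B → x ∈ S → y ∈ B → y ∈ S → u ∉ B → u ∈ S →
    v ∉ B → v ∈ S → P.coef B x u ≠ 0 → P.coef B x v ≠ 0 → P.coef B y u ≠ 0 → P.coef B y v ≠ 0 →
    Q.cr B x y u v = lam (P.cr B x y u v)

namespace Lifts

lemma mono (h : Lifts lam P Q S B₀) (hTS : T ⊆ S) : Lifts lam P Q T B₀ :=
  ⟨fun B hB => h.1 B (hB.mono hTS), fun B hA hB x y u v hx hxT hy hyT hu huT hv hvT =>
    h.2 B (hA.mono hTS) hB x y u v hx (hTS hxT) hy (hTS hyT) hu (hTS huT) hv (hTS hvT)⟩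

lemma rebase (h : Lifts lam P Q S B₀) (hA : Agree S B B₀) : Lifts lam P Q S B :=
  ⟨fun _ hB => h.1 _ (hB.trans hA), fun _ hB => h.2 _ (hB.trans hA)⟩

lemma isBase (h : Lifts lam P Q S B₀) (hA : Agree S B B₀) (hB : P.IsBase B) : Q.IsBase B :=
  (h.1 B hA).1 hB

lemma coef_eq_zero (h : Lifts lam P Q S B₀) (hA : Agree S B B₀) (hB : P.IsBase B)
    (hx : x ∈ B) (hxS : x ∈ S) (hu : u ∉ B) (huS : u ∈ S) :
    Q.coef B x u = 0 ↔ P.coef B x u = 0 := by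
  have h1 := P.swap_iff hB hx hu
  have h2 := Q.swap_iff (h.isBase hA hB) hx hu
  rw [← not_iff_not]
  exact h2.symm.trans ((h.1 _ (hA.swap_left hxS huS)).symm.trans h1)

lemma of_scaled (h : Lifts lam P Q S B₀) (hB₀ : P.IsBase B₀) (hσ : ∀ z, σ z ≠ 0)
    (hR : R.IsBase B₀) (hs : Scaled σ Q R S B₀) : Lifts lam P R S B₀ := by
  have hQ := h.isBase (Agree.refl S B₀) hB₀
  refine ⟨fun B hA => (h.1 B hA).trans (hs.isBase_iff hσ hR hQ hA), ?_⟩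
  intro B hA hB x y u v hx hxS hy hyS hu huS hv hvS h1 h2 h3 h4
  rw [(hs.face hσ hR hQ (h.isBase hA hB) hA).2.cr_eq hσ hx hxS hy hyS hu huS hv hvS]
  exact h.2 B hA hB x y u v hx hxS hy hyS hu huS hv hvS h1 h2 h3 h4

/-- Lifts are unique up to scaling. -/
theorem exists_scaled_of_lifts (hB₀ : P.IsBase B₀) (hQ : Lifts lam P Q S B₀)
    (hR : Lifts lam P R S B₀) : ∃ σ : α → F, (∀ z, σ z ≠ 0) ∧ Scaled σ Q R S B₀ := by
  induction hn : S.card using Nat.strong_induction_on generalizing S with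
  | _ n ih =>
  by_cases hu : ∃ u ∈ S, u ∉ B₀
  · obtain ⟨u, huS, hu⟩ := hu
    have hsub := Finset.erase_subset u S
    obtain ⟨τ, hτ0, hτ⟩ := ih _ (hn ▸ Finset.card_erase_lt_of_mem huS) (hQ.mono hsub)
      (hR.mono hsub) rfl
    have hQ0 := hQ.isBase (Agree.refl S B₀) hB₀
    have hR0 := hR.isBase (Agree.refl S B₀) hB₀
    have key : ∀ B, Q.IsBase B → Agree (S.erase u) B B₀ → P.IsBase B ∧ Agree S B B₀ ∧ u ∉ B :=
      fun B hB hA => ⟨(hQ.1 B (hA.mono hsub)).2 hB, hA.mono hsub, by rw [hA u (by simp)]; exact hu⟩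
    have := exists_scaled (Finset.Subset.refl (S.erase u)) (fun z h1 h2 => absurd h1 h2)
      (fun z h1 h2 => absurd h1 h2) (Finset.notMem_erase u S) hu hQ0 hR0 hτ0 hτ
      (fun B hB hA p hp hpS => by
        obtain ⟨h1, h2, h3⟩ := key B hB hA
        rw [hQ.coef_eq_zero h2 h1 hp (hsub hpS) h3 huS, hR.coef_eq_zero h2 h1 hp (hsub hpS) h3 huS])
      (fun B hB hA x y e hx hxS hy hyS he heS h1 h2 h3 h4 => by
        obtain ⟨g1, g2, g3⟩ := key B hB hA
        rw [ne_eq, hQ.coef_eq_zero g2 g1 hx (hsub hxS) g3 huS] at h1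
        rw [ne_eq, hQ.coef_eq_zero g2 g1 hy (hsub hyS) g3 huS] at h2
        rw [ne_eq, hQ.coef_eq_zero g2 g1 hx (hsub hxS) he (hsub heS)] at h3
        rw [ne_eq, hQ.coef_eq_zero g2 g1 hy (hsub hyS) he (hsub heS)] at h4
        rw [hQ.2 B g2 g1 x y u e hx (hsub hxS) hy (hsub hyS) g3 huS he (hsub heS) h1 h3 h2 h4,
          hR.2 B g2 g1 x y u e hx (hsub hxS) hy (hsub hyS) g3 huS he (hsub heS) h1 h3 h2 h4])
    rwa [Finset.insert_erase huS] at this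
  · push Not at hu
    exact ⟨fun _ => 1, fun _ => one_ne_zero, fun p _ _ q hq hqS => absurd (hu q hqS) hq⟩

end Lifts

/-- The condition on a pivot system corresponding to the absence of minors isomorphic to
`U(2,5)` or `U(3,5)`. -/
def NoUniform (P : PivotSystem K α) : Prop :=
  (∀ B, P.IsBase B → ∀ x y u v w, x ∈ B → y ∈ B → u ∉ B → v ∉ B → w ∉ B →
    P.coef B x u ≠ 0 → P.coef B x v ≠ 0 → P.coef B x w ≠ 0 →
    P.coef B y u ≠ 0 → P.coef B y v ≠ 0 → P.coef B y w ≠ 0 →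
    P.coef B x u * P.coef B y v = P.coef B x v * P.coef B y u ∨
    P.coef B x u * P.coef B y w = P.coef B x w * P.coef B y u ∨
    P.coef B x v * P.coef B y w = P.coef B x w * P.coef B y v) ∧
  (∀ B, P.IsBase B → ∀ x y z u v, x ∈ B → y ∈ B → z ∈ B → u ∉ B → v ∉ B →
    P.coef B x u ≠ 0 → P.coef B y u ≠ 0 → P.coef B z u ≠ 0 →
    P.coef B x v ≠ 0 → P.coef B y v ≠ 0 → P.coef B z v ≠ 0 →
    P.coef B x u * P.coef B y v = P.coef B x v * P.coef B y u ∨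
    P.coef B x u * P.coef B z v = P.coef B x v * P.coef B z u ∨
    P.coef B y u * P.coef B z v = P.coef B y v * P.coef B z u)

lemma Agree.compl [Fintype α] (h : Agree S B B₀) : Agree S Bᶜ B₀ᶜ := by
  intro z hz
  simp [h z hz]

lemma dual_cr [Fintype α] : P.dual.cr B x y u v = P.cr Bᶜ u v x y := by
  simp only [cr, dual, neg_mul_neg]
  ring

lemma NoUniform.dual [Fintype α] (h : P.NoUniform) : P.dual.NoUniform := by
  refine ⟨fun B hB x y u v w hx hy hu hv hw h1 h2 h3 h4 h5 h6 => ?_,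
    fun B hB x y z u v hx hy hz hu hv h1 h2 h3 h4 h5 h6 => ?_⟩ <;>
    simp only [PivotSystem.dual, neg_ne_zero, neg_mul_neg] at *
  · have := h.2 Bᶜ hB u v w x y (by simpa) (by simpa) (by simpa) (by simpa) (by simpa) h1 h2 h3
      h4 h5 h6
    exact this.imp (·.trans (mul_comm _ _)) (Or.imp (·.trans (mul_comm _ _))
      (·.trans (mul_comm _ _)))
  · have := h.1 Bᶜ hB u v x y z (by simpa) (by simpa) (by simpa) (by simpa) (by simpa) h1 h2 h3
      h4 h5 h6
    exact this.imp (·.trans (mul_comm _ _)) (Or.imp (·.trans (mul_comm _ _))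
      (·.trans (mul_comm _ _)))

lemma Lifts.of_dual [Fintype α] (h : Lifts lam P.dual Q S B₀ᶜ) : Lifts lam P Q.dual S B₀ := by
  have e : ∀ B, P.dual.IsBase Bᶜ ↔ P.IsBase B := fun B => by simp [PivotSystem.dual]
  refine ⟨fun B hA => ?_, fun B hA hB x y u v hx hxS hy hyS hu huS hv hvS h1 h2 h3 h4 => ?_⟩
  · rw [← e B]
    exact h.1 Bᶜ (Agree.compl hA)
  · rw [dual_cr, h.2 Bᶜ (Agree.compl hA) ((e B).2 hB) u v x y (by simpa) huS (by simpa) hvS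
      (by simpa) hxS (by simpa) hyS, dual_cr, compl_compl]
    all_goals simp only [PivotSystem.dual, compl_compl, neg_ne_zero]; assumption

end PivotSystem
end Lifting

section BlockSmall

variable {K F α : Type*} [Field K] [Field F] [DecidableEq α]

namespace PivotSystem

variable {P : PivotSystem K α} {Q R : PivotSystem F α} {S S₁ S₂ T B B₀ : Finset α} {lam : K → F}
  {σ : α → F} {x y u v p q : α}

/-- The set that agrees with `B` on `S` and with `B₀` off `S`. -/
def restrictTo (S B B₀ : Finset α) : Finset α := (B ∩ S) ∪ (B₀ \ S)

lemma mem_restrictTo {z : α} : z ∈ restrictTo S B B₀ ↔ z ∈ S ∧ z ∈ B ∨ z ∉ S ∧ z ∈ B₀ := by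
  simp only [restrictTo, Finset.mem_union, Finset.mem_inter, Finset.mem_sdiff]
  tauto

lemma restrictTo_agree : Agree S (restrictTo S B B₀) B₀ := by
  intro z hz
  rw [mem_restrictTo]
  tauto

lemma restrictTo_swap (hp : p ∈ S) (hq : q ∈ S) :
    restrictTo S (swap B p q) B₀ = swap (restrictTo S B B₀) p q := by
  ext z
  simp only [mem_restrictTo, mem_swap]
  grind

lemma restrictTo_swap_of_notMem (hp : p ∉ S) (hq : q ∉ S) :
    restrictTo S (swap B p q) B₀ = restrictTo S B B₀ := by
  ext z
  simp only [mem_restrictTo, mem_swap]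
  grind

lemma restrictTo_self : restrictTo S B B = B := by
  ext z
  rw [mem_restrictTo]
  tauto

/-- The part of the splitting condition `IsSplit` that concerns the rows in `S₁`. -/
def IsHalfSplit (P : PivotSystem K α) (S₁ S₂ B₀ B : Finset α) : Prop :=
  P.IsBase (restrictTo S₁ B B₀) ∧
  (∀ i ∈ B, i ∈ S₁ → ∀ e ∉ B, e ∈ S₁ → P.coef B i e = P.coef (restrictTo S₁ B B₀) i e) ∧
  (∀ i ∈ B, i ∈ S₁ → ∀ e ∉ B, e ∈ S₂ → P.coef B i e = 0)

/-- The standard matrix of `B` splits on `S₁ ∪ S₂`. -/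
def IsSplit (P : PivotSystem K α) (S₁ S₂ B₀ B : Finset α) : Prop :=
  P.IsBase B ∧ P.IsHalfSplit S₁ S₂ B₀ B ∧ P.IsHalfSplit S₂ S₁ B₀ B

lemma IsSplit.symm (h : P.IsSplit S₁ S₂ B₀ B) : P.IsSplit S₂ S₁ B₀ B := ⟨h.1, h.2.2, h.2.1⟩

lemma isSplit_self (hB₀ : P.IsBase B₀)
    (h : ∀ i ∈ B₀, i ∈ S₁ → ∀ e ∉ B₀, e ∈ S₂ → P.coef B₀ i e = 0)
    (h' : ∀ i ∈ B₀, i ∈ S₂ → ∀ e ∉ B₀, e ∈ S₁ → P.coef B₀ i e = 0) :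
    P.IsSplit S₁ S₂ B₀ B₀ := by
  simp only [IsSplit, IsHalfSplit, restrictTo_self]
  exact ⟨hB₀, ⟨hB₀, fun _ _ _ _ _ _ => trivial, h⟩, ⟨hB₀, fun _ _ _ _ _ _ => trivial, h'⟩⟩

lemma IsSplit.swap (hd : Disjoint S₁ S₂) (h : P.IsSplit S₁ S₂ B₀ B) (hp : p ∈ B) (hpS : p ∈ S₁)
    (hq : q ∉ B) (hqS : q ∈ S₁) (hpq : P.coef B p q ≠ 0) :
    P.IsSplit S₁ S₂ B₀ (swap B p q) := by
  obtain ⟨hB, ⟨h1, h2, h3⟩, h4, h5, h6⟩ := h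
  have hp2 : p ∉ S₂ := Finset.disjoint_left.1 hd hpS
  have hq2 : q ∉ S₂ := Finset.disjoint_left.1 hd hqS
  have hpR : p ∈ restrictTo S₁ B B₀ := by rw [mem_restrictTo]; tauto
  have hqR : q ∉ restrictTo S₁ B B₀ := by rw [mem_restrictTo]; tauto
  have hpqR : P.coef (restrictTo S₁ B B₀) p q ≠ 0 := by rwa [← h2 p hp hpS q hq hqS]
  have hiR : ∀ i ∈ S₁, (i ∈ restrictTo S₁ B B₀ ↔ i ∈ B) := fun i hi => by
    rw [mem_restrictTo]; tauto
  refine ⟨swap_isBase hB hp hq hpq, ⟨?_, ?_, ?_⟩, ?_, ?_, ?_⟩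
  · rw [restrictTo_swap hpS hqS]
    exact swap_isBase h1 hpR hqR hpqR
  · intro i hi hiS e he heS
    rw [restrictTo_swap hpS hqS]
    have he' : e = p ∨ e ≠ p ∧ e ∉ B := by rw [mem_swap] at he; grind
    have heq : e ≠ q := by rw [mem_swap] at he; grind
    rcases mem_swap.1 hi with rfl | ⟨hip, hiB⟩ <;> rcases he' with rfl | ⟨hep, heB⟩
    · rw [P.coef_new hB hp hq hpq, P.coef_new h1 hpR hqR hpqR, h2 e hp hpS i hq hqS]
    · rw [P.coef_row hB hp hq hpq heB heq,
        P.coef_row h1 hpR hqR hpqR (by rwa [hiR e heS]) heq, h2 p hp hpS i hq hqS,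
        h2 p hp hpS e heB heS]
    · rw [P.coef_col hB hp hq hpq hiB hip,
        P.coef_col h1 hpR hqR hpqR (by rwa [hiR i hiS]) hip, h2 e hp hpS q hq hqS,
        h2 i hiB hiS q hq hqS]
    · rw [P.coef_rest hB hp hq hpq hiB hip heB heq,
        P.coef_rest h1 hpR hqR hpqR (by rwa [hiR i hiS]) hip (by rwa [hiR e heS]) heq,
        h2 p hp hpS q hq hqS, h2 i hiB hiS q hq hqS, h2 p hp hpS e heB heS, h2 i hiB hiS e heB heS]
  · intro i hi hiS e he heS
    have heB : e ∉ B := fun h => he (mem_swap.2 (Or.inr ⟨fun h' => hp2 (h' ▸ heS), h⟩))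
    have heq : e ≠ q := fun h' => hq2 (h' ▸ heS)
    rcases mem_swap.1 hi with rfl | ⟨hip, hiB⟩
    · rw [P.coef_row hB hp hq hpq heB heq, h3 p hp hpS e heB heS, zero_div]
    · rw [P.coef_rest hB hp hq hpq hiB hip heB heq, h3 p hp hpS e heB heS, h3 i hiB hiS e heB heS]
      simp
  · rwa [restrictTo_swap_of_notMem hp2 hq2]
  · intro i hi hiS e he heS
    rw [restrictTo_swap_of_notMem hp2 hq2]
    have hip : i ≠ p := fun h' => hp2 (h' ▸ hiS)
    have hiB : i ∈ B := by
      rcases mem_swap.1 hi with rfl | h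
      · exact absurd hiS hq2
      · exact h.2
    have heB : e ∉ B := fun h => he (mem_swap.2 (Or.inr ⟨fun h' => hp2 (h' ▸ heS), h⟩))
    have heq : e ≠ q := fun h' => hq2 (h' ▸ heS)
    rw [P.coef_rest hB hp hq hpq hiB hip heB heq, h6 i hiB hiS q hq hqS, h5 i hiB hiS e heB heS]
    simp
  · intro i hi hiS e he heS
    have hip : i ≠ p := fun h' => hp2 (h' ▸ hiS)
    have hiB : i ∈ B := by
      rcases mem_swap.1 hi with rfl | h
      · exact absurd hiS hq2
      · exact h.2
    by_cases hep : e = p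
    · rw [hep, P.coef_col hB hp hq hpq hiB hip, h6 i hiB hiS q hq hqS]
      simp
    · have heB : e ∉ B := fun h => he (mem_swap.2 (Or.inr ⟨hep, h⟩))
      have heq : e ≠ q := by rw [mem_swap] at he; grind
      rw [P.coef_rest hB hp hq hpq hiB hip heB heq, h6 i hiB hiS q hq hqS, h6 i hiB hiS e heB heS]
      simp

section

variable {K' : Type*} [Field K'] {Q : PivotSystem K' α}

lemma IsSplit.face (hd : Disjoint S₁ S₂) (h1 : ∀ B, Agree S₁ B B₀ → (P.IsBase B ↔ Q.IsBase B))
    (h2 : ∀ B, Agree S₂ B B₀ → (P.IsBase B ↔ Q.IsBase B)) (hP : P.IsSplit S₁ S₂ B₀ B₀)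
    (hQ : Q.IsSplit S₁ S₂ B₀ B₀) (hB : P.IsBase B) (hA : Agree (S₁ ∪ S₂) B B₀) :
    P.IsSplit S₁ S₂ B₀ B ∧ Q.IsSplit S₁ S₂ B₀ B := by
  refine face_induction (P := P) (S := S₁ ∪ S₂)
    (motive := fun B => P.IsSplit S₁ S₂ B₀ B ∧ Q.IsSplit S₁ S₂ B₀ B) hP.1 ⟨hP, hQ⟩ ?_ hB hA
  have key : ∀ S₁ S₂ : Finset α, Disjoint S₁ S₂ →
      (∀ B, Agree S₁ B B₀ → (P.IsBase B ↔ Q.IsBase B)) → ∀ B p q, P.IsSplit S₁ S₂ B₀ B →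
      Q.IsSplit S₁ S₂ B₀ B → p ∈ B → p ∈ S₁ → q ∉ B → q ∈ S₁ → P.coef B p q ≠ 0 →
      P.IsSplit S₁ S₂ B₀ (Paper.swap B p q) ∧ Q.IsSplit S₁ S₂ B₀ (Paper.swap B p q) := by
    intro S₁ S₂ hd h1 B p q hPB hQB hp hpS hq hqS hpq
    refine ⟨hPB.swap hd hp hpS hq hqS hpq, hQB.swap hd hp hpS hq hqS ?_⟩
    have hpR : p ∈ restrictTo S₁ B B₀ := by rw [mem_restrictTo]; tauto
    have hqR : q ∉ restrictTo S₁ B B₀ := by rw [mem_restrictTo]; tauto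
    rw [hPB.2.1.2.1 p hp hpS q hq hqS, ← P.swap_iff hPB.2.1.1 hpR hqR,
      h1 _ (restrictTo_agree.swap_left hpS hqS), Q.swap_iff hQB.2.1.1 hpR hqR] at hpq
    rwa [hQB.2.1.2.1 p hp hpS q hq hqS]
  rintro B p q hB hA ⟨hPB, hQB⟩ hp hpS hq hqS hpq
  rcases Finset.mem_union.1 hpS with hpS | hpS <;> rcases Finset.mem_union.1 hqS with hqS | hqS
  · exact key S₁ S₂ hd h1 B p q hPB hQB hp hpS hq hqS hpq
  · exact absurd (hPB.2.1.2.2 p hp hpS q hq hqS) hpq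
  · exact absurd (hPB.2.2.2.2 p hp hpS q hq hqS) hpq
  · obtain ⟨g1, g2⟩ := key S₂ S₁ hd.symm h2 B p q hPB.symm hQB.symm hp hpS hq hqS hpq
    exact ⟨g1.symm, g2.symm⟩

end

lemma Lifts.union (hd : Disjoint S₁ S₂) (h1 : Lifts lam P Q S₁ B₀) (h2 : Lifts lam P Q S₂ B₀)
    (hP : P.IsSplit S₁ S₂ B₀ B₀) (hQ : Q.IsSplit S₁ S₂ B₀ B₀) : Lifts lam P Q (S₁ ∪ S₂) B₀ := by
  refine ⟨fun B hA => ⟨fun hB => (IsSplit.face hd h1.1 h2.1 hP hQ hB hA).2.1, fun hB =>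
    (IsSplit.face hd (fun B hA => (h1.1 B hA).symm) (fun B hA => (h2.1 B hA).symm) hQ hP hB
      hA).2.1⟩, ?_⟩
  intro B hA hB x y u v hx hxS hy hyS hu huS hv hvS hxu hxv hyu hyv
  obtain ⟨hPB, hQB⟩ := IsSplit.face hd h1.1 h2.1 hP hQ hB hA
  have key : ∀ S₁ S₂ : Finset α, Lifts lam P Q S₁ B₀ → P.IsSplit S₁ S₂ B₀ B →
      Q.IsSplit S₁ S₂ B₀ B → x ∈ S₁ → (y ∈ S₁ ∨ y ∈ S₂) → (u ∈ S₁ ∨ u ∈ S₂) →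
      (v ∈ S₁ ∨ v ∈ S₂) → Q.cr B x y u v = lam (P.cr B x y u v) := by
    intro S₁ S₂ h1 hPB hQB hxS hyS huS hvS
    have huS : u ∈ S₁ := huS.resolve_right fun h => hxu (hPB.2.1.2.2 x hx hxS u hu h)
    have hvS : v ∈ S₁ := hvS.resolve_right fun h => hxv (hPB.2.1.2.2 x hx hxS v hv h)
    have hyS : y ∈ S₁ := hyS.resolve_right fun h => hyu (hPB.2.2.2.2 y hy h u hu huS)
    obtain ⟨e1, e2, -⟩ := hPB.2.1
    obtain ⟨-, e3, -⟩ := hQB.2.1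
    rw [e2 x hx hxS u hu huS] at hxu
    rw [e2 x hx hxS v hv hvS] at hxv
    rw [e2 y hy hyS u hu huS] at hyu
    rw [e2 y hy hyS v hv hvS] at hyv
    simp only [cr]
    rw [e2 x hx hxS u hu huS, e2 x hx hxS v hv hvS, e2 y hy hyS u hu huS, e2 y hy hyS v hv hvS,
      e3 x hx hxS u hu huS, e3 x hx hxS v hv hvS, e3 y hy hyS u hu huS, e3 y hy hyS v hv hvS]
    exact h1.2 _ restrictTo_agree e1 x y u v (by rw [mem_restrictTo]; tauto) hxS
      (by rw [mem_restrictTo]; tauto) hyS (by rw [mem_restrictTo]; tauto) huS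
      (by rw [mem_restrictTo]; tauto) hvS hxu hxv hyu hyv
  rw [Finset.mem_union] at hxS hyS huS hvS
  rcases hxS with hxS | hxS
  · exact key S₁ S₂ h1 hPB hQB hxS hyS huS hvS
  · exact key S₂ S₁ h2 hPB.symm hQB.symm hxS hyS.symm huS.symm hvS.symm

/-- Lifts of the two sides of a separation combine. -/
lemma exists_lift_union (hB₀ : P.IsBase B₀) (hd : Disjoint S₁ S₂)
    (h : ∀ p ∈ S₁, ∀ q ∈ S₂, ¬ (P.graph (S₁ ∪ S₂) B₀).Adj p q) {Q₁ Q₂ : PivotSystem F α}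
    (h1 : Lifts lam P Q₁ S₁ B₀) (h2 : Lifts lam P Q₂ S₂ B₀) :
    ∃ Q : PivotSystem F α, Lifts lam P Q (S₁ ∪ S₂) B₀ := by
  let A : α → α → F := fun p q => if p ∈ S₁ ∧ q ∈ S₁ then Q₁.coef B₀ p q else
    if p ∈ S₂ ∧ q ∈ S₂ then Q₂.coef B₀ p q else 0
  have hQ := matrixSystem_isBase B₀ A
  have hnd : ∀ z ∈ S₁, z ∉ S₂ := fun z hz => Finset.disjoint_left.1 hd hz
  refine ⟨matrixSystem B₀ A, Lifts.union hd ?_ ?_ ?_ ?_⟩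
  · refine h1.of_scaled hB₀ (fun _ => one_ne_zero) hQ fun p hp hpS q hq hqS => ?_
    rw [matrixSystem_coef hp hq]
    simp [A, hpS, hqS]
  · refine h2.of_scaled hB₀ (fun _ => one_ne_zero) hQ fun p hp hpS q hq hqS => ?_
    rw [matrixSystem_coef hp hq]
    have : p ∉ S₁ := fun h => hnd p h hpS
    simp [A, hpS, hqS, this]
  · refine isSplit_self hB₀ (fun i hi hiS e he heS => ?_) (fun i hi hiS e he heS => ?_)
    · by_contra h0
      exact h i hiS e heS (graph_adj.2 ⟨by simp [hiS], by simp [heS], Or.inl ⟨hi, he, h0⟩⟩)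
    · by_contra h0
      exact h e heS i hiS (graph_adj.2 ⟨by simp [heS], by simp [hiS], Or.inr ⟨hi, he, h0⟩⟩)
  · refine isSplit_self hQ (fun i hi hiS e he heS => ?_) (fun i hi hiS e he heS => ?_)
    · rw [matrixSystem_coef hi he]
      have h1 : e ∉ S₁ := fun h => hnd e h heS
      have h2 : i ∉ S₂ := hnd i hiS
      simp [A, h1, h2]
    · rw [matrixSystem_coef hi he]
      have h1 : i ∉ S₁ := fun h => hnd i h hiS
      have h2 : e ∉ S₂ := hnd e heS
      simp [A, h1, h2]

/-- The standard matrices of `B` have the same support and corresponding cross ratios. -/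
def Matches (lam : K → F) (P : PivotSystem K α) (Q : PivotSystem F α) (S B : Finset α) : Prop :=
  (∀ x u, x ∈ B → x ∈ S → u ∉ B → u ∈ S → (Q.coef B x u = 0 ↔ P.coef B x u = 0)) ∧
  ∀ x y u v, x ≠ y → u ≠ v → x ∈ B → x ∈ S → y ∈ B → y ∈ S → u ∉ B → u ∈ S →
    v ∉ B → v ∈ S → P.coef B x u ≠ 0 → P.coef B x v ≠ 0 → P.coef B y u ≠ 0 → P.coef B y v ≠ 0 →
    Q.cr B x y u v = lam (P.cr B x y u v)

lemma Lifts.of_matches (hlam : IsCrossRatioMap lam) {motive : Finset α → Prop} (hP : P.IsBase B₀)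
    (hQ : Q.IsBase B₀) (h0 : motive B₀)
    (hm : ∀ B, P.IsBase B → Q.IsBase B → motive B → Matches lam P Q S B)
    (step : ∀ B p q, P.IsBase B → Q.IsBase B → motive B → p ∈ B → p ∈ S → q ∉ B → q ∈ S →
      P.coef B p q ≠ 0 → Q.coef B p q ≠ 0 → motive (swap B p q)) : Lifts lam P Q S B₀ := by
  have h1 : ∀ B, Agree S B B₀ → P.IsBase B → Q.IsBase B ∧ motive B := by
    intro B hA hB
    refine face_induction (P := P) (S := S) (motive := fun B => Q.IsBase B ∧ motive B)
      hP ⟨hQ, h0⟩ ?_ hB hA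
    rintro B p q hB - ⟨hQB, hmB⟩ hp hpS hq hqS hpq
    have : Q.coef B p q ≠ 0 := by rwa [ne_eq, (hm B hB hQB hmB).1 p q hp hpS hq hqS]
    exact ⟨swap_isBase hQB hp hq this, step B p q hB hQB hmB hp hpS hq hqS hpq this⟩
  have h2 : ∀ B, Agree S B B₀ → Q.IsBase B → P.IsBase B := by
    intro B hA hB
    refine (face_induction (P := Q) (S := S) (motive := fun B => P.IsBase B ∧ motive B)
      hQ ⟨hP, h0⟩ ?_ hB hA).1
    rintro B p q hB - ⟨hPB, hmB⟩ hp hpS hq hqS hpq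
    have : P.coef B p q ≠ 0 := by rwa [ne_eq, ← (hm B hPB hB hmB).1 p q hp hpS hq hqS]
    exact ⟨swap_isBase hPB hp hq this, step B p q hPB hB hmB hp hpS hq hqS this hpq⟩
  refine ⟨fun B hA => ⟨fun h => (h1 B hA h).1, h2 B hA⟩, ?_⟩
  intro B hA hB x y u v hx hxS hy hyS hu huS hv hvS hxu hxv hyu hyv
  obtain ⟨hQB, hmB⟩ := h1 B hA hB
  obtain ⟨hs, hc⟩ := hm B hB hQB hmB
  by_cases hxy : x = y
  · subst hxy
    rw [cr_self_left hxu hxv, hlam.map_one, cr_self_left]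
    · rwa [ne_eq, hs x u hx hxS hu huS]
    · rwa [ne_eq, hs x v hx hxS hv hvS]
  by_cases huv : u = v
  · subst huv
    rw [cr_self_right hxu hyu, hlam.map_one, cr_self_right]
    · rwa [ne_eq, hs x u hx hxS hu huS]
    · rwa [ne_eq, hs y u hy hyS hu huS]
  exact hc x y u v hxy huv hx hxS hy hyS hu huS hv hvS hxu hxv hyu hyv

end PivotSystem
end BlockSmall

section Small

variable {K F α : Type*} [Field K] [Field F] [DecidableEq α]

/-- There are at most one row, or at most one column, or two rows and two columns in `S`. -/
def IsSmall (S B : Finset α) : Prop :=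
  (S ∩ B).card ≤ 1 ∨ (S \ B).card ≤ 1 ∨ (S ∩ B).card ≤ 2 ∧ (S \ B).card ≤ 2

lemma IsSmall.swap {S B : Finset α} {p q : α} (h : IsSmall S B) (hp : p ∈ B) (hpS : p ∈ S)
    (hq : q ∉ B) (hqS : q ∈ S) : IsSmall S (swap B p q) := by
  have h1 : S ∩ Paper.swap B p q = Paper.swap (S ∩ B) p q := by
    ext z
    simp only [Finset.mem_inter, mem_swap]
    grind
  have h2 : S \ Paper.swap B p q = Paper.swap (S \ B) q p := by
    ext z
    simp only [Finset.mem_sdiff, mem_swap]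
    grind
  rw [IsSmall, h1, h2, PivotSystem.card_swap (by simp [hp, hpS]) (by simp [hq]),
    PivotSystem.card_swap (by simp [hq, hqS]) (by simp [hp])]
  exact h

lemma eq_or_eq_of_card_le_two {s : Finset α} (h : s.card ≤ 2) {a b c : α} (ha : a ∈ s) (hb : b ∈ s)
    (hab : a ≠ b) (hc : c ∈ s) : c = a ∨ c = b := by
  by_contra! hne
  have : ({a, b, c} : Finset α).card ≤ s.card := Finset.card_le_card (by
    intro z
    simp only [Finset.mem_insert, Finset.mem_singleton]
    rintro (rfl | rfl | rfl) <;> assumption)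
  rw [Finset.card_insert_of_notMem (by simp [hab, hne.1.symm]),
    Finset.card_insert_of_notMem (by simp [hne.2.symm]), Finset.card_singleton] at this
  omega

namespace PivotSystem

variable {P : PivotSystem K α} {Q : PivotSystem F α} {S B B₀ : Finset α} {lam : K → F}
  {x y u v p q i e : α}

/-- The effect of a pivot on a cross ratio involving the pivot. -/
lemma cr_swap_pivot (hB : P.IsBase B) (hp : p ∈ B) (hq : q ∉ B) (hpq : P.coef B p q ≠ 0)
    (hi : i ∈ B) (hip : i ≠ p) (he : e ∉ B) (heq : e ≠ q) (hpe : P.coef B p e ≠ 0)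
    (hiq : P.coef B i q ≠ 0) :
    P.cr (swap B p q) q i p e = 1 - P.coef B p q * P.coef B i e / (P.coef B p e * P.coef B i q) := by
  simp only [cr]
  rw [P.coef_new hB hp hq hpq, P.coef_row hB hp hq hpq he heq, P.coef_col hB hp hq hpq hi hip,
    P.coef_rest hB hp hq hpq hi hip he heq]
  field_simp
  ring

lemma Matches.swap (hlam : IsCrossRatioMap lam) (h : Matches lam P Q S B) (hP : P.IsBase B)
    (hQ : Q.IsBase B) (hS : IsSmall S B) (hp : p ∈ B) (hpS : p ∈ S) (hq : q ∉ B) (hqS : q ∈ S)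
    (hpq : P.coef B p q ≠ 0) : Matches lam P Q S (swap B p q) := by
  obtain ⟨hs, hc⟩ := h
  have hs' : ∀ x u, x ∈ B → x ∈ S → u ∉ B → u ∈ S → P.coef B x u ≠ 0 → Q.coef B x u ≠ 0 :=
    fun x u hx hxS hu huS h h' => h ((hs x u hx hxS hu huS).1 h')
  have hQpq := hs' p q hp hpS hq hqS hpq
  have hs2 : ∀ i ∈ B, i ∈ S → i ≠ p → ∀ e ∉ B, e ∈ S → e ≠ q →
      (Q.coef (Paper.swap B p q) i e = 0 ↔ P.coef (Paper.swap B p q) i e = 0) := by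
    intro i hi hiS hip e he heS heq
    rw [P.coef_rest hP hp hq hpq hi hip he heq, Q.coef_rest hQ hp hq hQpq hi hip he heq]
    have e1 := hs i e hi hiS he heS
    by_cases h1 : P.coef B i q = 0
    · simp [h1, (hs i q hi hiS hq hqS).2 h1, e1]
    by_cases h2 : P.coef B p e = 0
    · simp [h2, (hs p e hp hpS he heS).2 h2, e1]
    have h1' := hs' i q hi hiS hq hqS h1
    have h2' := hs' p e hp hpS he heS h2
    by_cases h3 : P.coef B i e = 0
    · simp [h3, e1.2 h3, h1, h2, h1', h2', hpq, hQpq]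
    have h3' := hs' i e hi hiS he heS h3
    have e2 := hc p i q e hip.symm heq.symm hp hpS hi hiS hq hqS he heS hpq h2 h1 h3
    have e3 : P.cr B p i q e = 1 ↔ Q.cr B p i q e = 1 :=
      ⟨fun h => by rw [e2, h, hlam.map_one], fun h => hlam.eq_one (e2.symm.trans h)⟩
    rw [cr_eq_one_iff h2 h1, cr_eq_one_iff h2' h1'] at e3
    rw [sub_eq_zero, sub_eq_zero, eq_div_iff hpq, eq_div_iff hQpq]
    constructor
    · intro h
      linear_combination e3.2 (by linear_combination h)
    · intro h
      linear_combination e3.1 (by linear_combination h)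
  constructor
  · intro i e hi hiS he heS
    have he' : e = p ∨ e ≠ p ∧ e ∉ B := by rw [mem_swap] at he; grind
    have heq : e ≠ q := by rw [mem_swap] at he; grind
    rcases mem_swap.1 hi with rfl | ⟨hip, hiB⟩ <;> rcases he' with rfl | ⟨hep, heB⟩
    · rw [P.coef_new hP hp hq hpq, Q.coef_new hQ hp hq hQpq]
      simp [hpq, hQpq]
    · rw [P.coef_row hP hp hq hpq heB heq, Q.coef_row hQ hp hq hQpq heB heq]
      simp [hpq, hQpq, hs p e hp hpS heB heS]
    · rw [P.coef_col hP hp hq hpq hiB hip, Q.coef_col hQ hp hq hQpq hiB hip]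
      simp [hpq, hQpq, hs i q hiB hiS hq hqS]
    · exact hs2 i hiB hiS hip e heB heS heq
  · have hS' := hS.swap hp hpS hq hqS
    have hqB' : q ∈ Paper.swap B p q := mem_swap.2 (Or.inl rfl)
    have hpB' : p ∉ Paper.swap B p q := by rw [mem_swap]; grind
    -- the normalised case
    have key : ∀ i e, i ∈ Paper.swap B p q → i ∈ S → i ≠ q → e ∉ Paper.swap B p q → e ∈ S →
        e ≠ p → P.coef (Paper.swap B p q) q e ≠ 0 → P.coef (Paper.swap B p q) i p ≠ 0 →
        Q.cr (Paper.swap B p q) q i p e = lam (P.cr (Paper.swap B p q) q i p e) := by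
      intro i e hi hiS hiq he heS hep hqe hip'
      have hi' := (mem_swap.1 hi).resolve_left hiq
      have heB : e ∉ B := fun h => he (mem_swap.2 (Or.inr ⟨hep, h⟩))
      have heq : e ≠ q := fun h => he (mem_swap.2 (Or.inl h))
      have h2 : P.coef B p e ≠ 0 := fun h => hqe (by rw [P.coef_row hP hp hq hpq heB heq, h, zero_div])
      have h1 : P.coef B i q ≠ 0 := fun h => hip' (by
        rw [P.coef_col hP hp hq hpq hi'.2 hi'.1, h, neg_zero, zero_div])
      have h1' := hs' i q hi'.2 hiS hq hqS h1
      have h2' := hs' p e hp hpS heB heS h2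
      rw [cr_swap_pivot hP hp hq hpq hi'.2 hi'.1 heB heq h2 h1,
        cr_swap_pivot hQ hp hq hQpq hi'.2 hi'.1 heB heq h2' h1', hlam.map_one_sub]
      congr 1
      by_cases h3 : P.coef B i e = 0
      · rw [h3, (hs i e hi'.2 hiS heB heS).2 h3]
        simp [hlam.map_zero]
      · exact hc p i q e hi'.1.symm heq.symm hp hpS hi'.2 hiS hq hqS heB heS hpq h2 h1 h3
    intro x y u v hxy huv hx hxS hy hyS hu huS hv hvS hxu hxv hyu hyv
    have hxy2 : 2 ≤ (S ∩ Paper.swap B p q).card := by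
      rw [← Finset.card_pair hxy]
      exact Finset.card_le_card (by simp [Finset.insert_subset_iff, *])
    have huv2 : 2 ≤ (S \ Paper.swap B p q).card := by
      rw [← Finset.card_pair huv]
      exact Finset.card_le_card (by simp [Finset.insert_subset_iff, *])
    obtain ⟨c1, c2⟩ : (S ∩ Paper.swap B p q).card ≤ 2 ∧ (S \ Paper.swap B p q).card ≤ 2 := by
      rcases hS' with h | h | h
      · omega
      · omega
      · exact h
    have hqxy := eq_or_eq_of_card_le_two c1 (a := x) (b := y) (c := q) (by simp [*]) (by simp [*])
      hxy (by simp [*])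
    have hpuv := eq_or_eq_of_card_le_two c2 (a := u) (b := v) (c := p) (by simp [*]) (by simp [*])
      huv (by simp [*])
    rcases hqxy with rfl | rfl <;> rcases hpuv with rfl | rfl
    · exact key y v hy hyS hxy.symm hv hvS huv.symm hxv hyu
    · rw [cr_swap_right, cr_swap_right (u := p), hlam.map_inv,
        key y u hy hyS hxy.symm hu huS huv hxu hyv]
    · rw [cr_swap_left, cr_swap_left (x := q), hlam.map_inv,
        key x v hx hxS hxy hv hvS huv.symm hyv hxu]
    · rw [cr_swap_left, cr_swap_left (x := q), cr_swap_right, cr_swap_right (u := p), inv_inv,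
        inv_inv, key x u hx hxS hxy hu huS huv hyu hxv]

lemma exists_lift_of_isSmall (hlam : IsCrossRatioMap lam) (hP : P.IsBase B₀) (hS : IsSmall S B₀) :
    ∃ Q : PivotSystem F α, Lifts lam P Q S B₀ := by
  classical
  suffices h : ∃ A : α → α → F, Matches lam P (matrixSystem B₀ A) S B₀ by
    obtain ⟨A, hA⟩ := h
    refine ⟨matrixSystem B₀ A, Lifts.of_matches hlam
      (motive := fun B => Matches lam P (matrixSystem B₀ A) S B ∧ IsSmall S B) hP
      (matrixSystem_isBase B₀ A) ⟨hA, hS⟩ (fun B _ _ h => h.1) ?_⟩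
    intro B p q hB hQ h hp hpS hq hqS hpq _
    exact ⟨h.1.swap hlam hB hQ h.2 hp hpS hq hqS hpq, h.2.swap hp hpS hq hqS⟩
  by_cases hex : ∃ x y u v, x ≠ y ∧ u ≠ v ∧ x ∈ B₀ ∧ x ∈ S ∧ y ∈ B₀ ∧ y ∈ S ∧ u ∉ B₀ ∧ u ∈ S ∧
      v ∉ B₀ ∧ v ∈ S ∧ P.coef B₀ x u ≠ 0 ∧ P.coef B₀ x v ≠ 0 ∧ P.coef B₀ y u ≠ 0 ∧
      P.coef B₀ y v ≠ 0
  · obtain ⟨x, y, u, v, hxy, huv, hx, hxS, hy, hyS, hu, huS, hv, hvS, hxu, hxv, hyu, hyv⟩ := hex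
    have hxy2 : 2 ≤ (S ∩ B₀).card := by
      rw [← Finset.card_pair hxy]
      exact Finset.card_le_card (by simp [Finset.insert_subset_iff, *])
    have huv2 : 2 ≤ (S \ B₀).card := by
      rw [← Finset.card_pair huv]
      exact Finset.card_le_card (by simp [Finset.insert_subset_iff, *])
    obtain ⟨c1, c2⟩ : (S ∩ B₀).card ≤ 2 ∧ (S \ B₀).card ≤ 2 := by
      rcases hS with h | h | h
      · omega
      · omega
      · exact h
    have hcr := cr_ne_zero hxu hxv hyu hyv
    have hl : lam (P.cr B₀ x y u v) ≠ 0 := fun h => hcr (hlam.eq_zero h)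
    let A : α → α → F := fun p q => if P.coef B₀ p q = 0 then 0 else
      if p = x ∧ q = u then lam (P.cr B₀ x y u v) else 1
    have key : (matrixSystem B₀ A).cr B₀ x y u v = lam (P.cr B₀ x y u v) := by
      simp only [cr]
      rw [matrixSystem_coef hx hu, matrixSystem_coef hx hv, matrixSystem_coef hy hu,
        matrixSystem_coef hy hv]
      simp [A, hxu, hxv, hyu, hyv, hxy.symm, huv.symm, cr]
    refine ⟨A, fun p q hp hpS hq hqS => ?_, ?_⟩
    · rw [matrixSystem_coef hp hq]
      simp only [A]
      split_ifs <;> simp_all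
    · intro x' y' u' v' hxy' huv' hx' hxS' hy' hyS' hu' huS' hv' hvS' _ _ _ _
      have e1 := eq_or_eq_of_card_le_two c1 (a := x) (b := y) (c := x') (by simp [*]) (by simp [*])
        hxy (by simp [*])
      have e2 := eq_or_eq_of_card_le_two c1 (a := x) (b := y) (c := y') (by simp [*]) (by simp [*])
        hxy (by simp [*])
      have e3 := eq_or_eq_of_card_le_two c2 (a := u) (b := v) (c := u') (by simp [*]) (by simp [*])
        huv (by simp [*])
      have e4 := eq_or_eq_of_card_le_two c2 (a := u) (b := v) (c := v') (by simp [*]) (by simp [*])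
        huv (by simp [*])
      clear_value A
      rcases e1 with rfl | rfl <;> rcases e2 with rfl | rfl
      · exact absurd rfl hxy'
      · rcases e3 with rfl | rfl <;> rcases e4 with rfl | rfl
        · exact absurd rfl huv'
        · exact key
        · rw [cr_swap_right, cr_swap_right (u := v'), key, hlam.map_inv]
        · exact absurd rfl huv'
      · rcases e3 with rfl | rfl <;> rcases e4 with rfl | rfl
        · exact absurd rfl huv'
        · rw [cr_swap_left, cr_swap_left (x := y'), key, hlam.map_inv]
        · rw [cr_swap_left, cr_swap_left (x := y'), cr_swap_right, cr_swap_right (u := v'), key,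
            inv_inv, inv_inv]
        · exact absurd rfl huv'
      · exact absurd rfl hxy'
  · refine ⟨fun p q => if P.coef B₀ p q = 0 then 0 else 1, fun p q hp hpS hq hqS => ?_, ?_⟩
    · rw [matrixSystem_coef hp hq]
      simp
    · intro x y u v hxy huv hx hxS hy hyS hu huS hv hvS hxu hxv hyu hyv
      exact absurd ⟨x, y, u, v, hxy, huv, hx, hxS, hy, hyS, hu, huS, hv, hvS, hxu, hxv, hyu, hyv⟩
        hex

end PivotSystem
end Small

section Connected

variable {α : Type*} [DecidableEq α] {G H : SimpleGraph α} {S T U : Finset α}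

/-- The graph `G` induces a connected graph on the finset `S`. -/
def IsConn (G : SimpleGraph α) (S : Finset α) : Prop :=
  ∀ T ⊆ S, T.Nonempty → (∀ p ∈ T, ∀ q ∈ S, G.Adj p q → q ∈ T) → T = S

lemma IsConn.congr (h : IsConn G S) (hGH : ∀ p ∈ S, ∀ q ∈ S, (G.Adj p q ↔ H.Adj p q)) :
    IsConn H S :=
  fun T hT hne hcl => h T hT hne fun p hp q hq hpq => hcl p hp q hq ((hGH p (hT hp) q hq).1 hpq)

lemma IsConn.exists_adj (h : IsConn G S) (hU : U ⊆ S) (hne : U.Nonempty)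
    (hcard : U.card < S.card) : ∃ p ∈ U, ∃ q ∈ S, q ∉ U ∧ G.Adj p q := by
  by_contra! hcon
  have := h U hU hne fun p hp q hq hpq => by
    by_contra hqU
    exact hcon p hp q hq hqU hpq
  rw [this] at hcard
  exact lt_irrefl _ hcard

lemma IsConn.insert {p q : α} (h : IsConn G U) (hp : p ∈ U) (hpq : G.Adj p q) :
    IsConn G (insert q U) := by
  intro T hT hne hcl
  have hpT : p ∈ T := by
    by_cases hTU : (T ∩ U).Nonempty
    · have : T ∩ U = U := h _ Finset.inter_subset_right hTU fun a ha b hb hab =>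
        Finset.mem_inter.2 ⟨hcl a (Finset.mem_inter.1 ha).1 b (Finset.mem_insert_of_mem hb) hab, hb⟩
      rw [← this] at hp
      exact (Finset.mem_inter.1 hp).1
    · obtain ⟨z, hz⟩ := hne
      have : z = q := by
        refine (Finset.mem_insert.1 (hT hz)).resolve_right fun hzU => hTU ⟨z, ?_⟩
        exact Finset.mem_inter.2 ⟨hz, hzU⟩
      subst this
      exact hcl z hz p (Finset.mem_insert_of_mem hp) hpq.symm
  have hTU : T ∩ U = U := h _ Finset.inter_subset_right ⟨p, Finset.mem_inter.2 ⟨hpT, hp⟩⟩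
    fun a ha b hb hab =>
      Finset.mem_inter.2 ⟨hcl a (Finset.mem_inter.1 ha).1 b (Finset.mem_insert_of_mem hb) hab, hb⟩
  refine hT.antisymm fun z hz => ?_
  rcases Finset.mem_insert.1 hz with rfl | hz
  · exact hcl p hpT z (Finset.mem_insert_self z U) hpq
  · rw [← hTU] at hz
    exact (Finset.mem_inter.1 hz).1

lemma isConn_star {c : α} (hc : c ∈ S) (h : ∀ z ∈ S, z ≠ c → G.Adj c z) : IsConn G S := by
  intro T hT hne hcl
  have hcT : c ∈ T := by
    obtain ⟨z, hz⟩ := hne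
    by_cases hzc : z = c
    · rwa [← hzc]
    · exact hcl z hz c hc (h z (hT hz) hzc).symm
  refine hT.antisymm fun z hz => ?_
  by_cases hzc : z = c
  · rwa [hzc]
  · exact hcl c hcT z hz (h z hz hzc)

/-- A connected graph with a vertex of degree at least three has three vertices any subset of
which can be deleted without disconnecting the graph. -/
lemma IsConn.exists_triple (h : IsConn G S) {c a₁ a₂ a₃ : α} (hc : c ∈ S) (h1 : a₁ ∈ S)
    (h2 : a₂ ∈ S) (h3 : a₃ ∈ S) (h12 : a₁ ≠ a₂) (h13 : a₁ ≠ a₃) (h23 : a₂ ≠ a₃)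
    (g1 : G.Adj c a₁) (g2 : G.Adj c a₂) (g3 : G.Adj c a₃) :
    ∃ L ⊆ S, L.card = 3 ∧ ∀ M ⊆ L, IsConn G (S \ M) := by
  have key : ∀ n, 4 ≤ n → n ≤ S.card → ∃ U ⊆ S, U.card = n ∧
      ∃ L ⊆ U, L.card = 3 ∧ ∀ M ⊆ L, IsConn G (U \ M) := by
    intro n hn
    induction n, hn using Nat.le_induction with
    | base =>
      intro _
      have hcard : ({a₁, a₂, a₃} : Finset α).card = 3 := Finset.card_eq_three.2
        ⟨a₁, a₂, a₃, h12, h13, h23, rfl⟩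
      have hcn : c ∉ ({a₁, a₂, a₃} : Finset α) := by
        simp [g1.ne, g2.ne, g3.ne]
      refine ⟨Insert.insert c {a₁, a₂, a₃}, ?_, ?_, {a₁, a₂, a₃}, Finset.subset_insert _ _, hcard,
        fun M hM => ?_⟩
      · simp [Finset.insert_subset_iff, hc, h1, h2, h3]
      · rw [Finset.card_insert_of_notMem hcn, hcard]
      · refine isConn_star (c := c) ?_ ?_
        · exact Finset.mem_sdiff.2 ⟨Finset.mem_insert_self _ _, fun h => hcn (hM h)⟩
        · intro z hz hzc
          have := (Finset.mem_insert.1 (Finset.mem_sdiff.1 hz).1).resolve_left hzc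
          simp only [Finset.mem_insert, Finset.mem_singleton] at this
          rcases this with rfl | rfl | rfl <;> assumption
    | succ n hn ih =>
      intro hnS
      obtain ⟨U, hU, hUn, L, hL, hL3, hM⟩ := ih (by omega)
      obtain ⟨p, hp, q, hq, hqU, hpq⟩ := h.exists_adj hU (Finset.card_pos.1 (by omega)) (by omega)
      refine ⟨Insert.insert q U, Finset.insert_subset hq hU,
        by rw [Finset.card_insert_of_notMem hqU, hUn], ?_⟩
      by_cases hpL : p ∈ L
      · refine ⟨swap L p q, ?_, ?_, fun M hML => ?_⟩
        · intro z hz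
          rcases mem_swap.1 hz with rfl | hz
          · exact Finset.mem_insert_self _ _
          · exact Finset.mem_insert_of_mem (hL hz.2)
        · rw [PivotSystem.card_swap hpL (fun h => hqU (hL h)), hL3]
        · by_cases hqM : q ∈ M
          · have : Insert.insert q U \ M = U \ (M.erase q) := by
              ext z
              simp only [Finset.mem_sdiff, Finset.mem_insert, Finset.mem_erase]
              grind
            rw [this]
            refine hM _ fun z hz => ?_
            have hz' := Finset.mem_erase.1 hz
            exact ((mem_swap.1 (hML hz'.2)).resolve_left hz'.1).2
          · rw [Finset.insert_sdiff_of_notMem _ hqM]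
            refine (hM M fun z hz => ?_).insert (p := p) ?_ hpq
            · exact ((mem_swap.1 (hML hz)).resolve_left (fun h => hqM (h ▸ hz))).2
            · refine Finset.mem_sdiff.2 ⟨hp, fun hpM => ?_⟩
              rcases mem_swap.1 (hML hpM) with h | h
              · exact hqU (h ▸ hp)
              · exact h.1 rfl
      · refine ⟨L, hL.trans (Finset.subset_insert _ _), hL3, fun M hML => ?_⟩
        have hqM : q ∉ M := fun h => hqU (hL (hML h))
        rw [Finset.insert_sdiff_of_notMem _ hqM]
        exact (hM M hML).insert (Finset.mem_sdiff.2 ⟨hp, fun h => hpL (hML h)⟩) hpq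
  have h4 : 4 ≤ S.card := by
    have hcn : c ∉ ({a₁, a₂, a₃} : Finset α) := by
      simp [g1.ne, g2.ne, g3.ne]
    have : (Insert.insert c {a₁, a₂, a₃} : Finset α).card = 4 := by
      rw [Finset.card_insert_of_notMem hcn, Finset.card_eq_three.2
        ⟨a₁, a₂, a₃, h12, h13, h23, rfl⟩]
    rw [← this]
    exact Finset.card_le_card (by simp [Finset.insert_subset_iff, hc, h1, h2, h3])
  obtain ⟨U, hU, hUn, hL⟩ := key S.card h4 le_rfl
  rwa [Finset.eq_of_subset_of_card_le hU hUn.ge] at hL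

/-- A vertex with three neighbours in `S`. -/
def HasFork (G : SimpleGraph α) (S : Finset α) : Prop :=
  ∃ c ∈ S, ∃ a₁ ∈ S, ∃ a₂ ∈ S, ∃ a₃ ∈ S, a₁ ≠ a₂ ∧ a₁ ≠ a₃ ∧ a₂ ≠ a₃ ∧ G.Adj c a₁ ∧
    G.Adj c a₂ ∧ G.Adj c a₃

lemma IsConn.hasFork_or_path (h : IsConn G S) (hS : 5 ≤ S.card) : HasFork G S ∨
    ∃ v₁ ∈ S, ∃ v₂ ∈ S, ∃ v₃ ∈ S, ∃ v₄ ∈ S, ∃ v₅ ∈ S, [v₁, v₂, v₃, v₄, v₅].Nodup ∧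
      G.Adj v₁ v₂ ∧ G.Adj v₂ v₃ ∧ G.Adj v₃ v₄ ∧ G.Adj v₄ v₅ := by
  by_cases hf : HasFork G S
  · exact Or.inl hf
  right
  obtain ⟨v₁, h1⟩ := Finset.card_pos.1 (show 0 < S.card by omega)
  obtain ⟨p, hp, v₂, h2, hn2, e12⟩ := h.exists_adj (U := {v₁}) (by simpa) (by simp) (by simp; omega)
  obtain rfl := Finset.mem_singleton.1 hp
  have hn12 := e12.ne
  obtain ⟨v₁, h1, v₂, h2, v₃, h3, e12, e23, e13⟩ : ∃ v₁ ∈ S, ∃ v₂ ∈ S, ∃ v₃ ∈ S,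
      G.Adj v₁ v₂ ∧ G.Adj v₂ v₃ ∧ v₁ ≠ v₃ := by
    obtain ⟨q, hq, z, hz, hzn, e⟩ := h.exists_adj (U := {p, v₂})
      (by simp [Finset.insert_subset_iff, *]) (by simp) (Finset.card_le_two.trans_lt (by omega))
    simp only [Finset.mem_insert, Finset.mem_singleton, not_or] at hq hzn
    rcases hq with rfl | rfl
    · exact ⟨v₂, h2, q, h1, z, hz, e12.symm, e, Ne.symm hzn.2⟩
    · exact ⟨p, h1, q, h2, z, hz, e12, e, Ne.symm hzn.1⟩
  have hn12 := e12.ne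
  have hn23 := e23.ne
  obtain ⟨v₁, h1, v₂, h2, v₃, h3, v₄, h4, e12, e23, e34, e13, e14, e24⟩ : ∃ v₁ ∈ S, ∃ v₂ ∈ S,
      ∃ v₃ ∈ S, ∃ v₄ ∈ S, G.Adj v₁ v₂ ∧ G.Adj v₂ v₃ ∧ G.Adj v₃ v₄ ∧ v₁ ≠ v₃ ∧ v₁ ≠ v₄ ∧
      v₂ ≠ v₄ := by
    obtain ⟨q, hq, z, hz, hzn, e⟩ := h.exists_adj (U := {v₁, v₂, v₃})
      (by simp [Finset.insert_subset_iff, *]) (by simp) (Finset.card_le_three.trans_lt (by omega))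
    simp only [Finset.mem_insert, Finset.mem_singleton, not_or] at hq hzn
    rcases hq with rfl | rfl | rfl
    · exact ⟨v₃, h3, v₂, h2, q, h1, z, hz, e23.symm, e12.symm, e, Ne.symm e13, Ne.symm hzn.2.2,
        Ne.symm hzn.2.1⟩
    · exact absurd ⟨q, h2, v₁, h1, v₃, h3, z, hz, e13, Ne.symm hzn.1, Ne.symm hzn.2.2, e12.symm,
        e23, e⟩ hf
    · exact ⟨v₁, h1, v₂, h2, q, h3, z, hz, e12, e23, e, e13, Ne.symm hzn.1, Ne.symm hzn.2.1⟩
  have hn12 := e12.ne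
  have hn23 := e23.ne
  have hn34 := e34.ne
  obtain ⟨q, hq, z, hz, hzn, e⟩ := h.exists_adj (U := {v₁, v₂, v₃, v₄})
    (by simp [Finset.insert_subset_iff, *]) (by simp) (Finset.card_le_four.trans_lt (by omega))
  simp only [Finset.mem_insert, Finset.mem_singleton, not_or] at hq hzn
  obtain ⟨z1, z2, z3, z4⟩ := hzn
  rcases hq with rfl | rfl | rfl | rfl
  · refine ⟨v₄, h4, v₃, h3, v₂, h2, q, h1, z, hz, ?_, e34.symm, e23.symm, e12.symm, e⟩
    simp only [List.nodup_cons, List.mem_cons, List.not_mem_nil]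
    grind
  · exact absurd ⟨q, h2, v₁, h1, v₃, h3, z, hz, e13, Ne.symm z1, Ne.symm z3, e12.symm, e23, e⟩ hf
  · exact absurd ⟨q, h3, v₂, h2, v₄, h4, z, hz, e24, Ne.symm z2, Ne.symm z4, e23.symm, e34, e⟩ hf
  · refine ⟨v₁, h1, v₂, h2, v₃, h3, q, h4, z, hz, ?_, e12, e23, e34, e⟩
    simp only [List.nodup_cons, List.mem_cons, List.not_mem_nil]
    grind

end Connected

section ConnectedSystem

variable {K α : Type*} [Field K] [DecidableEq α]

namespace PivotSystem

variable {P : PivotSystem K α} {S T B B₀ : Finset α} {p q x y : α}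

lemma graph_adj_of_subset (hTS : T ⊆ S) (hp : p ∈ T) (hq : q ∈ T) :
    (P.graph S B).Adj p q ↔ (P.graph T B).Adj p q := by
  simp only [graph_adj, hp, hq, hTS hp, hTS hq, true_and]

lemma isConn_graph_iff (hTS : T ⊆ S) : IsConn (P.graph S B) T ↔ IsConn (P.graph T B) T :=
  ⟨fun h => h.congr fun _ hp _ hq => graph_adj_of_subset hTS hp hq,
    fun h => h.congr fun _ hp _ hq => (graph_adj_of_subset hTS hp hq).symm⟩

lemma reachable_of_isConn (h : IsConn (P.graph S B) S) (hx : x ∈ S) (hy : y ∈ S) :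
    (P.graph S B).Reachable x y := by
  classical
  have : S.filter (fun z => (P.graph S B).Reachable x z) = S := by
    refine h _ (Finset.filter_subset _ _) ⟨x, by simp [hx]⟩ fun p hp q hq hpq => ?_
    rw [Finset.mem_filter] at hp ⊢
    exact ⟨hq, hp.2.trans hpq.reachable⟩
  rw [← this, Finset.mem_filter] at hy
  exact hy.2

/-- Connectivity is invariant under pivoting. -/
lemma isConn_swap (hB : P.IsBase B) (hp : p ∈ B) (hpS : p ∈ S) (hq : q ∉ B) (hqS : q ∈ S)
    (hpq : P.coef B p q ≠ 0) (h : IsConn (P.graph S B) S) :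
    IsConn (P.graph S (swap B p q)) S := by
  intro T hT hne hcl
  refine h T hT hne ?_
  have hB' := swap_isBase hB hp hq hpq
  have hd : Disjoint T (S \ T) := Finset.disjoint_sdiff
  have hs : P.IsSplit T (S \ T) (swap B p q) (swap B p q) := by
    refine isSplit_self hB' (fun i hi hiT e he heT => ?_) (fun i hi hiT e he heT => ?_)
    · by_contra h0
      rw [Finset.mem_sdiff] at heT
      exact heT.2 (hcl i hiT e heT.1 (graph_adj.2 ⟨hT hiT, heT.1, Or.inl ⟨hi, he, h0⟩⟩))
    · by_contra h0
      rw [Finset.mem_sdiff] at hiT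
      exact hiT.2 (hcl e heT i hiT.1 (graph_adj.2 ⟨hT heT, hiT.1, Or.inr ⟨hi, he, h0⟩⟩))
  have hq' : q ∈ swap B p q := mem_swap.2 (Or.inl rfl)
  have hp' : p ∉ swap B p q := by rw [mem_swap]; grind
  have hqp : P.coef (swap B p q) q p ≠ 0 := by
    rw [P.coef_new hB hp hq hpq]
    exact inv_ne_zero hpq
  have hs' : P.IsSplit T (S \ T) (swap B p q) B := by
    rw [← swap_swap hp hq]
    nth_rewrite 1 [swap_swap hp hq]
    by_cases hqT : q ∈ T
    · have hpT : p ∈ T := hcl q hqT p hpS (graph_adj.2 ⟨hqS, hpS, Or.inl ⟨hq', hp', hqp⟩⟩)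
      exact hs.swap hd hq' hqT hp' hpT hqp
    · have hpT : p ∉ T := fun hpT =>
        hqT (hcl p hpT q hqS (graph_adj.2 ⟨hpS, hqS, Or.inr ⟨hq', hp', hqp⟩⟩))
      exact (hs.symm.swap hd.symm hq' (Finset.mem_sdiff.2 ⟨hqS, hqT⟩) hp'
        (Finset.mem_sdiff.2 ⟨hpS, hpT⟩) hqp).symm
  intro a ha b hb hab
  by_contra hbT
  have hb' := Finset.mem_sdiff.2 ⟨hb, hbT⟩
  rcases (graph_adj.1 hab).2.2 with ⟨h1, h2, h3⟩ | ⟨h1, h2, h3⟩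
  · exact h3 (hs'.2.1.2.2 a h1 ha b h2 hb')
  · exact h3 (hs'.2.2.2.2 b h1 hb' a h2 ha)

lemma isConn_of_agree (hB₀ : P.IsBase B₀) (hB : P.IsBase B) (hA : Agree S B B₀)
    (h : IsConn (P.graph S B₀) S) : IsConn (P.graph S B) S :=
  face_induction (P := P) (S := S) (motive := fun B => IsConn (P.graph S B) S) hB₀ h
    (fun _ _ _ hB _ h hp hpS hq hqS hpq => isConn_swap hB hp hpS hq hqS hpq h) hB hA

/-- Up to pivoting, a connected graph with at least five vertices has a vertex of degree at least
three. -/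
lemma exists_hasFork (hB₀ : P.IsBase B₀) (h : IsConn (P.graph S B₀) S) (hS : 5 ≤ S.card) :
    ∃ B, P.IsBase B ∧ Agree S B B₀ ∧ HasFork (P.graph S B) S := by
  rcases h.hasFork_or_path hS with hf | ⟨v₁, h1, v₂, h2, v₃, h3, v₄, h4, v₅, h5, hnd, e12, e23,
    e34, e45⟩
  · exact ⟨B₀, hB₀, Agree.refl _ _, hf⟩
  by_cases e14 : (P.graph S B₀).Adj v₄ v₁
  · refine ⟨B₀, hB₀, Agree.refl _ _, v₄, h4, v₃, h3, v₅, h5, v₁, h1, ?_, ?_, ?_, e34.symm, e45, e14⟩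
    all_goals grind
  by_cases e25 : (P.graph S B₀).Adj v₂ v₅
  · refine ⟨B₀, hB₀, Agree.refl _ _, v₂, h2, v₁, h1, v₃, h3, v₅, h5, ?_, ?_, ?_, e12.symm, e23, e25⟩
    all_goals grind
  simp only [graph_adj, h1, h2, h3, h4, h5, true_and] at e12 e23 e34 e45 e14 e25
  simp only [List.nodup_cons, List.mem_cons, List.not_mem_nil, or_false, not_or] at hnd
  by_cases hv2 : v₂ ∈ B₀
  · have m1 : v₁ ∉ B₀ := by grind
    have m3 : v₃ ∉ B₀ := by grind
    have m4 : v₄ ∈ B₀ := by grind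
    have m5 : v₅ ∉ B₀ := by grind
    have c21 : P.coef B₀ v₂ v₁ ≠ 0 := by grind
    have c23 : P.coef B₀ v₂ v₃ ≠ 0 := by grind
    have c43 : P.coef B₀ v₄ v₃ ≠ 0 := by grind
    have c45 : P.coef B₀ v₄ v₅ ≠ 0 := by grind
    have c41 : P.coef B₀ v₄ v₁ = 0 := by grind
    have c25 : P.coef B₀ v₂ v₅ = 0 := by grind
    refine ⟨swap B₀ v₂ v₃, swap_isBase hB₀ hv2 m3 c23, (Agree.refl _ _).swap_left h2 h3,
      v₄, h4, v₂, h2, v₁, h1, v₅, h5, by grind, by grind, by grind, ?_, ?_, ?_⟩ <;>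
      rw [graph_adj] <;> refine ⟨h4, by assumption, Or.inl ⟨by rw [mem_swap]; grind,
        by rw [mem_swap]; grind, ?_⟩⟩
    · rw [P.coef_col hB₀ hv2 m3 c23 m4 (by grind)]
      exact div_ne_zero (neg_ne_zero.2 c43) c23
    · rw [P.coef_rest hB₀ hv2 m3 c23 m4 (by grind) m1 (by grind), c41, zero_sub, neg_ne_zero]
      exact div_ne_zero (mul_ne_zero c43 c21) c23
    · rw [P.coef_rest hB₀ hv2 m3 c23 m4 (by grind) m5 (by grind), c25]
      simpa using c45
  · have m1 : v₁ ∈ B₀ := by grind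
    have m3 : v₃ ∈ B₀ := by grind
    have m4 : v₄ ∉ B₀ := by grind
    have m5 : v₅ ∈ B₀ := by grind
    have c12 : P.coef B₀ v₁ v₂ ≠ 0 := by grind
    have c32 : P.coef B₀ v₃ v₂ ≠ 0 := by grind
    have c34 : P.coef B₀ v₃ v₄ ≠ 0 := by grind
    have c54 : P.coef B₀ v₅ v₄ ≠ 0 := by grind
    have c14 : P.coef B₀ v₁ v₄ = 0 := by grind
    have c52 : P.coef B₀ v₅ v₂ = 0 := by grind
    refine ⟨swap B₀ v₃ v₂, swap_isBase hB₀ m3 hv2 c32, (Agree.refl _ _).swap_left h3 h2,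
      v₄, h4, v₂, h2, v₁, h1, v₅, h5, by grind, by grind, by grind, ?_, ?_, ?_⟩ <;>
      rw [graph_adj] <;> refine ⟨h4, by assumption, Or.inr ⟨by rw [mem_swap]; grind,
        by rw [mem_swap]; grind, ?_⟩⟩
    · rw [P.coef_row hB₀ m3 hv2 c32 m4 (by grind)]
      exact div_ne_zero c34 c32
    · rw [P.coef_rest hB₀ m3 hv2 c32 m1 (by grind) m4 (by grind), c14, zero_sub, neg_ne_zero]
      exact div_ne_zero (mul_ne_zero c12 c34) c32
    · rw [P.coef_rest hB₀ m3 hv2 c32 m5 (by grind) m4 (by grind), c52]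
      simpa using c54

lemma exists_deletable_pair (hB₀ : P.IsBase B₀) (h : IsConn (P.graph S B₀) S)
    (hS : 5 ≤ S.card) : ∃ B, P.IsBase B ∧ Agree S B B₀ ∧ ∃ u ∈ S, ∃ v ∈ S, u ≠ v ∧ (u ∈ B ↔ v ∈ B) ∧
      IsConn (P.graph S B) ((S.erase u).erase v) := by
  obtain ⟨B, hB, hA, c, hc, a, ha, b, hb, d, hd, h1, h2, h3, e1, e2, e3⟩ :=
    exists_hasFork hB₀ h hS
  obtain ⟨L, hL, hL3, hM⟩ := (isConn_of_agree hB₀ hB hA h).exists_triple hc ha hb hd h1 h2 h3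
    e1 e2 e3
  obtain ⟨z1, z2, z3, g12, g13, g23, rfl⟩ := Finset.card_eq_three.1 hL3
  have hz : ∀ u v, u ∈ ({z1, z2, z3} : Finset α) → v ∈ ({z1, z2, z3} : Finset α) →
      IsConn (P.graph S B) ((S.erase u).erase v) := by
    intro u v hu hv
    have : (S.erase u).erase v = S \ {u, v} := by
      ext z
      simp only [Finset.mem_erase, Finset.mem_sdiff, Finset.mem_insert, Finset.mem_singleton]
      tauto
    rw [this]
    exact hM _ (by simp only [Finset.insert_subset_iff, Finset.singleton_subset_iff]; exact ⟨hu, hv⟩)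
  refine ⟨B, hB, hA, ?_⟩
  by_cases e12 : z1 ∈ B ↔ z2 ∈ B
  · exact ⟨z1, hL (by simp), z2, hL (by simp), g12, e12, hz _ _ (by simp) (by simp)⟩
  by_cases e13 : z1 ∈ B ↔ z3 ∈ B
  · exact ⟨z1, hL (by simp), z3, hL (by simp), g13, e13, hz _ _ (by simp) (by simp)⟩
  · exact ⟨z2, hL (by simp), z3, hL (by simp), g23, by tauto, hz _ _ (by simp) (by simp)⟩

end PivotSystem
end ConnectedSystem

section PathOfLengthFour

variable {K F α : Type*} [Field K] [Field F] [DecidableEq α]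

lemma IsCrossRatioMap.map_mul {lam : K → F} (hlam : IsCrossRatioMap lam) {a b : K}
    (hb : b ≠ 0) (h : a = 1 ∨ b = 1 ∨ a * b = 1) : lam (a * b) = lam a * lam b := by
  rcases h with rfl | rfl | h
  · simp [hlam.map_one]
  · simp [hlam.map_one]
  · rw [h, eq_inv_of_mul_eq_one_left h, hlam.map_inv, hlam.map_one, inv_mul_cancel₀]
    exact fun h0 => hb (hlam.eq_zero h0)

lemma IsCrossRatioMap.map_ne_zero {lam : K → F} (hlam : IsCrossRatioMap lam) {a : K}
    (ha : a ≠ 0) : lam a ≠ 0 := fun h => ha (hlam.eq_zero h)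

namespace PivotSystem

/-- Scaling the standard matrices of a pivot system. -/
def scale (P : PivotSystem K α) (s : α → K) (hs : ∀ z, s z ≠ 0) : PivotSystem K α where
  IsBase := P.IsBase
  coef B x y := P.coef B x y * s y / s x
  swap_iff {B x y} h hx hy := by
    rw [P.swap_iff h hx hy]
    simp [hs]
  coef_new {B x y} h hx hy hxy := by
    have h1 := hs x
    have h2 := hs y
    have hxy' : P.coef B x y ≠ 0 := fun h0 => hxy (by rw [h0]; ring)
    rw [P.coef_new h hx hy hxy']
    field_simp
  coef_row {B x y e} h hx hy hxy he hne := by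
    have h1 := hs x
    have h2 := hs y
    have hxy' : P.coef B x y ≠ 0 := fun h0 => hxy (by rw [h0]; ring)
    rw [P.coef_row h hx hy hxy' he hne]
    field_simp
  coef_col {B x y e} h hx hy hxy he hne := by
    have h1 := hs x
    have h2 := hs y
    have h3 := hs e
    have hxy' : P.coef B x y ≠ 0 := fun h0 => hxy (by rw [h0]; ring)
    rw [P.coef_col h hx hy hxy' he hne]
    field_simp
  coef_rest {B x y i e} h hx hy hxy hi hix he hne := by
    have h1 := hs x
    have h2 := hs y
    have h3 := hs e
    have h4 := hs i
    have hxy' : P.coef B x y ≠ 0 := fun h0 => hxy (by rw [h0]; ring)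
    rw [P.coef_rest h hx hy hxy' hi hix he hne]
    field_simp
  exists_row {B B' x} h h' hx hx' := by
    obtain ⟨y, h1, h2, h3⟩ := P.exists_row h h' hx hx'
    exact ⟨y, h1, h2, div_ne_zero (mul_ne_zero h3 (hs y)) (hs x)⟩
  exists_col {B B' y} h h' hx hx' := by
    obtain ⟨x, h1, h2, h3⟩ := P.exists_col h h' hx hx'
    exact ⟨x, h1, h2, div_ne_zero (mul_ne_zero h3 (hs y)) (hs x)⟩

variable {P : PivotSystem K α} {Q : PivotSystem F α} {B : Finset α} {lam : K → F}
  {x₁ x₂ x₃ y₁ y₂ u v : α}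

lemma scale_coef (s : α → K) (hs : ∀ z, s z ≠ 0) (x y : α) :
    (P.scale s hs).coef B x y = P.coef B x y * s y / s x := rfl

lemma cr_scale (s : α → K) (hs : ∀ z, s z ≠ 0) (x y u v : α) :
    (P.scale s hs).cr B x y u v = P.cr B x y u v := by
  have h1 := hs x
  have h2 := hs y
  have h3 := hs u
  have h4 := hs v
  simp only [cr, scale_coef]
  field_simp

lemma NoUniform.scale (h : P.NoUniform) (s : α → K) (hs : ∀ z, s z ≠ 0) :
    (P.scale s hs).NoUniform := by
  have e : ∀ B x y u v, P.coef B x u * P.coef B y v = P.coef B x v * P.coef B y u →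
      (P.scale s hs).coef B x u * (P.scale s hs).coef B y v =
        (P.scale s hs).coef B x v * (P.scale s hs).coef B y u := by
    intro B x y u v h
    simp only [scale_coef]
    linear_combination s u * s v / (s x * s y) * h
  have e0 : ∀ {B x u}, (P.scale s hs).coef B x u ≠ 0 → P.coef B x u ≠ 0 := by
    intro B x u h h0
    exact h (by rw [scale_coef, h0]; ring)
  exact ⟨fun B hB x y u v w hx hy hu hv hw h1 h2 h3 h4 h5 h6 =>
    (h.1 B hB x y u v w hx hy hu hv hw (e0 h1) (e0 h2) (e0 h3) (e0 h4) (e0 h5) (e0 h6)).imp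
      (e _ _ _ _ _) (Or.imp (e _ _ _ _ _) (e _ _ _ _ _)),
    fun B hB x y z u v hx hy hz hu hv h1 h2 h3 h4 h5 h6 =>
    (h.2 B hB x y z u v hx hy hz hu hv (e0 h1) (e0 h2) (e0 h3) (e0 h4) (e0 h5) (e0 h6)).imp
      (e _ _ _ _ _) (Or.imp (e _ _ _ _ _) (e _ _ _ _ _))⟩

/-- The standard matrix of `B` has, in rows `x₁`, `x₂`, `x₃` and columns `y₁`, `y₂`, `u`, `v`,
the entries of the matrix `[1 0 1 1; 1 1 0 b; 0 1 c d]`. -/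
structure HasNormalForm (P : PivotSystem K α) (B : Finset α) (x₁ x₂ x₃ y₁ y₂ u v : α)
    (b c d : K) : Prop where
  e11 : P.coef B x₁ y₁ = 1
  e12 : P.coef B x₁ y₂ = 0
  e13 : P.coef B x₁ u = 1
  e14 : P.coef B x₁ v = 1
  e21 : P.coef B x₂ y₁ = 1
  e22 : P.coef B x₂ y₂ = 1
  e23 : P.coef B x₂ u = 0
  e24 : P.coef B x₂ v = b
  e31 : P.coef B x₃ y₁ = 0
  e32 : P.coef B x₃ y₂ = 1
  e33 : P.coef B x₃ u = c
  e34 : P.coef B x₃ v = d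

lemma HasNormalForm.cr_swap {b c d : K} (h : P.HasNormalForm B x₁ x₂ x₃ y₁ y₂ u v b c d)
    (hB : P.IsBase B) (hx₁ : x₁ ∈ B) (hx₂ : x₂ ∈ B) (hx₃ : x₃ ∈ B) (hy₁ : y₁ ∉ B) (hy₂ : y₂ ∉ B)
    (hu : u ∉ B) (h12 : x₁ ≠ x₂) (h13 : x₁ ≠ x₃) (hy : y₁ ≠ y₂) (hu1 : y₁ ≠ u) :
    P.cr (swap B x₁ y₁) x₂ x₃ y₂ u = -c := by
  have h0 : P.coef B x₁ y₁ ≠ 0 := by rw [h.e11]; exact one_ne_zero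
  simp only [cr]
  rw [P.coef_rest hB hx₁ hy₁ h0 hx₂ h12.symm hy₂ hy.symm, P.coef_rest hB hx₁ hy₁ h0 hx₃ h13.symm
    hy₂ hy.symm, P.coef_rest hB hx₁ hy₁ h0 hx₂ h12.symm hu hu1.symm, P.coef_rest hB hx₁ hy₁ h0 hx₃
    h13.symm hu hu1.symm, h.e11, h.e12, h.e13, h.e21, h.e22, h.e23, h.e31, h.e32, h.e33]
  simp [div_neg]

/-- The restrictions on a matrix `[1 0 1 1; 1 1 0 b; 0 1 c d]` imposed by the absence of large
uniform minors. -/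
lemma HasNormalForm.cases {b c d : K} (h : P.HasNormalForm B x₁ x₂ x₃ y₁ y₂ u v b c d)
    (hP : P.NoUniform) (hB : P.IsBase B) (hx₁ : x₁ ∈ B) (hx₂ : x₂ ∈ B) (hx₃ : x₃ ∈ B)
    (hy₁ : y₁ ∉ B) (hy₂ : y₂ ∉ B) (hu : u ∉ B) (hv : v ∉ B) (h12 : x₁ ≠ x₂) (h13 : x₁ ≠ x₃)
    (h23 : x₂ ≠ x₃) (hy : y₁ ≠ y₂) (hu1 : y₁ ≠ u) (hu2 : y₂ ≠ u) (hv1 : y₁ ≠ v) (hv2 : y₂ ≠ v)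
    (huv : u ≠ v) (hb : b ≠ 0) (hc : c ≠ 0) (hd : d ≠ 0) :
    b = 1 ∧ d = 1 ∧ (c = 1 ∨ c = -1) ∨ b = 1 ∧ d = c + 1 ∨ b = 1 ∧ c = -1 ∧ d = -1 ∨
    d = b ∧ c = -1 ∧ b = -1 ∨ d = b ∧ b * (1 + c) = c ∨ d = b - 1 ∧ (c = -1 ∨ c = d) := by
  obtain ⟨e11, e12, e13, e14, e21, e22, e23, e24, e31, e32, e33, e34⟩ := h
  have hx₁v : P.coef B x₁ v ≠ 0 := by simp [e14]
  have hx₁u : P.coef B x₁ u ≠ 0 := by simp [e13]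
  have hBv := swap_isBase hB hx₁ hv hx₁v
  have hBu := swap_isBase hB hx₁ hu hx₁u
  have m2v : x₂ ∈ swap B x₁ v := mem_swap.2 (Or.inr ⟨h12.symm, hx₂⟩)
  have m3v : x₃ ∈ swap B x₁ v := mem_swap.2 (Or.inr ⟨h13.symm, hx₃⟩)
  have m2u : x₂ ∈ swap B x₁ u := mem_swap.2 (Or.inr ⟨h12.symm, hx₂⟩)
  have m3u : x₃ ∈ swap B x₁ u := mem_swap.2 (Or.inr ⟨h13.symm, hx₃⟩)
  have n1v : x₁ ∉ swap B x₁ v := by rw [mem_swap]; grind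
  have nv : ∀ {z}, z ∉ B → z ≠ v → z ∉ swap B x₁ v := by intro z; rw [mem_swap]; grind
  have nu : ∀ {z}, z ∉ B → z ≠ u → z ∉ swap B x₁ u := by intro z; rw [mem_swap]; grind
  have f21 : P.coef (swap B x₁ v) x₂ x₁ = -b := by
    rw [P.coef_col hB hx₁ hv hx₁v hx₂ h12.symm, e24, e14, div_one]
  have f31 : P.coef (swap B x₁ v) x₃ x₁ = -d := by
    rw [P.coef_col hB hx₁ hv hx₁v hx₃ h13.symm, e34, e14, div_one]
  have f2 : ∀ {z}, z ∉ B → z ≠ v →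
      P.coef (swap B x₁ v) x₂ z = P.coef B x₂ z - b * P.coef B x₁ z := by
    intro z hz hzv
    rw [P.coef_rest hB hx₁ hv hx₁v hx₂ h12.symm hz hzv, e24, e14, div_one]
  have f3 : ∀ {z}, z ∉ B → z ≠ v →
      P.coef (swap B x₁ v) x₃ z = P.coef B x₃ z - d * P.coef B x₁ z := by
    intro z hz hzv
    rw [P.coef_rest hB hx₁ hv hx₁v hx₃ h13.symm hz hzv, e34, e14, div_one]
  have f2y₁ := f2 hy₁ hv1
  have f2y₂ := f2 hy₂ hv2
  have f2u := f2 hu huv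
  have f3y₁ := f3 hy₁ hv1
  have f3y₂ := f3 hy₂ hv2
  have f3u := f3 hu huv
  rw [e21, e11] at f2y₁
  rw [e22, e12] at f2y₂
  rw [e23, e13] at f2u
  rw [e31, e11] at f3y₁
  rw [e32, e12] at f3y₂
  rw [e33, e13] at f3u
  have t1 : c ≠ d → d = b ∨ c = d - b := by
    intro hcd
    have := hP.1 _ hBv x₂ x₃ x₁ y₂ u m2v m3v n1v (nv hy₂ hv2) (nv hu huv)
    rw [f21, f31, f2y₂, f3y₂, f2u, f3u] at this
    rcases this (by simpa) (by simp) (by simpa) (by simpa) (by simp)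
      (by simpa [sub_eq_zero] using hcd) with h | h | h
    · left; linear_combination h
    · exact absurd (by linear_combination -h : b * c = 0) (mul_ne_zero hb hc)
    · right; linear_combination h
  have t2 : b ≠ 1 → d = b ∨ d = b - 1 := by
    intro hb1
    have := hP.1 _ hBv x₂ x₃ x₁ y₂ y₁ m2v m3v n1v (nv hy₂ hv2) (nv hy₁ hv1)
    rw [f21, f31, f2y₂, f3y₂, f2y₁, f3y₁] at this
    rcases this (by simpa) (by simp) (by simpa [sub_eq_zero] using hb1.symm) (by simpa) (by simp)
      (by simpa) with h | h | h
    · left; linear_combination h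
    · exact absurd (by linear_combination h) hd
    · right; linear_combination -h
  have t3 : b ≠ 1 → c ≠ d → d = b → b * (1 + c) = c := by
    intro hb1 hcd hdb
    have := hP.1 _ hBv x₂ x₃ y₂ y₁ u m2v m3v (nv hy₂ hv2) (nv hy₁ hv1) (nv hu huv)
    rw [f2u, f3u, f2y₂, f3y₂, f2y₁, f3y₁, hdb] at this
    rw [hdb] at hcd
    rcases this (by simp) (by simpa [sub_eq_zero] using hb1.symm) (by simpa) (by simp)
      (by simpa) (by simpa [sub_eq_zero] using hcd) with h | h | h
    · exact absurd (by linear_combination -h : (1 : K) = 0) one_ne_zero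
    · exact absurd (by linear_combination h) hc
    · linear_combination -h
  have t4 : b = 1 → d = 1 → c = 1 ∨ c = -1 := by
    intro hb1 hd1
    by_contra! hcon
    have g2 : ∀ {z}, z ∉ B → z ≠ u →
        P.coef (swap B x₁ u) x₂ z = P.coef B x₂ z := by
      intro z hz hzv
      rw [P.coef_rest hB hx₁ hu hx₁u hx₂ h12.symm hz hzv, e23, e13]
      ring
    have g3 : ∀ {z}, z ∉ B → z ≠ u →
        P.coef (swap B x₁ u) x₃ z = P.coef B x₃ z - c * P.coef B x₁ z := by
      intro z hz hzv
      rw [P.coef_rest hB hx₁ hu hx₁u hx₃ h13.symm hz hzv, e33, e13, div_one]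
    have := hP.1 _ hBu x₂ x₃ y₁ y₂ v m2u m3u (nu hy₁ hu1) (nu hy₂ hu2) (nu hv huv.symm)
    rw [g2 hy₁ hu1, g2 hy₂ hu2, g2 hv huv.symm, g3 hy₁ hu1, g3 hy₂ hu2, g3 hv huv.symm, e21, e22,
      e24, e31, e32, e34, e11, e12, e14, hb1, hd1] at this
    rcases this (by simp) (by simp) (by simp) (by simpa) (by simp)
      (by simpa [sub_eq_zero] using hcon.1.symm) with h | h | h
    · exact hcon.2 (by linear_combination h)
    · exact absurd (by linear_combination h : (1 : K) = 0) one_ne_zero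
    · exact hc (by linear_combination -h)
  have hx₂y₁ : P.coef B x₂ y₁ ≠ 0 := by simp [e21]
  have hx₂y₂ : P.coef B x₂ y₂ ≠ 0 := by simp [e22]
  have t5 : b = 1 → c = d → d ≠ 1 → c = -1 := by
    intro hb1 hcd hd1
    by_contra hc1
    have hB1 := swap_isBase hB hx₂ hy₁ hx₂y₁
    have k1 : ∀ {z}, z ∉ B → z ≠ y₁ →
        P.coef (swap B x₂ y₁) x₁ z = P.coef B x₁ z - P.coef B x₂ z := by
      intro z hz hzv
      rw [P.coef_rest hB hx₂ hy₁ hx₂y₁ hx₁ h12 hz hzv, e11, e21]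
      ring
    have k2 : ∀ {z}, z ∉ B → z ≠ y₁ →
        P.coef (swap B x₂ y₁) y₁ z = P.coef B x₂ z := by
      intro z hz hzv
      rw [P.coef_row hB hx₂ hy₁ hx₂y₁ hz hzv, e21, div_one]
    have k3 : ∀ {z}, z ∉ B → z ≠ y₁ →
        P.coef (swap B x₂ y₁) x₃ z = P.coef B x₃ z := by
      intro z hz hzv
      rw [P.coef_rest hB hx₂ hy₁ hx₂y₁ hx₃ h23.symm hz hzv, e31]
      ring
    have mx₁ : x₁ ∈ swap B x₂ y₁ := mem_swap.2 (Or.inr ⟨h12, hx₁⟩)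
    have mx₃ : x₃ ∈ swap B x₂ y₁ := mem_swap.2 (Or.inr ⟨h23.symm, hx₃⟩)
    have my₁ : y₁ ∈ swap B x₂ y₁ := mem_swap.2 (Or.inl rfl)
    have n1 : ∀ {z}, z ∉ B → z ≠ y₁ → z ∉ swap B x₂ y₁ := by intro z; rw [mem_swap]; grind
    have hx₃y₂ : P.coef (swap B x₂ y₁) x₃ y₂ ≠ 0 := by rw [k3 hy₂ hy.symm]; simp [e32]
    have hB2 := swap_isBase hB1 mx₃ (n1 hy₂ hy.symm) hx₃y₂
    have l1 : ∀ {z}, z ∉ B → z ≠ y₁ → z ≠ y₂ →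
        P.coef (swap (swap B x₂ y₁) x₃ y₂) x₁ z = P.coef B x₁ z - P.coef B x₂ z + P.coef B x₃ z := by
      intro z hz hz1 hz2
      rw [P.coef_rest hB1 mx₃ (n1 hy₂ hy.symm) hx₃y₂ mx₁ h13 (n1 hz hz1) hz2, k1 hz hz1,
        k1 hy₂ hy.symm, k3 hz hz1, k3 hy₂ hy.symm, e12, e22, e32]
      ring
    have l2 : ∀ {z}, z ∉ B → z ≠ y₁ → z ≠ y₂ →
        P.coef (swap (swap B x₂ y₁) x₃ y₂) y₁ z = P.coef B x₂ z - P.coef B x₃ z := by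
      intro z hz hz1 hz2
      rw [P.coef_rest hB1 mx₃ (n1 hy₂ hy.symm) hx₃y₂ my₁ (by grind) (n1 hz hz1) hz2, k2 hz hz1,
        k2 hy₂ hy.symm, k3 hz hz1, k3 hy₂ hy.symm, e22, e32]
      ring
    have l3 : ∀ {z}, z ∉ B → z ≠ y₁ → z ≠ y₂ →
        P.coef (swap (swap B x₂ y₁) x₃ y₂) y₂ z = P.coef B x₃ z := by
      intro z hz hz1 hz2
      rw [P.coef_row hB1 mx₃ (n1 hy₂ hy.symm) hx₃y₂ (n1 hz hz1) hz2, k3 hz hz1,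
        k3 hy₂ hy.symm, e32, div_one]
    have n2 : ∀ {z}, z ∉ B → z ≠ y₁ → z ≠ y₂ → z ∉ swap (swap B x₂ y₁) x₃ y₂ := by
      intro z; rw [mem_swap, mem_swap]; grind
    have := hP.2 _ hB2 x₁ y₁ y₂ u v (by simp only [mem_swap]; grind) (by simp only [mem_swap]; grind)
      (by simp only [mem_swap]; grind) (n2 hu hu1.symm hu2.symm) (n2 hv hv1.symm hv2.symm)
    rw [l1 hu hu1.symm hu2.symm, l1 hv hv1.symm hv2.symm, l2 hu hu1.symm hu2.symm,
      l2 hv hv1.symm hv2.symm, l3 hu hu1.symm hu2.symm, l3 hv hv1.symm hv2.symm, e13, e14, e23, e24,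
      e33, e34, hb1, ← hcd] at this
    rw [← hcd] at hd1
    rcases this (fun h => hc1 (by linear_combination h)) (by simpa) hc (by simpa)
      (by simpa [sub_eq_zero] using Ne.symm hd1) hc with h | h | h
    · exact absurd (by linear_combination h : (1 : K) = 0) one_ne_zero
    · exact hc (by linear_combination h)
    · exact hc (by linear_combination -h)
  have t6 : b ≠ 1 → c = d → d = b → c = -1 := by
    intro hb1 hcd hdb
    by_contra hc1
    have hB1 := swap_isBase hB hx₂ hy₂ hx₂y₂
    have k1 : ∀ {z}, z ∉ B → z ≠ y₂ →
        P.coef (swap B x₂ y₂) x₁ z = P.coef B x₁ z := by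
      intro z hz hzv
      rw [P.coef_rest hB hx₂ hy₂ hx₂y₂ hx₁ h12 hz hzv, e12, e22]
      ring
    have k2 : ∀ {z}, z ∉ B → z ≠ y₂ →
        P.coef (swap B x₂ y₂) y₂ z = P.coef B x₂ z := by
      intro z hz hzv
      rw [P.coef_row hB hx₂ hy₂ hx₂y₂ hz hzv, e22, div_one]
    have k3 : ∀ {z}, z ∉ B → z ≠ y₂ →
        P.coef (swap B x₂ y₂) x₃ z = P.coef B x₃ z - P.coef B x₂ z := by
      intro z hz hzv
      rw [P.coef_rest hB hx₂ hy₂ hx₂y₂ hx₃ h23.symm hz hzv, e32, e22]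
      ring
    have mx₁ : x₁ ∈ swap B x₂ y₂ := mem_swap.2 (Or.inr ⟨h12, hx₁⟩)
    have mx₃ : x₃ ∈ swap B x₂ y₂ := mem_swap.2 (Or.inr ⟨h23.symm, hx₃⟩)
    have my₂ : y₂ ∈ swap B x₂ y₂ := mem_swap.2 (Or.inl rfl)
    have n1 : ∀ {z}, z ∉ B → z ≠ y₂ → z ∉ swap B x₂ y₂ := by intro z; rw [mem_swap]; grind
    have hx₁y₁ : P.coef (swap B x₂ y₂) x₁ y₁ ≠ 0 := by rw [k1 hy₁ hy]; simp [e11]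
    have hB2 := swap_isBase hB1 mx₁ (n1 hy₁ hy) hx₁y₁
    have l1 : ∀ {z}, z ∉ B → z ≠ y₁ → z ≠ y₂ →
        P.coef (swap (swap B x₂ y₂) x₁ y₁) x₃ z = P.coef B x₃ z - P.coef B x₂ z + P.coef B x₁ z := by
      intro z hz hz1 hz2
      rw [P.coef_rest hB1 mx₁ (n1 hy₁ hy) hx₁y₁ mx₃ h13.symm (n1 hz hz2) hz1, k3 hz hz2,
        k3 hy₁ hy, k1 hz hz2, k1 hy₁ hy, e31, e21, e11]
      ring
    have l2 : ∀ {z}, z ∉ B → z ≠ y₁ → z ≠ y₂ →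
        P.coef (swap (swap B x₂ y₂) x₁ y₁) y₂ z = P.coef B x₂ z - P.coef B x₁ z := by
      intro z hz hz1 hz2
      rw [P.coef_rest hB1 mx₁ (n1 hy₁ hy) hx₁y₁ my₂ (by grind) (n1 hz hz2) hz1, k2 hz hz2,
        k2 hy₁ hy, k1 hz hz2, k1 hy₁ hy, e21, e11]
      ring
    have l3 : ∀ {z}, z ∉ B → z ≠ y₁ → z ≠ y₂ →
        P.coef (swap (swap B x₂ y₂) x₁ y₁) y₁ z = P.coef B x₁ z := by
      intro z hz hz1 hz2
      rw [P.coef_row hB1 mx₁ (n1 hy₁ hy) hx₁y₁ (n1 hz hz2) hz1, k1 hz hz2, k1 hy₁ hy, e11, div_one]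
    have n2 : ∀ {z}, z ∉ B → z ≠ y₁ → z ≠ y₂ → z ∉ swap (swap B x₂ y₂) x₁ y₁ := by
      intro z; rw [mem_swap, mem_swap]; grind
    have := hP.2 _ hB2 x₃ y₁ y₂ u v (by simp only [mem_swap]; grind) (by simp only [mem_swap]; grind)
      (by simp only [mem_swap]; grind) (n2 hu hu1.symm hu2.symm) (n2 hv hv1.symm hv2.symm)
    rw [l1 hu hu1.symm hu2.symm, l1 hv hv1.symm hv2.symm, l2 hu hu1.symm hu2.symm,
      l2 hv hv1.symm hv2.symm, l3 hu hu1.symm hu2.symm, l3 hv hv1.symm hv2.symm, e13, e14, e23, e24,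
      e33, e34, ← hdb, ← hcd] at this
    rw [← hdb, ← hcd] at hb1
    rcases this (fun h => hc1 (by linear_combination h)) (by simp) (by simp) (by simp)
      (by simp) (by simpa [sub_eq_zero] using hb1) with h | h | h
    · exact hc (by linear_combination h)
    · exact mul_ne_zero hc hc (by linear_combination h)
    · exact hc (by linear_combination h)
  by_cases hb1 : b = 1
  · by_cases hd1 : d = 1
    · exact Or.inl ⟨hb1, hd1, t4 hb1 hd1⟩
    · by_cases hcd : c = d
      · exact Or.inr (Or.inr (Or.inl ⟨hb1, t5 hb1 hcd hd1, hcd ▸ t5 hb1 hcd hd1⟩))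
      · rcases t1 hcd with h | h
        · exact absurd (h.trans hb1) hd1
        · exact Or.inr (Or.inl ⟨hb1, by rw [h, hb1]; ring⟩)
  · by_cases hdb : d = b
    · by_cases hcd : c = d
      · have := t6 hb1 hcd hdb
        exact Or.inr (Or.inr (Or.inr (Or.inl ⟨hdb, this, by rw [← hdb, ← hcd, this]⟩)))
      · exact Or.inr (Or.inr (Or.inr (Or.inr (Or.inl ⟨hdb, t3 hb1 hcd hdb⟩))))
    · have h1 := (t2 hb1).resolve_left hdb
      refine Or.inr (Or.inr (Or.inr (Or.inr (Or.inr ⟨h1, ?_⟩))))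
      by_cases hcd : c = d
      · exact Or.inr hcd
      · left
        rw [(t1 hcd).resolve_left hdb, h1]
        ring

lemma map_div_of_cases {b c d : K} {b' c' d' : F} (hlam : IsCrossRatioMap lam)
    (hb : b ≠ 0) (hc : c ≠ 0) (hd : d ≠ 0) (hb' : b' = lam b) (hd' : d' / b' = lam (d / b))
    (hc' : -c' = lam (-c))
    (h : b = 1 ∧ d = 1 ∧ (c = 1 ∨ c = -1) ∨ b = 1 ∧ d = c + 1 ∨ b = 1 ∧ c = -1 ∧ d = -1 ∨
      d = b ∧ c = -1 ∧ b = -1 ∨ d = b ∧ b * (1 + c) = c ∨ d = b - 1 ∧ (c = -1 ∨ c = d)) :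
    d' / c' = lam (d / c) := by
  have hb0 : b' ≠ 0 := hb' ▸ hlam.map_ne_zero hb
  have hc0 : c' ≠ 0 := by
    have := hlam.map_ne_zero (neg_ne_zero.2 hc)
    rw [← hc'] at this
    simpa using this
  have hcm : c = -1 → c' = -1 := by
    rintro rfl
    rw [neg_neg, hlam.map_one] at hc'
    linear_combination -hc'
  have hc1 : lam (1 + c) = 1 + c' := by
    rw [show 1 + c = 1 - (-c) by ring, hlam.map_one_sub, ← hc']
    ring
  have hb1 : b = 1 → b' = 1 := by
    rintro rfl
    rw [hb', hlam.map_one]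
  rcases h with ⟨h1, rfl, rfl | h2⟩ | ⟨h1, rfl⟩ | ⟨h1, h2, h3⟩ | ⟨h1, h2, h3⟩ | ⟨h1, h2⟩ |
    ⟨rfl, h2 | h2⟩
  · rw [hb1 h1, h1, div_one, div_one, hlam.map_one] at hd'
    rw [hlam.map_neg_one] at hc'
    rw [hd', neg_injective hc', div_one, div_one, hlam.map_one]
  · rw [hb1 h1, h1, div_one, div_one, hlam.map_one] at hd'
    rw [hd', hcm h2, h2, one_div_neg_one_eq_neg_one, one_div_neg_one_eq_neg_one, hlam.map_neg_one]
  · rw [hb1 h1, h1, div_one, div_one, add_comm, hc1] at hd'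
    rw [show (c + 1) / c = 1 - (-c)⁻¹ by field_simp; ring, hlam.map_one_sub, hlam.map_inv, ← hc', hd']
    field_simp
    ring
  · rw [hb1 h1, h1, div_one, div_one, h3, hlam.map_neg_one] at hd'
    rw [hd', h2, h3, hcm h2, div_self (by simp), div_self (by simp), hlam.map_one]
  · rw [h1, div_self hb, hlam.map_one, div_eq_one_iff_eq hb0, hb', h3, hlam.map_neg_one] at hd'
    rw [hd', h1, h2, h3, hcm h2, div_self (by simp), div_self (by simp), hlam.map_one]
  · have h3 : 1 + c ≠ 0 := fun h => hc (by rw [← h2, h, mul_zero])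
    have h4 : 1 + c' ≠ 0 := hc1 ▸ hlam.map_ne_zero h3
    rw [h1, div_self hb, hlam.map_one, div_eq_one_iff_eq hb0, hb',
      show b = 1 - (1 + c)⁻¹ by field_simp; linear_combination h2, hlam.map_one_sub, hlam.map_inv,
      hc1] at hd'
    rw [h1, show b / c = (1 + c)⁻¹ by field_simp; linear_combination h2, hlam.map_inv, hc1, hd']
    field_simp
    ring
  all_goals
    have h3 : d' = b' - 1 := by
      rw [show (b - 1) / b = 1 - b⁻¹ by field_simp, hlam.map_one_sub, hlam.map_inv, ← hb'] at hd'
      field_simp at hd'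
      exact hd'
  · rw [hcm h2, h2, h3, div_neg, div_neg, div_one, div_one, neg_sub, neg_sub, hlam.map_one_sub, hb']
  · rw [h2, neg_sub, hlam.map_one_sub, ← hb'] at hc'
    rw [h3, h2, div_self hd, hlam.map_one, div_eq_one_iff_eq hc0]
    linear_combination hc'

/-- The zero pattern of the matrix `[1 0 1 1; 1 1 0 b; 0 1 c d]`. -/
structure HasPattern (P : PivotSystem K α) (B : Finset α) (x₁ x₂ x₃ y₁ y₂ u v : α) : Prop where
  e11 : P.coef B x₁ y₁ ≠ 0
  e12 : P.coef B x₁ y₂ = 0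
  e13 : P.coef B x₁ u ≠ 0
  e14 : P.coef B x₁ v ≠ 0
  e21 : P.coef B x₂ y₁ ≠ 0
  e22 : P.coef B x₂ y₂ ≠ 0
  e23 : P.coef B x₂ u = 0
  e24 : P.coef B x₂ v ≠ 0
  e31 : P.coef B x₃ y₁ = 0
  e32 : P.coef B x₃ y₂ ≠ 0
  e33 : P.coef B x₃ u ≠ 0
  e34 : P.coef B x₃ v ≠ 0

lemma HasPattern.exists_scale (h : P.HasPattern B x₁ x₂ x₃ y₁ y₂ u v)
    (hn : [x₁, x₂, x₃, y₁, y₂, u, v].Nodup) : ∃ s hs b c d, b ≠ 0 ∧ c ≠ 0 ∧ d ≠ 0 ∧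
      (P.scale s hs).HasNormalForm B x₁ x₂ x₃ y₁ y₂ u v b c d := by
  obtain ⟨e11, e12, e13, e14, e21, e22, e23, e24, e31, e32, e33, e34⟩ := h
  obtain ⟨s, hs, s1, s2, s3, t1, t2, su, sv⟩ : ∃ s : α → K, (∀ z, s z ≠ 0) ∧
      s x₁ = P.coef B x₁ y₁ / P.coef B x₂ y₁ ∧ s x₂ = 1 ∧
      s x₃ = P.coef B x₃ y₂ / P.coef B x₂ y₂ ∧ s y₁ = (P.coef B x₂ y₁)⁻¹ ∧
      s y₂ = (P.coef B x₂ y₂)⁻¹ ∧ s u = P.coef B x₁ y₁ / (P.coef B x₂ y₁ * P.coef B x₁ u) ∧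
      s v = P.coef B x₁ y₁ / (P.coef B x₂ y₁ * P.coef B x₁ v) := by
    refine ⟨fun z => if z = x₁ then P.coef B x₁ y₁ / P.coef B x₂ y₁ else
      if z = x₃ then P.coef B x₃ y₂ / P.coef B x₂ y₂ else if z = y₁ then (P.coef B x₂ y₁)⁻¹ else
      if z = y₂ then (P.coef B x₂ y₂)⁻¹ else
      if z = u then P.coef B x₁ y₁ / (P.coef B x₂ y₁ * P.coef B x₁ u) else
      if z = v then P.coef B x₁ y₁ / (P.coef B x₂ y₁ * P.coef B x₁ v) else 1, ?_, ?_⟩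
    · intro z
      dsimp only
      split_ifs <;> simp [*]
    · simp only [List.nodup_cons, List.mem_cons, List.not_mem_nil, or_false, not_or] at hn
      simp only [hn, if_true, if_false, true_and]
      grind
  refine ⟨s, hs, (P.scale s hs).coef B x₂ v, (P.scale s hs).coef B x₃ u,
    (P.scale s hs).coef B x₃ v, ?_, ?_, ?_, ?_⟩
  · exact div_ne_zero (mul_ne_zero e24 (hs _)) (hs _)
  · exact div_ne_zero (mul_ne_zero e33 (hs _)) (hs _)
  · exact div_ne_zero (mul_ne_zero e34 (hs _)) (hs _)
  · constructor
    all_goals try rfl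
    all_goals
      simp only [scale_coef, s1, s2, s3, t1, t2, su, sv, e12, e23, e31, zero_mul, zero_div]
    all_goals field_simp

lemma HasPattern.cr_eq (hlam : IsCrossRatioMap lam) (hP : P.NoUniform) (hB : P.IsBase B)
    (hQ : Q.IsBase B) (hn : [x₁, x₂, x₃, y₁, y₂, u, v].Nodup) (hx₁ : x₁ ∈ B) (hx₂ : x₂ ∈ B)
    (hx₃ : x₃ ∈ B) (hy₁ : y₁ ∉ B) (hy₂ : y₂ ∉ B) (hu : u ∉ B) (hv : v ∉ B)
    (hp : P.HasPattern B x₁ x₂ x₃ y₁ y₂ u v) (hq : Q.HasPattern B x₁ x₂ x₃ y₁ y₂ u v)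
    (h1 : Q.cr B x₁ x₂ y₁ v = lam (P.cr B x₁ x₂ y₁ v))
    (h2 : Q.cr B x₂ x₃ y₂ v = lam (P.cr B x₂ x₃ y₂ v))
    (h3 : Q.cr (swap B x₁ y₁) x₂ x₃ y₂ u = lam (P.cr (swap B x₁ y₁) x₂ x₃ y₂ u)) :
    Q.cr B x₁ x₃ u v = lam (P.cr B x₁ x₃ u v) := by
  obtain ⟨s, hs, b, c, d, hb, hc, hd, N⟩ := hp.exists_scale hn
  obtain ⟨t, ht, b', c', d', -, -, -, N'⟩ := hq.exists_scale hn
  simp only [List.nodup_cons, List.mem_cons, List.not_mem_nil, or_false, not_or] at hn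
  obtain ⟨⟨n1, n2, -⟩, ⟨n3, -⟩, -, ⟨n4, n5, n6⟩, ⟨n7, n8⟩, n9, -⟩ := hn
  have hB' : (P.scale s hs).IsBase B := hB
  have hQ' : (Q.scale t ht).IsBase B := hQ
  have hcases := N.cases (hP.scale s hs) hB' hx₁ hx₂ hx₃ hy₁ hy₂ hu hv n1 n2 n3 n4 n5 n7 n6 n8 n9
    hb hc hd
  rw [← cr_scale s hs, ← cr_scale t ht] at h1 h2 h3 ⊢
  rw [N.cr_swap hB' hx₁ hx₂ hx₃ hy₁ hy₂ hu n1 n2 n4 n5,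
    N'.cr_swap hQ' hx₁ hx₂ hx₃ hy₁ hy₂ hu n1 n2 n4 n5] at h3
  obtain ⟨e11, e12, e13, e14, e21, e22, e23, e24, e31, e32, e33, e34⟩ := N
  obtain ⟨f11, f12, f13, f14, f21, f22, f23, f24, f31, f32, f33, f34⟩ := N'
  simp only [cr, e11, e13, e14, e21, e22, e24, e32, e33, e34, f11, f13, f14,
    f21, f22, f24, f32, f33, f34, one_mul, mul_one, div_one] at h1 h2 ⊢
  exact map_div_of_cases hlam hb hc hd h1 h2 h3 hcases

end PivotSystem
end PathOfLengthFour

section Gluing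

variable {K F α : Type*} [Field K] [Field F] [DecidableEq α]

namespace PivotSystem

variable {P : PivotSystem K α} {Q : PivotSystem F α} {S B B' : Finset α} {lam : K → F}
  {x y u v e f z p q : α}

/-- The system `Q` lifts `P` after deleting either of the columns `u` and `v`. -/
structure Glued (lam : K → F) (P : PivotSystem K α) (Q : PivotSystem F α) (S B : Finset α)
    (u v : α) : Prop where
  map : IsCrossRatioMap lam
  noUniform : P.NoUniform
  isBase : P.IsBase B
  huS : u ∈ S
  hvS : v ∈ S
  huv : u ≠ v
  hu : u ∉ B
  hv : v ∉ B
  lifts_u : Lifts lam P Q (S.erase u) B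
  lifts_v : Lifts lam P Q (S.erase v) B
  isConn : IsConn (P.graph S B) ((S.erase u).erase v)
  exists_lift : ∀ z ∈ S, ∀ C, P.IsBase C → Agree S C B → ∃ R : PivotSystem F α,
    Lifts lam P R (S.erase z) C

/-- The rows `x` and `y` witness that `Q` does not lift `P`. -/
structure IsBad (lam : K → F) (P : PivotSystem K α) (Q : PivotSystem F α) (S B : Finset α)
    (u v x y : α) : Prop where
  hx : x ∈ B
  hxS : x ∈ S
  hy : y ∈ B
  hyS : y ∈ S
  xu : P.coef B x u ≠ 0
  xv : P.coef B x v ≠ 0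
  yu : P.coef B y u ≠ 0
  yv : P.coef B y v ≠ 0
  ne : Q.cr B x y u v ≠ lam (P.cr B x y u v)

lemma IsBad.symm (hlam : IsCrossRatioMap lam) (h : IsBad lam P Q S B u v x y) :
    IsBad lam P Q S B v u x y := by
  refine ⟨h.hx, h.hxS, h.hy, h.hyS, h.xv, h.xu, h.yv, h.yu, fun h0 => h.ne ?_⟩
  rw [cr_swap_right, h0, cr_swap_right (u := v), hlam.map_inv]

namespace Glued

lemma symm (h : Glued lam P Q S B u v) : Glued lam P Q S B v u :=
  ⟨h.map, h.noUniform, h.isBase, h.hvS, h.huS, h.huv.symm, h.hv, h.hu, h.lifts_v, h.lifts_u,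
    by rw [Finset.erase_right_comm]; exact h.isConn, h.exists_lift⟩

lemma rebase (h : Glued lam P Q S B u v) (hB' : P.IsBase B')
    (hA : Agree ((S.erase u).erase v) B' B) : Glued lam P Q S B' u v where
  map := h.map
  noUniform := h.noUniform
  isBase := hB'
  huS := h.huS
  hvS := h.hvS
  huv := h.huv
  hu := by rw [hA u (by simp)]; exact h.hu
  hv := by rw [hA v (by simp)]; exact h.hv
  lifts_u := h.lifts_u.rebase (hA.mono (Finset.erase_subset _ _))
  lifts_v := h.lifts_v.rebase (hA.mono (by rw [Finset.erase_right_comm]; exact Finset.erase_subset _ _))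
  isConn := by
    have hsub : (S.erase u).erase v ⊆ S :=
      (Finset.erase_subset _ _).trans (Finset.erase_subset _ _)
    rw [isConn_graph_iff hsub]
    exact isConn_of_agree h.isBase hB' hA ((isConn_graph_iff hsub).1 h.isConn)
  exists_lift := fun z hz B'' hB'' hA' => h.exists_lift z hz B'' hB'' (hA'.trans
    (hA.mono ((Finset.erase_subset _ _).trans (Finset.erase_subset _ _))))

lemma isBase' (h : Glued lam P Q S B u v) : Q.IsBase B := h.lifts_u.isBase (Agree.refl _ _) h.isBase

lemma ne_of_mem (h : Glued lam P Q S B u v) (hx : x ∈ B) : x ≠ u ∧ x ≠ v :=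
  ⟨fun h0 => h.hu (h0 ▸ hx), fun h0 => h.hv (h0 ▸ hx)⟩

lemma coef_eq_zero (h : Glued lam P Q S B u v) (hx : x ∈ B) (hxS : x ∈ S) (he : e ∉ B)
    (heS : e ∈ S) : Q.coef B x e = 0 ↔ P.coef B x e = 0 := by
  obtain ⟨h1, h2⟩ := h.ne_of_mem hx
  by_cases heu : e = u
  · exact h.lifts_v.coef_eq_zero (Agree.refl _ _) h.isBase hx (by simp [*]) he
      (by rw [heu]; simp [h.huv, h.huS])
  · exact h.lifts_u.coef_eq_zero (Agree.refl _ _) h.isBase hx (by simp [*]) he (by simp [*])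

lemma cr_eq (h : Glued lam P Q S B u v) (hx : x ∈ B) (hxS : x ∈ S) (hy : y ∈ B) (hyS : y ∈ S)
    (he : e ∉ B) (heS : e ∈ S) (hf : f ∉ B) (hfS : f ∈ S) (hef : e ≠ u ∧ f ≠ u ∨ e ≠ v ∧ f ≠ v)
    (h1 : P.coef B x e ≠ 0) (h2 : P.coef B x f ≠ 0) (h3 : P.coef B y e ≠ 0)
    (h4 : P.coef B y f ≠ 0) : Q.cr B x y e f = lam (P.cr B x y e f) := by
  obtain ⟨n1, n2⟩ := h.ne_of_mem hx
  obtain ⟨n3, n4⟩ := h.ne_of_mem hy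
  rcases hef with ⟨n5, n6⟩ | ⟨n5, n6⟩
  · exact h.lifts_u.2 B (Agree.refl _ _) h.isBase x y e f hx (by simp [*]) hy (by simp [*]) he
      (by simp [*]) hf (by simp [*]) h1 h2 h3 h4
  · exact h.lifts_v.2 B (Agree.refl _ _) h.isBase x y e f hx (by simp [*]) hy (by simp [*]) he
      (by simp [*]) hf (by simp [*]) h1 h2 h3 h4

lemma _root_.Paper.eq_of_reachable {β γ : Type*} {G : SimpleGraph β} {g : β → γ}
    (hg : ∀ a b, G.Adj a b → g a = g b) {a b : β} (h : G.Reachable a b) : g a = g b := by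
  obtain ⟨w⟩ := h
  induction w with
  | nil => rfl
  | cons hadj _ ih => exact (hg _ _ hadj).trans ih

/-- Every other element separates a pair of bad rows. -/
lemma not_reachable (h : Glued lam P Q S B u v) (hbad : IsBad lam P Q S B u v x y)
    (hz : z ∈ (S.erase u).erase v) (hzx : z ≠ x) (hzy : z ≠ y) :
    ¬ (P.graph (((S.erase u).erase v).erase z) B).Reachable x y := by
  intro hr
  simp only [Finset.mem_erase] at hz
  obtain ⟨hzv, hzu, hzS⟩ := hz
  obtain ⟨R, hR⟩ := h.exists_lift z hzS B h.isBase (Agree.refl _ _)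
  have hR0 := hR.isBase (Agree.refl _ _) h.isBase
  have su : (S.erase u).erase z ⊆ S.erase z := Finset.erase_subset_erase _ (Finset.erase_subset _ _)
  have sv : (S.erase v).erase z ⊆ S.erase z := Finset.erase_subset_erase _ (Finset.erase_subset _ _)
  obtain ⟨σ, hσ0, hσ⟩ := (h.lifts_u.mono (Finset.erase_subset z _)).exists_scaled_of_lifts h.isBase
    (hR.mono su)
  obtain ⟨τ, hτ0, hτ⟩ := (h.lifts_v.mono (Finset.erase_subset z _)).exists_scaled_of_lifts h.isBase
    (hR.mono sv)
  have hedge : ∀ p q, p ∈ B → q ∉ B → p ∈ ((S.erase u).erase v).erase z →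
      q ∈ ((S.erase u).erase v).erase z → P.coef B p q ≠ 0 → σ p / τ p = σ q / τ q := by
    intro p q hp hq hpS hqS hpq
    simp only [Finset.mem_erase] at hpS hqS
    have e1 := hσ p hp (by simp [hpS]) q hq (by simp [hqS])
    have e2 := hτ p hp (by simp [hpS]) q hq (by simp [hqS])
    have hQ : Q.coef B p q ≠ 0 := by
      rwa [ne_eq, h.coef_eq_zero hp hpS.2.2.2 hq hqS.2.2.2]
    have g1 := hσ0 p
    have g2 := hσ0 q
    have g3 := hτ0 p
    have g4 := hτ0 q
    rw [e1] at e2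
    field_simp at e2 ⊢
    exact e2.symm
  have hst : σ x / τ x = σ y / τ y := by
    refine eq_of_reachable (g := fun z => σ z / τ z) (fun a b hab => ?_) hr
    obtain ⟨ha, hb, ⟨h1, h2, h3⟩ | ⟨h1, h2, h3⟩⟩ := graph_adj.1 hab
    · exact hedge a b h1 h2 ha hb h3
    · exact (hedge b a h1 h2 hb ha h3).symm
  obtain ⟨nxu, nxv⟩ := h.ne_of_mem hbad.hx
  obtain ⟨nyu, nyv⟩ := h.ne_of_mem hbad.hy
  have hxS := hbad.hxS
  have hyS := hbad.hyS
  have huS := h.huS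
  have hvS := h.hvS
  have huv := h.huv
  have e1 := hσ x hbad.hx (by simp [*, hzx.symm]) v h.hv (by simp [*, huv.symm, hzv.symm])
  have e2 := hσ y hbad.hy (by simp [*, hzy.symm]) v h.hv (by simp [*, huv.symm, hzv.symm])
  have e3 := hτ x hbad.hx (by simp [*, hzx.symm]) u h.hu (by simp [*, hzu.symm])
  have e4 := hτ y hbad.hy (by simp [*, hzy.symm]) u h.hu (by simp [*, hzu.symm])
  have key := hR.2 B (Agree.refl _ _) h.isBase x y u v hbad.hx (by simp [*, hzx.symm]) hbad.hy
    (by simp [*, hzy.symm]) h.hu (by simp [*, hzu.symm]) h.hv (by simp [*, hzv.symm]) hbad.xu hbad.xv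
    hbad.yu hbad.yv
  refine hbad.ne (Eq.trans ?_ key)
  simp only [cr]
  rw [e1, e2, e3, e4]
  have g1 := hσ0 x
  have g2 := hσ0 y
  have g3 := hτ0 x
  have g4 := hτ0 y
  have g5 := hσ0 v
  have g6 := hτ0 u
  have hst' : σ x = σ y / τ y * τ x := by
    rw [← hst]
    field_simp
  rw [hst']
  have := hbad.xu
  have q1 : Q.coef B x v ≠ 0 := by
    rw [ne_eq, h.coef_eq_zero hbad.hx hxS h.hv hvS]; exact hbad.xv
  have q2 : Q.coef B y u ≠ 0 := by
    rw [ne_eq, h.coef_eq_zero hbad.hy hyS h.hu huS]; exact hbad.yu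
  field_simp

/-- A pivot leaving alone two rows and two columns. -/
lemma bad_swap (h : Glued lam P Q S B u v) (hbad : IsBad lam P Q S B u v x y) (hp : p ∈ B)
    (hpS : p ∈ S) (hq : q ∉ B) (hqS : q ∈ S) (hqu : q ≠ u) (hqv : q ≠ v) (hpq : P.coef B p q ≠ 0)
    (hpx : p ≠ x) (hpy : p ≠ y)
    (hz : P.coef B x q = 0 ∧ P.coef B y q = 0 ∨ P.coef B p u = 0 ∧ P.coef B p v = 0) :
    Glued lam P Q S (swap B p q) u v ∧ IsBad lam P Q S (swap B p q) u v x y := by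
  have hB' := swap_isBase h.isBase hp hq hpq
  obtain ⟨npu, npv⟩ := h.ne_of_mem hp
  have hpq' : Q.coef B p q ≠ 0 := by rwa [ne_eq, h.coef_eq_zero hp hpS hq hqS]
  refine ⟨h.rebase hB' ((Agree.refl _ _).swap_left (by simp [*]) (by simp [*])), ?_⟩
  have e : ∀ a e, a = x ∨ a = y → e = u ∨ e = v → e ∉ B → e ∈ S → e ≠ q →
      P.coef (swap B p q) a e = P.coef B a e ∧ Q.coef (swap B p q) a e = Q.coef B a e := by
    intro a e ha he heB heS heq
    have ha' : a ∈ B ∧ a ∈ S ∧ a ≠ p := by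
      rcases ha with rfl | rfl
      · exact ⟨hbad.hx, hbad.hxS, hpx.symm⟩
      · exact ⟨hbad.hy, hbad.hyS, hpy.symm⟩
    rw [P.coef_rest h.isBase hp hq hpq ha'.1 ha'.2.2 heB heq,
      Q.coef_rest h.isBase' hp hq hpq' ha'.1 ha'.2.2 heB heq]
    have h1 : P.coef B a q = 0 ∨ P.coef B p e = 0 := by
      rcases hz with ⟨hz1, hz2⟩ | ⟨hz1, hz2⟩
      · rcases ha with rfl | rfl <;> simp [*]
      · rcases he with rfl | rfl <;> simp [*]
    have h2 : Q.coef B a q = 0 ∨ Q.coef B p e = 0 := by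
      rwa [h.coef_eq_zero ha'.1 ha'.2.1 hq hqS, h.coef_eq_zero hp hpS heB heS]
    constructor
    · rcases h1 with h1 | h1 <;> simp [h1]
    · rcases h2 with h2 | h2 <;> simp [h2]
  have e1 := e x u (Or.inl rfl) (Or.inl rfl) h.hu h.huS hqu.symm
  have e2 := e x v (Or.inl rfl) (Or.inr rfl) h.hv h.hvS hqv.symm
  have e3 := e y u (Or.inr rfl) (Or.inl rfl) h.hu h.huS hqu.symm
  have e4 := e y v (Or.inr rfl) (Or.inr rfl) h.hv h.hvS hqv.symm
  refine ⟨mem_swap.2 (Or.inr ⟨hpx.symm, hbad.hx⟩), hbad.hxS, mem_swap.2 (Or.inr ⟨hpy.symm, hbad.hy⟩),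
    hbad.hyS, ?_, ?_, ?_, ?_, ?_⟩
  · rw [e1.1]; exact hbad.xu
  · rw [e2.1]; exact hbad.xv
  · rw [e3.1]; exact hbad.yu
  · rw [e4.1]; exact hbad.yv
  · have := hbad.ne
    simp only [cr] at this ⊢
    rwa [e1.1, e1.2, e2.1, e2.2, e3.1, e3.2, e4.1, e4.2]

lemma exists_path (h : Glued lam P Q S B u v) (hbad : IsBad lam P Q S B u v x y) :
    ∃ (p : ℕ → α) (d : ℕ), p 0 = x ∧ p d = y ∧ 2 ≤ d ∧ Even d ∧
      (∀ i ≤ d, p i ∈ (S.erase u).erase v) ∧ (∀ i ≤ d, ∀ j ≤ d, p i = p j → i = j) ∧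
      (∀ i ≤ d, (p i ∈ B ↔ Even i)) ∧
      ∀ i ≤ d, ∀ j ≤ d, Even i → ¬ Even j →
        (P.coef B (p i) (p j) ≠ 0 ↔ j = i + 1 ∨ i = j + 1) := by
  obtain ⟨nxu, nxv⟩ := h.ne_of_mem hbad.hx
  obtain ⟨nyu, nyv⟩ := h.ne_of_mem hbad.hy
  have hxS := hbad.hxS
  have hyS := hbad.hyS
  have hsub : (S.erase u).erase v ⊆ S := (Finset.erase_subset _ _).trans (Finset.erase_subset _ _)
  have hxW : x ∈ (S.erase u).erase v := by simp [*]
  have hyW : y ∈ (S.erase u).erase v := by simp [*]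
  have hr := reachable_of_isConn ((isConn_graph_iff hsub).1 h.isConn) hxW hyW
  obtain ⟨p, h0, hd, hadj, hdist⟩ := exists_geodesic hr
  generalize hdd : (P.graph ((S.erase u).erase v) B).dist x y = d at hd hadj hdist
  have hpB := chain_mem_iff hadj (h0 ▸ hbad.hx)
  have hev : Even d := by
    rw [← hpB d le_rfl, hd]
    exact hbad.hy
  have hd0 : d ≠ 0 := by
    rintro rfl
    have hxy : x = y := h0.symm.trans hd
    apply hbad.ne
    have q1 : Q.coef B x u ≠ 0 := by
      rw [ne_eq, h.coef_eq_zero hbad.hx hxS h.hu h.huS]; exact hbad.xu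
    have q2 : Q.coef B x v ≠ 0 := by
      rw [ne_eq, h.coef_eq_zero hbad.hx hxS h.hv h.hvS]; exact hbad.xv
    rw [← hxy, cr_self_left q1 q2, cr_self_left hbad.xu hbad.xv, h.map.map_one]
  have hpW : ∀ i ≤ d, p i ∈ (S.erase u).erase v := by
    intro i hi
    rcases Nat.lt_or_ge i d with hlt | hge
    · exact (graph_adj.1 (hadj i hlt)).1
    · rw [le_antisymm hi hge, hd]; exact hyW
  have hreach : ∀ i ≤ d, (P.graph ((S.erase u).erase v) B).Reachable x (p i) := by
    intro i hi
    rw [← h0]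
    exact (dist_le_of_chain p (Nat.zero_le i) fun j _ hj => hadj j (by omega)).1
  refine ⟨p, d, h0, hd, ?_, hev, hpW, ?_, hpB, ?_⟩
  · obtain ⟨k, rfl⟩ := hev
    omega
  · intro i hi j hj hij
    rw [← hdist i hi, ← hdist j hj, hij]
  · intro i hi j hj hei hej
    have hiB := (hpB i hi).2 hei
    have hjB : p j ∉ B := fun h1 => hej ((hpB j hj).1 h1)
    constructor
    · intro hc
      have hij : (P.graph ((S.erase u).erase v) B).Adj (p i) (p j) :=
        graph_adj.2 ⟨hpW i hi, hpW j hj, Or.inl ⟨hiB, hjB, hc⟩⟩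
      have l1 := dist_le_succ_of_adj (hreach i hi) hij
      have l2 := dist_le_succ_of_adj (hreach j hj) hij.symm
      rw [hdist i hi, hdist j hj] at l1 l2
      have : i ≠ j := by rintro rfl; exact hej hei
      omega
    · rintro (rfl | rfl)
      · have := (graph_adj.1 (hadj i (by omega))).2.2
        tauto
      · have := (graph_adj.1 (hadj j (by omega))).2.2
        tauto

/-- Bad rows do not have a common neighbour apart from `u` and `v`. -/
lemma not_bad_of_common (h : Glued lam P Q S B u v) (hbad : IsBad lam P Q S B u v x y)
    (hz : z ∈ (S.erase u).erase v) (hzx : z ≠ x) (hzy : z ≠ y) (hq : q ∉ B) (hqS : q ∈ S)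
    (hqu : q ≠ u) (hqv : q ≠ v) (hqz : q ≠ z) (hxq : P.coef B x q ≠ 0) (hyq : P.coef B y q ≠ 0) :
    False := by
  obtain ⟨nxu, nxv⟩ := h.ne_of_mem hbad.hx
  obtain ⟨nyu, nyv⟩ := h.ne_of_mem hbad.hy
  have hxS := hbad.hxS
  have hyS := hbad.hyS
  refine h.not_reachable hbad hz hzx hzy ?_
  have hqW : q ∈ ((S.erase u).erase v).erase z := by simp [*]
  have h1 : (P.graph (((S.erase u).erase v).erase z) B).Adj x q :=
    graph_adj.2 ⟨by simp [*, hzx.symm], hqW, Or.inl ⟨hbad.hx, hq, hxq⟩⟩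
  have h2 : (P.graph (((S.erase u).erase v).erase z) B).Adj y q :=
    graph_adj.2 ⟨by simp [*, hzy.symm], hqW, Or.inl ⟨hbad.hy, hq, hyq⟩⟩
  exact h1.reachable.trans h2.symm.reachable

lemma coef_ne_zero (h : Glued lam P Q S B u v) (hx : x ∈ B) (hxS : x ∈ S) (he : e ∉ B)
    (heS : e ∈ S) (h0 : P.coef B x e ≠ 0) : Q.coef B x e ≠ 0 := by
  rwa [ne_eq, h.coef_eq_zero hx hxS he heS]

lemma not_bad_two (h : Glued lam P Q S B u v) (hbad : IsBad lam P Q S B u v x y)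
    (hq : q ∉ B) (hqS : q ∈ S) (hqu : q ≠ u) (hqv : q ≠ v) (hxq : P.coef B x q ≠ 0)
    (hyq : P.coef B y q ≠ 0) : False := by
  obtain ⟨hx, hxS, hy, hyS, xu, xv, yu, yv, hne⟩ := hbad
  have h1 := h.cr_eq hx hxS hy hyS h.hu h.huS hq hqS (Or.inr ⟨h.huv, hqv⟩) xu hxq yu hyq
  have h2 := h.cr_eq hx hxS hy hyS hq hqS h.hv h.hvS (Or.inl ⟨hqu, h.huv.symm⟩) hxq xv hyq yv
  have hxq' := h.coef_ne_zero hx hxS hq hqS hxq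
  have hyq' := h.coef_ne_zero hy hyS hq hqS hyq
  have mulP : P.cr B x y u q * P.cr B x y q v = P.cr B x y u v := by
    simp only [cr]
    field_simp
  have mulQ : Q.cr B x y u q * Q.cr B x y q v = Q.cr B x y u v := by
    simp only [cr]
    field_simp
  refine hne ?_
  rw [← mulP, ← mulQ, h1, h2, h.map.map_mul (cr_ne_zero hxq xv hyq yv)]
  rw [cr_eq_one_iff hxq yu, cr_eq_one_iff xv hyq, mulP, cr_eq_one_iff xv yu]
  have := h.noUniform.1 B h.isBase x y u q v hx hy h.hu hq h.hv xu hxq xv yu hyq yv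
  tauto

lemma cr_eq_of_three {x₁ x₂ x₃ : α} (h : Glued lam P Q S B u v)
    (h13 : IsBad lam P Q S B u v x₁ x₃) (hx₂ : x₂ ∈ B) (hx₂S : x₂ ∈ S) (x2u : P.coef B x₂ u ≠ 0)
    (x2v : P.coef B x₂ v ≠ 0) :
    IsBad lam P Q S B u v x₁ x₂ ∨ IsBad lam P Q S B u v x₂ x₃ := by
  by_contra! hcon
  obtain ⟨hx, hxS, hy, hyS, xu, xv, yu, yv, hne⟩ := h13
  have h1 : Q.cr B x₁ x₂ u v = lam (P.cr B x₁ x₂ u v) := by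
    by_contra h0
    exact hcon.1 ⟨hx, hxS, hx₂, hx₂S, xu, xv, x2u, x2v, h0⟩
  have h2 : Q.cr B x₂ x₃ u v = lam (P.cr B x₂ x₃ u v) := by
    by_contra h0
    exact hcon.2 ⟨hx₂, hx₂S, hy, hyS, x2u, x2v, yu, yv, h0⟩
  have x2u' := h.coef_ne_zero hx₂ hx₂S h.hu h.huS x2u
  have x2v' := h.coef_ne_zero hx₂ hx₂S h.hv h.hvS x2v
  have mulP : P.cr B x₁ x₂ u v * P.cr B x₂ x₃ u v = P.cr B x₁ x₃ u v := by
    simp only [cr]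
    field_simp
  have mulQ : Q.cr B x₁ x₂ u v * Q.cr B x₂ x₃ u v = Q.cr B x₁ x₃ u v := by
    simp only [cr]
    field_simp
  refine hne ?_
  rw [← mulP, ← mulQ, h1, h2, h.map.map_mul (cr_ne_zero x2u x2v yu yv)]
  rw [cr_eq_one_iff xv x2u, cr_eq_one_iff x2v yu, mulP, cr_eq_one_iff xv yu]
  have := h.noUniform.2 B h.isBase x₁ x₂ x₃ u v hx hx₂ hy h.hu h.hv xu x2u yu xv x2v yv
  tauto

lemma not_bad_of_pattern {x₁ x₂ x₃ y₁ y₂ : α} (h : Glued lam P Q S B u v)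
    (hbad : IsBad lam P Q S B u v x₁ x₃) (hn : [x₁, x₂, x₃, y₁, y₂, u, v].Nodup) (hx₂ : x₂ ∈ B)
    (hx₂S : x₂ ∈ S) (hy₁ : y₁ ∉ B) (hy₁S : y₁ ∈ S) (hy₂ : y₂ ∉ B) (hy₂S : y₂ ∈ S)
    (hp : P.HasPattern B x₁ x₂ x₃ y₁ y₂ u v) : False := by
  obtain ⟨hx₁, hx₁S, hx₃, hx₃S, -, -, -, -, hne⟩ := hbad
  obtain ⟨e11, e12, e13, e14, e21, e22, e23, e24, e31, e32, e33, e34⟩ := hp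
  have nz := fun {x e : α} => h.coef_ne_zero (x := x) (e := e)
  have zero := fun {x e : α} => h.coef_eq_zero (x := x) (e := e)
  have hq : Q.HasPattern B x₁ x₂ x₃ y₁ y₂ u v :=
    ⟨nz hx₁ hx₁S hy₁ hy₁S e11, (zero hx₁ hx₁S hy₂ hy₂S).2 e12, nz hx₁ hx₁S h.hu h.huS e13,
      nz hx₁ hx₁S h.hv h.hvS e14, nz hx₂ hx₂S hy₁ hy₁S e21, nz hx₂ hx₂S hy₂ hy₂S e22,
      (zero hx₂ hx₂S h.hu h.huS).2 e23, nz hx₂ hx₂S h.hv h.hvS e24, (zero hx₃ hx₃S hy₁ hy₁S).2 e31,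
      nz hx₃ hx₃S hy₂ hy₂S e32, nz hx₃ hx₃S h.hu h.huS e33, nz hx₃ hx₃S h.hv h.hvS e34⟩
  refine hne (HasPattern.cr_eq h.map h.noUniform h.isBase h.isBase' hn hx₁ hx₂ hx₃ hy₁ hy₂ h.hu h.hv
    ⟨e11, e12, e13, e14, e21, e22, e23, e24, e31, e32, e33, e34⟩ hq ?_ ?_ ?_)
  all_goals
    simp only [List.nodup_cons, List.mem_cons, List.not_mem_nil, or_false, not_or] at hn
    obtain ⟨⟨n1, n2, n10, n11, n12, n13⟩, ⟨n3, -⟩, -, ⟨n4, n5, n6⟩, ⟨n7, n8⟩, n9, -⟩ := hn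
  · exact h.cr_eq hx₁ hx₁S hx₂ hx₂S hy₁ hy₁S h.hv h.hvS (Or.inl ⟨n5, h.huv.symm⟩) e11 e14 e21 e24
  · exact h.cr_eq hx₂ hx₂S hx₃ hx₃S hy₂ hy₂S h.hv h.hvS (Or.inl ⟨n7, h.huv.symm⟩) e22 e24 e32 e34
  · have h' := h.rebase (swap_isBase h.isBase hx₁ hy₁ e11)
      ((Agree.refl _ _).swap_left (by simp [*]) (by simp [*]))
    have m : ∀ {a}, a ∈ B → a ≠ x₁ → a ∈ swap B x₁ y₁ := fun h1 h2 => mem_swap.2 (Or.inr ⟨h2, h1⟩)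
    have n : ∀ {a}, a ∉ B → a ≠ y₁ → a ∉ swap B x₁ y₁ := by intro a; rw [mem_swap]; grind
    have hrest : ∀ {i e}, i ∈ B → i ≠ x₁ → e ∉ B → e ≠ y₁ → P.coef (swap B x₁ y₁) i e =
        P.coef B i e - P.coef B i y₁ * P.coef B x₁ e / P.coef B x₁ y₁ :=
      fun hi hi1 he he1 => P.coef_rest h.isBase hx₁ hy₁ e11 hi hi1 he he1
    refine h'.cr_eq (m hx₂ (Ne.symm n1)) hx₂S (m hx₃ (Ne.symm n2)) hx₃S (n hy₂ (Ne.symm n4)) hy₂S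
      (n h.hu (Ne.symm n5)) h.huS (Or.inr ⟨n8, h.huv⟩) ?_ ?_ ?_ ?_
    · rw [hrest hx₂ (Ne.symm n1) hy₂ (Ne.symm n4), e12]
      simpa
    · rw [hrest hx₂ (Ne.symm n1) h.hu (Ne.symm n5), e23]
      simp [*]
    · rw [hrest hx₃ (Ne.symm n2) hy₂ (Ne.symm n4), e31]
      simpa
    · rw [hrest hx₃ (Ne.symm n2) h.hu (Ne.symm n5), e31]
      simpa

lemma not_bad_four {x₁ x₂ x₃ y₁ y₂ : α} (h : Glued lam P Q S B u v)
    (hbad : IsBad lam P Q S B u v x₁ x₃) (hn : [x₁, x₂, x₃, y₁, y₂, u, v].Nodup) (hx₂ : x₂ ∈ B)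
    (hx₂S : x₂ ∈ S) (hy₁ : y₁ ∉ B) (hy₁S : y₁ ∈ S) (hy₂ : y₂ ∉ B) (hy₂S : y₂ ∈ S)
    (e11 : P.coef B x₁ y₁ ≠ 0) (e12 : P.coef B x₁ y₂ = 0) (e21 : P.coef B x₂ y₁ ≠ 0)
    (e22 : P.coef B x₂ y₂ ≠ 0) (e31 : P.coef B x₃ y₁ = 0) (e32 : P.coef B x₃ y₂ ≠ 0) : False := by
  have hn' := hn
  have hn'' : [x₁, x₂, x₃, y₁, y₂, v, u].Nodup := by
    simp only [List.nodup_cons, List.mem_cons, List.not_mem_nil, or_false, not_or] at hn ⊢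
    grind
  simp only [List.nodup_cons, List.mem_cons, List.not_mem_nil, or_false, not_or] at hn
  obtain ⟨⟨n1, n2, n10, n11, n12, n13⟩, ⟨n3, n14, n15, n16, n17⟩, ⟨n18, n19, n20, n21⟩, ⟨n4, n5, n6⟩,
    ⟨n7, n8⟩, n9, -⟩ := hn
  have hx₁S := hbad.hxS
  have hx₃S := hbad.hyS
  by_cases hu0 : P.coef B x₂ u = 0 <;> by_cases hv0 : P.coef B x₂ v = 0
  · obtain ⟨h', hbad'⟩ := h.bad_swap hbad hx₂ hx₂S hy₁ hy₁S n5 n6 e21 (Ne.symm n1) n3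
      (Or.inr ⟨hu0, hv0⟩)
    refine h'.not_bad_of_common hbad' (z := x₂) (q := y₂) (by simp [*]) (Ne.symm n1) n3
      (by rw [mem_swap]; grind) hy₂S n7 n8 (Ne.symm n15) ?_ ?_
    · rw [P.coef_rest h.isBase hx₂ hy₁ e21 hbad.hx n1 hy₂ (Ne.symm n4), e12]
      simp [*]
    · rw [P.coef_rest h.isBase hx₂ hy₁ e21 hbad.hy (Ne.symm n3) hy₂ (Ne.symm n4), e31]
      simpa
  · exact h.not_bad_of_pattern hbad hn' hx₂ hx₂S hy₁ hy₁S hy₂ hy₂S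
      ⟨e11, e12, hbad.xu, hbad.xv, e21, e22, hu0, hv0, e31, e32, hbad.yu, hbad.yv⟩
  · exact h.symm.not_bad_of_pattern (hbad.symm h.map) hn'' hx₂ hx₂S hy₁ hy₁S hy₂ hy₂S
      ⟨e11, e12, hbad.xv, hbad.xu, e21, e22, hv0, hu0, e31, e32, hbad.yv, hbad.yu⟩
  · rcases h.cr_eq_of_three hbad hx₂ hx₂S hu0 hv0 with hb | hb
    · exact h.not_bad_of_common hb (z := x₃) (q := y₁) (by simp [*]) (Ne.symm n2) (Ne.symm n3) hy₁ hy₁S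
        n5 n6 (Ne.symm n18) e11 e21
    · exact h.not_bad_of_common hb (z := x₁) (q := y₂) (by simp [*]) n1 n2 hy₂ hy₂S n7 n8
        (Ne.symm n11) e22 e32

/-- Two partial lifts are never in conflict. -/
theorem not_bad (h : Glued lam P Q S B u v) : ¬ IsBad lam P Q S B u v x y := by
  intro hbad
  obtain ⟨p, d, rfl, rfl, hd2, hev, hpW, hinj, hpB, hco⟩ := h.exists_path hbad
  have hco0 : ∀ i ≤ d, ∀ j ≤ d, Even i → ¬ Even j → ¬ (j = i + 1 ∨ i = j + 1) →
      P.coef B (p i) (p j) = 0 := by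
    intro i hi j hj hei hej hij
    by_contra h0
    exact hij ((hco i hi j hj hei hej).1 h0)
  have hpS : ∀ i ≤ d, p i ∈ S := fun i hi => Finset.mem_of_mem_erase (Finset.mem_of_mem_erase (hpW i hi))
  have hpu : ∀ i ≤ d, p i ≠ u := fun i hi =>
    Finset.ne_of_mem_erase (Finset.mem_of_mem_erase (hpW i hi))
  have hpv : ∀ i ≤ d, p i ≠ v := fun i hi => Finset.ne_of_mem_erase (hpW i hi)
  have hB : ∀ i ≤ d, Even i → p i ∈ B := fun i hi => (hpB i hi).2
  have hB' : ∀ i ≤ d, ¬ Even i → p i ∉ B := fun i hi he h0 => he ((hpB i hi).1 h0)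
  have hne : ∀ i ≤ d, ∀ j ≤ d, i ≠ j → p i ≠ p j := fun i hi j hj hij h0 => hij (hinj i hi j hj h0)
  have e0 : Even 0 := Even.zero
  have e1 : ¬ Even 1 := by decide
  have e2 : Even 2 := by decide
  have e3 : ¬ Even 3 := by decide
  have e4 : Even 4 := by decide
  obtain rfl | rfl | hd6 : d = 2 ∨ d = 4 ∨ 6 ≤ d := by
    obtain ⟨k, rfl⟩ := hev
    omega
  · exact h.not_bad_two hbad (q := p 1) (hB' 1 (by simp) e1) (hpS 1 (by simp)) (hpu 1 (by simp))
      (hpv 1 (by simp)) ((hco 0 (by simp) 1 (by simp) e0 e1).2 (by simp))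
      ((hco 2 (by simp) 1 (by simp) e2 e1).2 (by simp))
  · refine h.not_bad_four hbad (x₂ := p 2) (y₁ := p 1) (y₂ := p 3) ?_ (hB 2 (by simp) e2)
      (hpS 2 (by simp)) (hB' 1 (by simp) e1) (hpS 1 (by simp)) (hB' 3 (by simp) e3)
      (hpS 3 (by simp)) ((hco 0 (by simp) 1 (by simp) e0 e1).2 (by simp))
      (hco0 0 (by simp) 3 (by simp) e0 e3 (by simp)) ((hco 2 (by simp) 1 (by simp) e2 e1).2 (by simp))
      ((hco 2 (by simp) 3 (by simp) e2 e3).2 (by simp))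
      (hco0 4 (by simp) 1 (by simp) e4 e1 (by simp)) ((hco 4 (by simp) 3 (by simp) e4 e3).2 (by simp))
    have huv := h.huv
    have q01 := hne 0 (by simp) 1 (by simp) (by simp)
    have q02 := hne 0 (by simp) 2 (by simp) (by simp)
    have q03 := hne 0 (by simp) 3 (by simp) (by simp)
    have q04 := hne 0 (by simp) 4 (by simp) (by simp)
    have q12 := hne 1 (by simp) 2 (by simp) (by simp)
    have q13 := hne 1 (by simp) 3 (by simp) (by simp)
    have q14 := hne 1 (by simp) 4 (by simp) (by simp)
    have q23 := hne 2 (by simp) 3 (by simp) (by simp)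
    have q24 := hne 2 (by simp) 4 (by simp) (by simp)
    have q34 := hne 3 (by simp) 4 (by simp) (by simp)
    have := hpu 0 (by simp)
    have := hpu 1 (by simp)
    have := hpu 2 (by simp)
    have := hpu 3 (by simp)
    have := hpu 4 (by simp)
    have := hpv 0 (by simp)
    have := hpv 1 (by simp)
    have := hpv 2 (by simp)
    have := hpv 3 (by simp)
    have := hpv 4 (by simp)
    simp only [List.nodup_cons, List.mem_cons, List.not_mem_nil, or_false, not_or]
    grind
  · have h23 := (hco 2 (by omega) 3 (by omega) e2 e3).2 (by simp)
    have m2 := hB 2 (by omega) e2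
    have m3 := hB' 3 (by omega) e3
    obtain ⟨h', hbad'⟩ := h.bad_swap hbad (p := p 2) (q := p 3) m2 (hpS 2 (by omega)) m3
      (hpS 3 (by omega)) (hpu 3 (by omega)) (hpv 3 (by omega)) h23
      (hne 2 (by omega) 0 (by omega) (by simp)) (hne 2 (by omega) d (by omega) (by omega))
      (Or.inl ⟨hco0 0 (by omega) 3 (by omega) e0 e3 (by omega),
        hco0 d le_rfl 3 (by omega) hev e3 (by omega)⟩)
    have hrest : ∀ i ≤ d, ∀ j ≤ d, Even i → ¬ Even j → i ≠ 2 → j ≠ 3 →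
        P.coef (swap B (p 2) (p 3)) (p i) (p j) = P.coef B (p i) (p j) -
          P.coef B (p i) (p 3) * P.coef B (p 2) (p j) / P.coef B (p 2) (p 3) := by
      intro i hi j hj hei hej hi2 hj3
      exact P.coef_rest h.isBase m2 m3 h23 (hB i hi hei) (hne i hi 2 (by omega) hi2) (hB' j hj hej)
        (hne j hj 3 (by omega) hj3)
    refine h'.not_reachable hbad' (z := p 2) (hpW 2 (by omega)) (hne 2 (by omega) 0 (by omega) (by simp))
      (hne 2 (by omega) d (by omega) (by omega)) ?_
    have hadj : ∀ i ≤ d, ∀ j ≤ d, Even i → ¬ Even j → i ≠ 2 → j ≠ 3 →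
        P.coef (swap B (p 2) (p 3)) (p i) (p j) ≠ 0 →
        (P.graph (((S.erase u).erase v).erase (p 2)) (swap B (p 2) (p 3))).Adj (p i) (p j) := by
      intro i hi j hj hei hej hi2 hj3 hc
      have hj2 : j ≠ 2 := by rintro rfl; exact hej e2
      refine graph_adj.2 ⟨Finset.mem_erase.2 ⟨hne i hi 2 (by omega) hi2, hpW i hi⟩,
        Finset.mem_erase.2 ⟨hne j hj 2 (by omega) hj2, hpW j hj⟩, Or.inl ⟨?_, ?_, hc⟩⟩
      · exact mem_swap.2 (Or.inr ⟨hne i hi 2 (by omega) hi2, hB i hi hei⟩)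
      · rw [mem_swap]
        have := hB' j hj hej
        have := hne j hj 3 (by omega) hj3
        grind
    have a01 := hadj 0 (by omega) 1 (by omega) e0 e1 (by simp) (by simp) (by
      rw [hrest 0 (by omega) 1 (by omega) e0 e1 (by simp) (by simp),
        hco0 0 (by omega) 3 (by omega) e0 e3 (by simp)]
      simpa using (hco 0 (by omega) 1 (by omega) e0 e1).2 (by simp))
    have a41 := hadj 4 (by omega) 1 (by omega) e4 e1 (by simp) (by simp) (by
      rw [hrest 4 (by omega) 1 (by omega) e4 e1 (by simp) (by simp),
        hco0 4 (by omega) 1 (by omega) e4 e1 (by simp), zero_sub, neg_ne_zero]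
      exact div_ne_zero (mul_ne_zero ((hco 4 (by omega) 3 (by omega) e4 e3).2 (by simp))
        ((hco 2 (by omega) 1 (by omega) e2 e1).2 (by simp))) h23)
    have key : ∀ i ≤ d, ∀ j ≤ d, Even i → ¬ Even j → 4 ≤ i → 4 ≤ j → (j = i + 1 ∨ i = j + 1) →
        (P.graph (((S.erase u).erase v).erase (p 2)) (swap B (p 2) (p 3))).Adj (p i) (p j) := by
      intro i hi j hj hei hej hi4 hj4 hij
      refine hadj i hi j hj hei hej (by omega) (by omega) ?_
      rw [hrest i hi j hj hei hej (by omega) (by omega), hco0 2 (by omega) j hj e2 hej (by omega)]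
      simpa using (hco i hi j hj hei hej).2 hij
    have htail := (dist_le_of_chain (G := P.graph (((S.erase u).erase v).erase (p 2))
      (swap B (p 2) (p 3))) p (a := 4) (b := d) (by omega) (fun j hj hjd => by
        by_cases hej : Even j
        · exact key j (by omega) (j + 1) (by omega) hej (by rw [Nat.even_add_one]; simpa) hj
            (by omega) (Or.inl rfl)
        · exact (key (j + 1) (by omega) j (by omega) (by rw [Nat.even_add_one]; exact hej) hej
            (by omega) hj (Or.inr rfl)).symm)).1
    exact a01.reachable.trans (a41.symm.reachable.trans htail)

end Glued
end PivotSystem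
end Gluing

section Main

variable {K F α : Type*} [Field K] [Field F] [DecidableEq α]

namespace PivotSystem

variable {P : PivotSystem K α} {Q : PivotSystem F α} {S B B₀ : Finset α} {lam : K → F}
  {x y u v c d z : α}

lemma exists_swap_swap (hB₀ : P.IsBase B₀) (hB : P.IsBase B) (huB : u ∈ B) (hvB : v ∈ B)
    (huv : u ≠ v) (hu : u ∉ B₀) (hv : v ∉ B₀) : ∃ C x y, P.IsBase C ∧ x ∈ C ∧ y ∈ C ∧ x ≠ y ∧
      u ∉ C ∧ v ∉ C ∧ x ∉ B ∧ y ∉ B ∧ x ∈ B₀ ∧ y ∈ B₀ ∧ (∀ z, z ≠ u → z ≠ v → z ≠ x → z ≠ y →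
      (z ∈ C ↔ z ∈ B)) ∧ P.coef C x u ≠ 0 ∧ B = swap (swap C x u) y v := by
  obtain ⟨y, hy, hyB, hvy⟩ := P.exists_row hB hB₀ hvB hv
  have hB1 := swap_isBase hB hvB hyB hvy
  have hu1 : u ∈ swap B v y := mem_swap.2 (Or.inr ⟨huv, huB⟩)
  obtain ⟨x, hx, hx1, hux⟩ := P.exists_row hB1 hB₀ hu1 hu
  have hB2 := swap_isBase hB1 hu1 hx1 hux
  have hxy : x ≠ y := by rintro rfl; exact hx1 (mem_swap.2 (Or.inl rfl))
  have hxv : x ≠ v := by rintro rfl; exact hv hx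
  have hxB : x ∉ B := fun h => hx1 (mem_swap.2 (Or.inr ⟨hxv, h⟩))
  refine ⟨_, x, y, hB2, mem_swap.2 (Or.inl rfl), ?_, hxy, ?_, ?_, hxB, hyB, hx, hy, ?_, ?_, ?_⟩
  · simp only [mem_swap]; grind
  · simp only [mem_swap]; grind
  · simp only [mem_swap]; grind
  · intro z h1 h2 h3 h4
    simp only [mem_swap]; grind
  · rw [P.coef_new hB1 hu1 hx1 hux]
    exact inv_ne_zero hux
  · rw [swap_swap hu1 hx1, swap_swap hvB hyB]

namespace Glued

lemma det_iff (h : Glued lam P Q S B u v) (hx : x ∈ B) (hxS : x ∈ S) (hy : y ∈ B) (hyS : y ∈ S) :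
    P.coef B x u * P.coef B y v = P.coef B x v * P.coef B y u ↔
      Q.coef B x u * Q.coef B y v = Q.coef B x v * Q.coef B y u := by
  have exu := h.coef_eq_zero hx hxS h.hu h.huS
  have exv := h.coef_eq_zero hx hxS h.hv h.hvS
  have eyu := h.coef_eq_zero hy hyS h.hu h.huS
  have eyv := h.coef_eq_zero hy hyS h.hv h.hvS
  by_cases hxu : P.coef B x u = 0
  · simp [hxu, exu.2 hxu, exv, eyu]
  by_cases hxv : P.coef B x v = 0
  · simp [hxv, exv.2 hxv, exu, eyv]
  by_cases hyu : P.coef B y u = 0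
  · simp [hyu, eyu.2 hyu, exu, eyv]
  by_cases hyv : P.coef B y v = 0
  · simp [hyv, eyv.2 hyv, exv, eyu]
  rw [← cr_eq_one_iff hxv hyu, ← cr_eq_one_iff (fun h0 => hxv (exv.1 h0)) (fun h0 => hyu (eyu.1 h0))]
  have : Q.cr B x y u v = lam (P.cr B x y u v) := by
    by_contra hne
    exact h.not_bad ⟨hx, hxS, hy, hyS, hxu, hxv, hyu, hyv, hne⟩
  rw [this]
  exact ⟨fun h1 => by rw [h1, h.map.map_one], h.map.eq_one⟩

lemma isBase_iff (h : Glued lam P Q S B₀ u v) (hA : Agree S B B₀) : P.IsBase B ↔ Q.IsBase B := by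
  by_cases huB : u ∈ B
  swap
  · refine h.lifts_u.1 B fun z hz => ?_
    by_cases hzu : z = u
    · subst hzu
      simp [huB, h.hu]
    · exact hA z (by grind)
  by_cases hvB : v ∈ B
  swap
  · refine h.lifts_v.1 B fun z hz => ?_
    by_cases hzv : z = v
    · subst hzv
      simp [hvB, h.hv]
    · exact hA z (by grind)
  have key : ∀ C x y, P.IsBase C → Q.IsBase C → Agree ((S.erase u).erase v) C B₀ → x ∈ C → y ∈ C →
      x ∈ S → y ∈ S → x ≠ y → P.coef C x u ≠ 0 →
      (P.IsBase (swap (swap C x u) y v) ↔ Q.IsBase (swap (swap C x u) y v)) := by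
    intro C x y hPC hQC hAC hx hy hxS hyS hxy hxu
    have h' := h.rebase hPC hAC
    rw [isBase_swap_swap_iff hPC hx hy hxy h'.hu h'.hv h.huv hxu,
      isBase_swap_swap_iff hQC hx hy hxy h'.hu h'.hv h.huv
        (fun h0 => hxu ((h'.coef_eq_zero hx hxS h'.hu h.huS).1 h0)), ne_eq, ne_eq,
      h'.det_iff hx hxS hy hyS]
  have agr : ∀ C x y, x ∉ B → y ∉ B → x ∈ B₀ → y ∈ B₀ → u ∉ C → v ∉ C → (∀ z, z ≠ u → z ≠ v →
      z ≠ x → z ≠ y → (z ∈ C ↔ z ∈ B)) → Agree ((S.erase u).erase v) C B₀ ∧ x ∈ S ∧ y ∈ S := by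
    intro C x y hx hy hx0 hy0 huC hvC hC
    have hxS : x ∈ S := by
      by_contra h0
      exact hx ((hA x h0).2 hx0)
    have hyS : y ∈ S := by
      by_contra h0
      exact hy ((hA y h0).2 hy0)
    refine ⟨fun z hz => ?_, hxS, hyS⟩
    by_cases hzu : z = u
    · subst hzu
      simp [huC, h.hu]
    by_cases hzv : z = v
    · subst hzv
      simp [hvC, h.hv]
    have hzS : z ∉ S := by grind
    rw [hC z hzu hzv (by grind) (by grind), hA z hzS]
  constructor
  · intro hB
    obtain ⟨C, x, y, hC, hxC, hyC, hxy, huC, hvC, hxB, hyB, hx0, hy0, hCB, hxu, e⟩ :=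
      exists_swap_swap h.isBase hB huB hvB h.huv h.hu h.hv
    obtain ⟨hAC, hxS, hyS⟩ := agr C x y hxB hyB hx0 hy0 huC hvC hCB
    have hQC := (h.rebase hC hAC).isBase'
    rw [e]
    exact (key C x y hC hQC hAC hxC hyC hxS hyS hxy hxu).1 (e ▸ hB)
  · intro hB
    obtain ⟨C, x, y, hC, hxC, hyC, hxy, huC, hvC, hxB, hyB, hx0, hy0, hCB, hxu, e⟩ :=
      exists_swap_swap h.isBase' hB huB hvB h.huv h.hu h.hv
    obtain ⟨hAC, hxS, hyS⟩ := agr C x y hxB hyB hx0 hy0 huC hvC hCB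
    have hPC := (h.lifts_u.1 C (hAC.mono (Finset.erase_subset _ _))).2 hC
    have h' := h.rebase hPC hAC
    rw [e]
    exact (key C x y hPC hC hAC hxC hyC hxS hyS hxy
      (fun h0 => hxu ((h'.coef_eq_zero hxC hxS h'.hu h.huS).2 h0))).2 (e ▸ hB)

lemma lifts_erase (h : Glued lam P Q S B u v) (hz : z ∈ (S.erase u).erase v) :
    Lifts lam P Q (S.erase z) B := by
  have hz' := hz
  simp only [Finset.mem_erase] at hz'
  obtain ⟨hzv, hzu, hzS⟩ := hz'
  obtain ⟨R, hR⟩ := h.exists_lift z hzS B h.isBase (Agree.refl _ _)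
  have hR0 := hR.isBase (Agree.refl _ _) h.isBase
  have su : (S.erase u).erase z ⊆ S.erase z := Finset.erase_subset_erase _ (Finset.erase_subset _ _)
  have sT : ((S.erase u).erase v).erase z ⊆ (S.erase u).erase z :=
    Finset.erase_subset_erase _ (Finset.erase_subset _ _)
  have hW : ∀ w ∈ (S.erase u).erase z, w ∉ ((S.erase u).erase v).erase z → w = v := by
    intro w h1 h2
    grind
  obtain ⟨τ, hτ0, hτ⟩ := hR.mono su |>.exists_scaled_of_lifts h.isBase
    (h.lifts_u.mono (Finset.erase_subset z _))
  have hins : insert u ((S.erase u).erase z) = S.erase z := by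
    ext w
    simp only [Finset.mem_insert, Finset.mem_erase]
    have := h.huS
    grind
  have key : ∀ C, R.IsBase C → Agree (((S.erase u).erase v).erase z) C B →
      P.IsBase C ∧ Agree ((S.erase u).erase v) C B ∧ Agree (S.erase z) C B := by
    intro C hC hA
    have hA' := hA.mono (sT.trans su)
    exact ⟨(hR.1 C hA').2 hC, hA.mono (Finset.erase_subset _ _), hA'⟩
  obtain ⟨σ, hσ0, hσ⟩ := exists_scaled (Q := R) (R := Q) (B₀ := B) (u := u) sT
    (fun w h1 h2 => by rw [hW w h1 h2]; exact h.hv)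
    (fun w h1 h2 w' h3 h4 => by rw [hW w h1 h2, hW w' h3 h4]) (by simp) h.hu hR0 h.isBase' hτ0 hτ
    (fun C hC hA p hp hpT => by
      obtain ⟨hPC, hA1, hA2⟩ := key C hC hA
      have h' := h.rebase hPC hA1
      rw [h'.coef_eq_zero hp (by grind) h'.hu h.huS, hR.coef_eq_zero hA2 hPC hp (by grind) h'.hu
        (by simp [h.huS, hzu.symm])])
    (fun C hC hA x y e hx hxT hy hyT he heW h1 h2 h3 h4 => by
      obtain ⟨hPC, hA1, hA2⟩ := key C hC hA
      have h' := h.rebase hPC hA1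
      have hxS : x ∈ S.erase z := by grind
      have hyS : y ∈ S.erase z := by grind
      have huS : u ∈ S.erase z := by simp [h.huS, hzu.symm]
      have heS : e ∈ S.erase z := by grind
      rw [ne_eq, hR.coef_eq_zero hA2 hPC hx hxS h'.hu huS] at h1
      rw [ne_eq, hR.coef_eq_zero hA2 hPC hy hyS h'.hu huS] at h2
      rw [ne_eq, hR.coef_eq_zero hA2 hPC hx hxS he heS] at h3
      rw [ne_eq, hR.coef_eq_zero hA2 hPC hy hyS he heS] at h4
      rw [hR.2 C hA2 hPC x y u e hx hxS hy hyS h'.hu huS he heS h1 h3 h2 h4]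
      by_cases hev : e = v
      · subst hev
        by_contra hne
        exact h'.not_bad ⟨hx, (Finset.mem_of_mem_erase hxS), hy, (Finset.mem_of_mem_erase hyS),
          h1, h3, h2, h4, fun h0 => hne h0.symm⟩
      · exact (h'.cr_eq hx (Finset.mem_of_mem_erase hxS) hy (Finset.mem_of_mem_erase hyS) h'.hu
          h.huS he (Finset.mem_of_mem_erase heS) (Or.inr ⟨h.huv, hev⟩) h1 h3 h2 h4).symm)
  rw [hins] at hσ
  exact hR.of_scaled h.isBase hσ0 h.isBase' hσ

lemma exists_agree (h : Glued lam P Q S B₀ u v) (hS : 5 ≤ S.card) (hz : z ∈ (S.erase u).erase v)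
    (B : Finset α) :
    ∃ C, P.IsBase C ∧ Agree ((S.erase u).erase v) C B₀ ∧ (z ∈ B ↔ z ∈ C) := by
  by_cases hzB : z ∈ B ↔ z ∈ B₀
  · exact ⟨B₀, h.isBase, Agree.refl _ _, hzB⟩
  have hcard : 3 ≤ ((S.erase u).erase v).card := by
    rw [Finset.card_erase_of_mem (by simp [h.hvS, h.huv.symm]), Finset.card_erase_of_mem h.huS]
    omega
  obtain ⟨p, hp, q, hq, -, hadj⟩ := h.isConn.exists_adj (U := {z}) (by simpa using hz) (by simp)
    (by simp; omega)
  rw [Finset.mem_singleton] at hp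
  subst hp
  obtain ⟨-, -, ⟨h1, h2, h3⟩ | ⟨h1, h2, h3⟩⟩ := hadj
  · refine ⟨_, swap_isBase h.isBase h1 h2 h3, (Agree.refl _ _).swap_left hz hq, ?_⟩
    simp only [mem_swap]
    grind
  · refine ⟨_, swap_isBase h.isBase h1 h2 h3, (Agree.refl _ _).swap_left hq hz, ?_⟩
    simp only [mem_swap]
    grind

/-- A system which lifts `P` after deleting `u` and after deleting `v` lifts `P`. -/
theorem lifts (h : Glued lam P Q S B₀ u v) (hS : 5 ≤ S.card) : Lifts lam P Q S B₀ := by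
  refine ⟨fun B hA => h.isBase_iff hA, ?_⟩
  intro B hA hB x y c d hx hxS hy hyS hc hcS hd hdS h1 h2 h3 h4
  by_cases hu : u ∉ B ∧ u ≠ c ∧ u ≠ d
  · obtain ⟨huB, huc, hud⟩ := hu
    refine h.lifts_u.2 B (fun z hz => ?_) hB x y c d hx (by grind) hy (by grind) hc (by grind) hd
      (by grind) h1 h2 h3 h4
    by_cases hzu : z = u
    · subst hzu
      simp [huB, h.hu]
    · exact hA z (by grind)
  by_cases hv : v ∉ B ∧ v ≠ c ∧ v ≠ d
  · obtain ⟨huB, huc, hud⟩ := hv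
    refine h.lifts_v.2 B (fun z hz => ?_) hB x y c d hx (by grind) hy (by grind) hc (by grind) hd
      (by grind) h1 h2 h3 h4
    by_cases hzu : z = v
    · subst hzu
      simp [huB, h.hv]
    · exact hA z (by grind)
  by_cases hz : ∃ z ∈ (S.erase u).erase v, z ≠ x ∧ z ≠ y ∧ z ≠ c ∧ z ≠ d
  · obtain ⟨z, hz, hzx, hzy, hzc, hzd⟩ := hz
    obtain ⟨C, hC, hAC, hzC⟩ := h.exists_agree hS hz B
    have h' := h.rebase hC hAC
    refine (h'.lifts_erase hz).2 B (fun w hw => ?_) hB x y c d hx (by grind) hy (by grind) hc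
      (by grind) hd (by grind) h1 h2 h3 h4
    by_cases hwz : w = z
    · rw [hwz]
      exact hzC
    · rw [hA w (by grind), hAC w (by grind)]
  · exfalso
    push Not at hz
    have hsub : S \ B ⊆ {c, d} := by
      intro w hw
      rw [Finset.mem_sdiff] at hw
      have hzw := hz w
      simp only [Finset.mem_erase, Finset.mem_insert, Finset.mem_singleton] at hzw ⊢
      by_contra! hne
      have key : ∀ t ∈ B, w ≠ t := fun t ht h0 => hw.2 (h0 ▸ ht)
      refine hne.2 (hzw ⟨?_, ?_, hw.1⟩ (key x hx) (key y hy) hne.1)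
      · rintro rfl
        exact hv ⟨hw.2, hne⟩
      · rintro rfl
        exact hu ⟨hw.2, hne⟩
    have hsub0 : {u, v} ⊆ S \ B₀ := by
      intro w hw
      have := h.hu
      have := h.hv
      have := h.huS
      have := h.hvS
      grind
    have hcard : (S \ B).card = (S \ B₀).card := by
      have e1 := card_eq hB h.isBase
      have e2 : B \ S = B₀ \ S := by
        ext w
        have := hA w
        simp only [Finset.mem_sdiff]
        grind
      have e3 := Finset.card_inter_add_card_sdiff B S
      have e4 := Finset.card_inter_add_card_sdiff B₀ S
      have e5 := Finset.card_inter_add_card_sdiff S B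
      have e6 := Finset.card_inter_add_card_sdiff S B₀
      rw [Finset.inter_comm] at e5 e6
      rw [e2] at e3
      omega
    have huv0 : {u, v} = S \ B₀ := by
      refine Finset.eq_of_subset_of_card_le hsub0 ?_
      rw [← hcard, Finset.card_pair h.huv]
      exact (Finset.card_le_card hsub).trans Finset.card_le_two
    have hWB : ∀ w ∈ (S.erase u).erase v, w ∈ B₀ := by
      intro w hw
      by_contra hwB
      have : w ∈ S \ B₀ := by grind
      rw [← huv0] at this
      grind
    have hcardW : 3 ≤ ((S.erase u).erase v).card := by
      rw [Finset.card_erase_of_mem (by simp [h.hvS, h.huv.symm]), Finset.card_erase_of_mem h.huS]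
      omega
    obtain ⟨a, ha⟩ := Finset.card_pos.1 (show 0 < ((S.erase u).erase v).card by omega)
    obtain ⟨p, hp, q, hq, -, hadj⟩ := h.isConn.exists_adj (U := {a}) (by simpa using ha) (by simp)
      (by simp; omega)
    rw [Finset.mem_singleton] at hp
    subst hp
    obtain ⟨-, -, ⟨h1, h2, h3⟩ | ⟨h1, h2, h3⟩⟩ := hadj
    · exact h2 (hWB _ hq)
    · exact h2 (hWB _ ha)

end Glued

/-- Lifts of two deletions glue to a common extension. -/
lemma exists_lifts_erase {Q₁ Q₂ : PivotSystem F α} (hB₀ : P.IsBase B₀) (hu : u ∉ B₀)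
    (h1 : Lifts lam P Q₁ (S.erase u) B₀)
    (h2 : Lifts lam P Q₂ (S.erase v) B₀) :
    ∃ Q : PivotSystem F α, Lifts lam P Q (S.erase u) B₀ ∧ Lifts lam P Q (S.erase v) B₀ := by
  obtain ⟨σ, hσ0, hσ⟩ := (h1.mono (Finset.erase_subset v _)).exists_scaled_of_lifts hB₀
    (h2.mono (T := (S.erase u).erase v) (Finset.erase_subset_erase _ (Finset.erase_subset _ _)))
  let A : α → α → F := fun p q => if q = u then Q₂.coef B₀ p q else
    Q₁.coef B₀ p q * σ q / σ p
  have hQ := matrixSystem_isBase B₀ A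
  refine ⟨matrixSystem B₀ A, h1.of_scaled hB₀ hσ0 hQ fun p hp hpS q hq hqS => ?_,
    h2.of_scaled hB₀ (σ := fun _ => 1) (fun _ => one_ne_zero) hQ fun p hp hpS q hq hqS => ?_⟩
  · rw [matrixSystem_coef hp hq]
    simp only [A]
    rw [if_neg (by grind)]
  · rw [matrixSystem_coef hp hq]
    simp only [A, mul_one, div_one]
    split_ifs with hqu
    · rfl
    · exact (hσ p hp (by grind) q hq (by grind)).symm

lemma exists_lift_of_deletable (hlam : IsCrossRatioMap lam) (hP : P.NoUniform) (hB₀ : P.IsBase B₀)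
    (huS : u ∈ S) (hvS : v ∈ S) (huv : u ≠ v) (hu : u ∉ B₀) (hv : v ∉ B₀) (hS : 5 ≤ S.card)
    (hc : IsConn (P.graph S B₀) ((S.erase u).erase v))
    (ih : ∀ z ∈ S, ∀ B, P.IsBase B → ∃ R : PivotSystem F α, Lifts lam P R (S.erase z) B) :
    ∃ Q : PivotSystem F α, Lifts lam P Q S B₀ := by
  obtain ⟨Q₁, h1⟩ := ih u huS B₀ hB₀
  obtain ⟨Q₂, h2⟩ := ih v hvS B₀ hB₀
  obtain ⟨Q, hQu, hQv⟩ := exists_lifts_erase hB₀ hu h1 h2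
  exact ⟨Q, Glued.lifts ⟨hlam, hP, hB₀, huS, hvS, huv, hu, hv, hQu, hQv, hc,
    fun z hz B hB _ => ih z hz B hB⟩ hS⟩

lemma dual_isBase_compl [Fintype α] : P.dual.IsBase Bᶜ ↔ P.IsBase B := by
  simp [PivotSystem.dual]

lemma dual_graph [Fintype α] : P.dual.graph S Bᶜ = P.graph S B := by
  ext p q
  simp only [graph_adj, PivotSystem.dual, Finset.mem_compl, compl_compl, neg_ne_zero, not_not]
  tauto

theorem exists_lift [Fintype α] (hlam : IsCrossRatioMap lam) (hP : P.NoUniform)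
    (hB₀ : P.IsBase B₀) (S : Finset α) : ∃ Q : PivotSystem F α, Lifts lam P Q S B₀ := by
  induction hn : S.card using Nat.strong_induction_on generalizing S P B₀ with
  | _ n ih =>
  by_cases hsmall : S.card ≤ 4
  · refine exists_lift_of_isSmall hlam hB₀ ?_
    have := Finset.card_inter_add_card_sdiff S B₀
    unfold IsSmall
    omega
  by_cases hconn : IsConn (P.graph S B₀) S
  · obtain ⟨B, hB, hA, u, huS, v, hvS, huv, huvB, hc⟩ := exists_deletable_pair hB₀ hconn (by omega)
    suffices h : ∃ Q : PivotSystem F α, Lifts lam P Q S B by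
      obtain ⟨Q, hQ⟩ := h
      exact ⟨Q, hQ.rebase hA.symm⟩
    by_cases hu : u ∈ B
    · obtain ⟨Q, hQ⟩ := exists_lift_of_deletable (F := F) hlam hP.dual (dual_isBase_compl.2 hB) huS
        hvS huv (by simpa) (by simpa using huvB.1 hu) (by omega) (by rwa [dual_graph])
        (fun z hz C hC => ih _ (hn ▸ Finset.card_erase_lt_of_mem hz) hP.dual hC _ rfl)
      exact ⟨_, hQ.of_dual⟩
    · exact exists_lift_of_deletable hlam hP hB huS hvS huv hu (fun h => hu (huvB.2 h)) (by omega) hc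
        (fun z hz C hC => ih _ (hn ▸ Finset.card_erase_lt_of_mem hz) hP hC _ rfl)
  · unfold IsConn at hconn
    push Not at hconn
    obtain ⟨T, hTS, hT, hcl, hne⟩ := hconn
    have hssub : T ⊂ S := hTS.ssubset_of_ne hne
    have hlt : (S \ T).card < S.card := by
      have := Finset.card_sdiff_add_card_eq_card hTS
      have := hT.card_pos
      omega
    obtain ⟨Q₁, h1⟩ := ih _ (hn ▸ Finset.card_lt_card hssub) hP hB₀ T rfl
    obtain ⟨Q₂, h2⟩ := ih _ (hn ▸ hlt) hP hB₀ (S \ T) rfl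
    have hun : T ∪ S \ T = S := Finset.union_sdiff_of_subset hTS
    obtain ⟨Q, hQ⟩ := exists_lift_union hB₀ Finset.disjoint_sdiff
      (fun p hp q hq hadj => by
        rw [hun] at hadj
        exact (Finset.mem_sdiff.1 hq).2 (hcl p hp q (Finset.mem_sdiff.1 hq).1 hadj)) h1 h2
    rw [hun] at hQ
    exact ⟨Q, hQ⟩

/-- There is a matrix over `F` with the same bases as `P`. -/
theorem exists_matrix [Fintype α] (hlam : IsCrossRatioMap lam) (hP : P.NoUniform)
    (hB₀ : P.IsBase B₀) : ∃ A : α → α → F, ∀ B, P.IsBase B ↔ (matrixSystem B₀ A).IsBase B := by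
  obtain ⟨Q, hQ⟩ := exists_lift (F := F) hlam hP hB₀ Finset.univ
  refine ⟨Q.coef B₀, fun B => ?_⟩
  refine (hQ.of_scaled hB₀ (σ := fun _ => 1) (fun _ => one_ne_zero) (matrixSystem_isBase _ _)
    fun p hp _ q hq _ => ?_).1 B fun z hz => absurd (Finset.mem_univ z) hz
  rw [matrixSystem_coef hp hq]
  simp

end PivotSystem
end Main

section CrossRatioMaps

variable {K F : Type*} [Field K] [Field F]

lemma exists_isCrossRatioMap_zmod_three (h2 : (2 : K) ≠ 0) :
    ∃ lam : K → ZMod 3, IsCrossRatioMap lam := by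
  classical
  have hneg : (-1 : K) ≠ 1 := fun h => h2 (by linear_combination -h)
  refine ⟨fun x => if x = 0 then 0 else if x = 1 then 1 else -1, ?_, ?_, ?_, ?_, ?_, ?_, ?_⟩
  · simp
  · simp
  · intro x
    split_ifs with h h'
    · simp [h]
    · simp
    · simp
  · intro x
    split_ifs with h h'
    · simp
    · simp [h']
    · intro h0
      exact absurd h0 (by decide)
  · intro x
    by_cases h : x = 0
    · simp [h]
    by_cases h' : x = 1
    · simp [h']
    · have e1 : 1 - x ≠ 0 := fun h0 => h' (by linear_combination -h0)
      have e2 : 1 - x ≠ 1 := fun h0 => h (by linear_combination -h0)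
      simp only [h, h', e1, e2, if_false]
      decide
  · intro x
    by_cases h : x = 0
    · simp [h]
    by_cases h' : x = 1
    · simp [h']
    · simp only [h, h', inv_eq_zero, inv_eq_one, if_false]
      rw [inv_neg, inv_one]
  · simp [hneg]

lemma exists_isCrossRatioMap_of_two_eq_zero (h2 : (2 : K) = 0) (hF : (2 : F) = 0) {ω : F}
    (hω : ω ^ 2 = ω + 1) : ∃ lam : K → F, IsCrossRatioMap lam := by
  classical
  have : CharP K 2 := CharTwo.of_one_ne_zero_of_two_eq_zero one_ne_zero h2
  let : Algebra (ZMod 2) K := ZMod.algebra K 2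
  obtain ⟨f, hf⟩ : ∃ f : Module.Dual (ZMod 2) K, f 1 ≠ 0 := by
    by_contra! h
    exact one_ne_zero ((Module.forall_dual_apply_eq_zero_iff (ZMod 2) (1 : K)).1 h)
  have hz : ∀ a : ZMod 2, a ≠ 0 ↔ a = 1 := by decide
  rw [hz] at hf
  have hflip : ∀ y, f (y + 1) = 0 ↔ ¬ f y = 0 := by
    intro y
    rw [map_add, hf]
    revert y
    suffices h : ∀ a : ZMod 2, a + 1 = 0 ↔ ¬ a = 0 from fun y => h _
    decide
  let g : K → K := fun x => x + x⁻¹ + (1 - x)⁻¹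
  let lam : K → F := fun x => if x = 0 then 0 else if x = 1 then 1 else
    if f (g x) = 0 then ω else ω + 1
  have hω0 : ω ≠ 0 := by
    rintro rfl
    simp at hω
  have hω1 : ω ≠ 1 := by
    rintro rfl
    exact one_ne_zero (α := F) (by linear_combination -hω)
  have hωi : ω⁻¹ = ω + 1 := by
    refine inv_eq_of_mul_eq_one_right ?_
    linear_combination hω + ω * hF
  have hωi' : (ω + 1)⁻¹ = ω := by rw [← hωi, inv_inv]
  have hK : ∀ x : K, 1 - x = x + 1 := fun x => by linear_combination -x * h2
  have hsub : ∀ x, x ≠ 0 → x ≠ 1 → g (1 - x) = g x + 1 := by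
    intro x h0 h1
    simp only [g, sub_sub_cancel]
    linear_combination -x * h2
  have hinv : ∀ x, x ≠ 0 → x ≠ 1 → g x⁻¹ = g x + 1 := by
    intro x h0 h1
    have e1 : 1 - x ≠ 0 := fun h => h1 (by linear_combination -h)
    have e2 : x - 1 ≠ 0 := fun h => h1 (by linear_combination h)
    have e3 : 1 - x⁻¹ = (x - 1) / x := by field_simp
    simp only [g, inv_inv, e3, inv_div]
    have : (1 - x)⁻¹ = - (x - 1)⁻¹ := by rw [← inv_neg, neg_sub]
    rw [this]
    field_simp
    linear_combination x * h2
  have hne : ∀ x, x ≠ 0 → x ≠ 1 → lam x = if f (g x) = 0 then ω else ω + 1 := by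
    intro x h0 h1
    simp only [lam, h0, h1, if_false]
  have hflip' : ∀ x y, x ≠ 0 → x ≠ 1 → y ≠ 0 → y ≠ 1 → g y = g x + 1 →
      (lam x = ω ∧ lam y = ω + 1 ∨ lam x = ω + 1 ∧ lam y = ω) := by
    intro x y h1 h2 h3 h4 h5
    rw [hne x h1 h2, hne y h3 h4, h5]
    simp only [hflip]
    by_cases h : f (g x) = 0 <;> simp [h]
  have hω2 : ω + 1 ≠ 0 := fun h => hω1 (by linear_combination h - hF)
  refine ⟨lam, ?_, ?_, ?_, ?_, ?_, ?_, ?_⟩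
  · simp [lam]
  · simp [lam]
  · intro x h
    by_contra h0
    by_cases h1 : x = 1
    · simp [lam, h1] at h
    · rw [hne x h0 h1] at h
      split_ifs at h
      · exact hω0 h
      · exact hω2 h
  · intro x h
    by_contra h1
    by_cases h0 : x = 0
    · simp [lam, h0] at h
    · rw [hne x h0 h1] at h
      split_ifs at h
      · exact hω1 h
      · exact hω0 (by linear_combination h)
  · intro x
    by_cases h : x = 0
    · simp [lam, h]
    by_cases h' : x = 1
    · simp [lam, h']
    · have e1 : 1 - x ≠ 0 := fun h0 => h' (by linear_combination -h0)
      have e2 : 1 - x ≠ 1 := fun h0 => h (by linear_combination -h0)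
      rcases hflip' x (1 - x) h h' e1 e2 (hsub x h h') with ⟨h3, h4⟩ | ⟨h3, h4⟩ <;> rw [h3, h4]
      · linear_combination ω * hF
      · linear_combination ω * hF
  · intro x
    by_cases h : x = 0
    · simp [lam, h]
    by_cases h' : x = 1
    · simp [lam, h']
    · rcases hflip' x x⁻¹ h h' (inv_ne_zero h) (fun h0 => h' (inv_eq_one.1 h0)) (hinv x h h') with
        ⟨h3, h4⟩ | ⟨h3, h4⟩ <;> rw [h3, h4]
      · exact hωi.symm
      · exact hωi'.symm
  · have e1 : (-1 : K) = 1 := by linear_combination -h2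
    have e2 : (-1 : F) = 1 := by linear_combination -hF
    rw [e1, e2]
    simp [lam]

lemma exists_galoisField_sq_eq : ∃ ω : GaloisField 2 2, ω ^ 2 = ω + 1 := by
  classical
  have : Fintype (GaloisField 2 2) := Fintype.ofFinite _
  have hcard : Fintype.card (GaloisField 2 2) = 4 := by
    rw [← Nat.card_eq_fintype_card, GaloisField.card 2 2 (by norm_num)]
    norm_num
  obtain ⟨ω, -, hω⟩ := Finset.exists_mem_notMem_of_card_lt_card
    (s := ({0, 1} : Finset (GaloisField 2 2))) (t := Finset.univ)
    (lt_of_le_of_lt Finset.card_le_two (by rw [Finset.card_univ, hcard]; norm_num))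
  simp only [Finset.mem_insert, Finset.mem_singleton, not_or] at hω
  have h4 := FiniteField.pow_card ω
  rw [hcard] at h4
  have hF : (2 : GaloisField 2 2) = 0 := CharTwo.two_eq_zero
  refine ⟨ω, ?_⟩
  have h : ω * (ω - 1) * (ω ^ 2 + ω + 1) = 0 := by linear_combination h4
  have := (mul_eq_zero.1 h).resolve_left (mul_ne_zero hω.1 (sub_ne_zero.2 hω.2))
  linear_combination this - (ω + 1) * hF

end CrossRatioMaps

section Minors

variable {K V β : Type*} {α : Type u} [Field K] [AddCommGroup V] [Module K V] [DecidableEq β]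

lemma exists_isVectorBase [Fintype β] {φ : β → V} {I : Finset β}
    (h : LinearIndepOn K φ (I : Set β)) : ∃ B, I ⊆ B ∧ IsVectorBase K φ B := by
  classical
  obtain ⟨b, -, hb, hspan, hli⟩ := exists_linearIndepOn_extension h (subset_univ _)
  refine ⟨b.toFinset, ?_, ?_, fun e => ?_⟩
  · simpa using hb
  · simpa using hli
  · simpa using hspan ⟨e, mem_univ _, rfl⟩

lemma linearIndepOn_iff_exists_isVectorBase [Fintype β] {φ : β → V} {I : Finset β} :
    LinearIndepOn K φ (I : Set β) ↔ ∃ B, I ⊆ B ∧ IsVectorBase K φ B :=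
  ⟨exists_isVectorBase, fun ⟨_, hI, hB⟩ => hB.1.mono (by exact_mod_cast hI)⟩

/-- A family of vectors on a finite subset of a matroid yields a uniform minor if it satisfies
the corresponding condition on its bases. -/
lemma hasUniformMinor_of_isVectorBase [Fintype β] {M : Matroid α} {f : β → α}
    (hf : Function.Injective f) (hfE : ∀ b, f b ∈ M.E) {φ : β → V}
    (h : ∀ J : Finset β, M.Indep (f '' J) ↔ LinearIndepOn K φ (J : Set β)) {C E : Finset β}
    (hCE : Disjoint C E) {r n : ℕ} (hE : E.card = n) (hr : r ≤ n)
    (hB : ∀ J ⊆ E, J.card = r → IsVectorBase K φ (C ∪ J)) : HasUniformMinor M r n := by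
  classical
  have hindep : ∀ J ⊆ E, J.card ≤ r → LinearIndepOn K φ ((C ∪ J : Finset β) : Set β) := by
    intro J hJ hJr
    obtain ⟨J', h1, h2, h3⟩ := Finset.exists_subsuperset_card_eq hJ hJr (hE ▸ hr)
    exact (hB J' h2 h3).1.mono (by exact_mod_cast Finset.union_subset_union_right h1)
  have hC : M.Indep (f '' C) := by
    rw [h]
    simpa using hindep ∅ (by simp) (by simp)
  have hgr : (M.E \ f '' C) \ (M.E \ (f '' C ∪ f '' E)) = f '' E := by
    ext a
    simp only [mem_sdiff, mem_union]
    constructor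
    · grind
    · rintro ⟨b, hb, rfl⟩
      refine ⟨⟨hfE b, ?_⟩, fun h0 => h0.2 (Or.inr ⟨b, hb, rfl⟩)⟩
      rintro ⟨c, hc, hcb⟩
      rw [hf hcb] at hc
      exact Finset.disjoint_left.1 hCE hc hb
  refine ⟨delete (contract M (f '' C)) (M.E \ (f '' C ∪ f '' E)), ⟨_, _, rfl⟩, ?_⟩
  have hground : (delete (contract M (f '' C)) (M.E \ (f '' C ∪ f '' E))).E = f '' E := hgr
  refine ⟨?_, ?_, ?_⟩ <;> rw [hground]
  · exact E.finite_toSet.image f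
  · rw [ncard_image_of_injective _ hf, ncard_coe_finset, hE]
  · intro I hI
    obtain ⟨J, hJ, rfl⟩ : ∃ J : Finset β, J ⊆ E ∧ f '' J = I := by
      refine ⟨E.filter fun b => f b ∈ I, Finset.filter_subset _ _, ?_⟩
      ext a
      constructor
      · rintro ⟨b, hb, rfl⟩
        simpa using (Finset.mem_filter.1 hb).2
      · intro ha
        obtain ⟨b, hb, rfl⟩ := hI ha
        exact ⟨b, by simpa using ⟨hb, ha⟩, rfl⟩
    have e1 : (delete (contract M (f '' C)) (M.E \ (f '' C ∪ f '' E))).Indep (f '' J) ↔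
        (M ／ (f '' C)).Indep (f '' J) ∧ f '' J ⊆ f '' E := by
      change _ ∧ f '' J ⊆ (M.E \ f '' C) \ (M.E \ (f '' C ∪ f '' E)) ↔ _
      rw [hgr]
      rfl
    rw [e1, and_iff_left hI, hC.contract_indep_iff, ← image_union, ← Finset.coe_union, h,
      ncard_image_of_injective _ hf, ncard_coe_finset, Finset.union_comm]
    constructor
    · rintro ⟨-, hli⟩
      obtain ⟨B, hJB, hBase⟩ := exists_isVectorBase hli
      obtain ⟨J', h2, h3⟩ := Finset.exists_subset_card_eq (hE ▸ hr)
      have hcard := PivotSystem.card_eq (P := vectorSystem K φ) hBase (hB J' h2 h3)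
      rw [Finset.card_union_of_disjoint (hCE.mono_right h2)] at hcard
      have := Finset.card_le_card hJB
      rw [Finset.card_union_of_disjoint (hCE.mono_right hJ)] at this
      omega
    · intro hJr
      refine ⟨?_, hindep J hJ hJr⟩
      rw [disjoint_image_iff hf]
      exact_mod_cast (hCE.mono_right hJ).symm

lemma forall_pair_of_symm {β : Type*} {r : β → β → Prop} (hr : ∀ a b, r a b → r b a) {a b c d e : β}
    (ab : r a b) (ac : r a c) (ad : r a d) (ae : r a e) (bc : r b c) (bd : r b d) (be : r b e)
    (cd : r c d) (ce : r c e) (de : r d e) {p q : β} (hp : p = a ∨ p = b ∨ p = c ∨ p = d ∨ p = e)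
    (hq : q = a ∨ q = b ∨ q = c ∨ q = d ∨ q = e) (hpq : p ≠ q) : r p q := by
  rcases hp with rfl | rfl | rfl | rfl | rfl <;> rcases hq with rfl | rfl | rfl | rfl | rfl <;>
    first
      | exact absurd rfl hpq
      | assumption
      | (apply hr; assumption)

namespace PivotSystem

variable {P : PivotSystem K β} {B J : Finset β} {x y z u v w : β}

lemma isBase_of_row_pair (hB : P.IsBase B) (hx : x ∈ B) (hy : y ∈ B) (hu : u ∉ B) (hv : v ∉ B)
    (hw : w ∉ B) (xu : P.coef B x u ≠ 0) (xv : P.coef B x v ≠ 0) (xw : P.coef B x w ≠ 0)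
    (yu : P.coef B y u ≠ 0) (yv : P.coef B y v ≠ 0) (yw : P.coef B y w ≠ 0)
    (duv : P.coef B x u * P.coef B y v ≠ P.coef B x v * P.coef B y u)
    (duw : P.coef B x u * P.coef B y w ≠ P.coef B x w * P.coef B y u)
    (dvw : P.coef B x v * P.coef B y w ≠ P.coef B x w * P.coef B y v)
    (hJ : J ⊆ {x, y, u, v, w}) (hJ2 : J.card = 2) : P.IsBase ((B.erase x).erase y ∪ J) := by
  obtain ⟨p, q, hpq, rfl⟩ := Finset.card_eq_two.1 hJ2
  have hxy : x ≠ y := by rintro rfl; exact duv (mul_comm _ _)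
  have one : ∀ e ∉ B, P.coef B x e ≠ 0 → P.IsBase ((B.erase x).erase y ∪ {y, e}) := by
    intro e he hxe
    convert swap_isBase hB hx he hxe using 1
    ext z
    simp only [Finset.mem_union, Finset.mem_erase, Finset.mem_insert, Finset.mem_singleton,
      mem_swap]
    grind
  have one' : ∀ e ∉ B, P.coef B y e ≠ 0 → P.IsBase ((B.erase x).erase y ∪ {x, e}) := by
    intro e he hxe
    convert swap_isBase hB hy he hxe using 1
    ext z
    simp only [Finset.mem_union, Finset.mem_erase, Finset.mem_insert, Finset.mem_singleton,
      mem_swap]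
    grind
  have two : ∀ e ∉ B, ∀ g ∉ B, P.coef B x e ≠ 0 →
      P.coef B x e * P.coef B y g ≠ P.coef B x g * P.coef B y e →
      P.IsBase ((B.erase x).erase y ∪ {e, g}) := by
    intro e he g hg hxe hdet
    have heg : e ≠ g := by rintro rfl; exact hdet rfl
    convert (isBase_swap_swap_iff hB hx hy hxy he hg heg hxe).2 hdet using 1
    ext z
    simp only [Finset.mem_union, Finset.mem_erase, Finset.mem_insert, Finset.mem_singleton,
      mem_swap]
    grind
  have zero : P.IsBase ((B.erase x).erase y ∪ {x, y}) := by
    convert hB using 1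
    ext z
    simp only [Finset.mem_union, Finset.mem_erase, Finset.mem_insert, Finset.mem_singleton]
    grind
  have hp := hJ (Finset.mem_insert_self p {q})
  have hq := hJ (Finset.mem_insert_of_mem (Finset.mem_singleton_self q))
  simp only [Finset.mem_insert, Finset.mem_singleton] at hp hq
  exact forall_pair_of_symm (r := fun p q => P.IsBase ((B.erase x).erase y ∪ {p, q}))
    (fun a b h => by rwa [Finset.pair_comm]) zero (one' u hu yu) (one' v hv yv) (one' w hw yw)
    (one u hu xu) (one v hv xv) (one w hw xw) (two u hu v hv xu duv) (two u hu w hw xu duw)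
    (two v hv w hw xv dvw) hp hq hpq

lemma isBase_of_row_triple (hB : P.IsBase B) (hx : x ∈ B) (hy : y ∈ B) (hz : z ∈ B) (hu : u ∉ B)
    (hv : v ∉ B) (xu : P.coef B x u ≠ 0) (yu : P.coef B y u ≠ 0) (zu : P.coef B z u ≠ 0)
    (xv : P.coef B x v ≠ 0) (yv : P.coef B y v ≠ 0) (zv : P.coef B z v ≠ 0)
    (dxy : P.coef B x u * P.coef B y v ≠ P.coef B x v * P.coef B y u)
    (dxz : P.coef B x u * P.coef B z v ≠ P.coef B x v * P.coef B z u)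
    (dyz : P.coef B y u * P.coef B z v ≠ P.coef B y v * P.coef B z u)
    (hJ : J ⊆ {x, y, z, u, v}) (hE : ({x, y, z, u, v} : Finset β).card = 5) (hJ3 : J.card = 3) :
    P.IsBase (((B.erase x).erase y).erase z ∪ J) := by
  have huv : u ≠ v := by rintro rfl; exact dxy rfl
  have hxy : x ≠ y := by rintro rfl; exact dxy (mul_comm _ _)
  have hxz : x ≠ z := by rintro rfl; exact dxz (mul_comm _ _)
  have hyz : y ≠ z := by rintro rfl; exact dyz (mul_comm _ _)
  have m : ∀ e ∉ B, x ≠ e ∧ y ≠ e ∧ z ≠ e := fun e he => ⟨by grind, by grind, by grind⟩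
  have mu := m u hu
  have mv := m v hv
  have hc : (({x, y, z, u, v} : Finset β) \ J).card = 2 := by
    rw [Finset.card_sdiff_of_subset hJ, hE, hJ3]
  obtain ⟨p, q, hpq, hpq'⟩ := Finset.card_eq_two.1 hc
  have hp : p ∈ ({x, y, z, u, v} : Finset β) \ J := by rw [hpq']; simp
  have hq : q ∈ ({x, y, z, u, v} : Finset β) \ J := by rw [hpq']; simp
  replace hp := (Finset.mem_sdiff.1 hp).1
  replace hq := (Finset.mem_sdiff.1 hq).1
  simp only [Finset.mem_insert, Finset.mem_singleton] at hp hq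
  let r : β → β → Prop := fun p q => ∃ B', P.IsBase B' ∧ ∀ t, t ∈ B' ↔
    t ∈ ((B.erase x).erase y).erase z ∪ {x, y, z, u, v} \ {p, q}
  have one : ∀ s ∈ B, ∀ e ∉ B, P.coef B s e ≠ 0 → ∀ f, (∀ t, t ∈ swap B s e ↔
      t ∈ ((B.erase x).erase y).erase z ∪ {x, y, z, u, v} \ {s, f}) → r s f :=
    fun s hs e he hse f hf => ⟨_, swap_isBase hB hs he hse, hf⟩
  have two : ∀ s ∈ B, ∀ s' ∈ B, s ≠ s' → P.coef B s u ≠ 0 →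
      P.coef B s u * P.coef B s' v ≠ P.coef B s v * P.coef B s' u →
      (∀ t, t ∈ swap (swap B s u) s' v ↔
      t ∈ ((B.erase x).erase y).erase z ∪ {x, y, z, u, v} \ {s, s'}) → r s s' :=
    fun s hs s' hs' hss hsu hdet hf =>
      ⟨_, (isBase_swap_swap_iff hB hs hs' hss hu hv huv hsu).2 hdet, hf⟩
  suffices h : r p q by
    obtain ⟨B', h1, h2⟩ := h
    have hJe : J = {x, y, z, u, v} \ {p, q} := by
      rw [← hpq', Finset.sdiff_sdiff_eq_self hJ]
    rw [hJe, ← Finset.ext h2]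
    exact h1
  have zero : r u v := by
    refine ⟨B, hB, fun t => ?_⟩
    simp only [Finset.mem_union, Finset.mem_erase, Finset.mem_insert, Finset.mem_singleton,
      Finset.mem_sdiff]
    grind
  clear hJ hJ3 hpq' hc m
  refine forall_pair_of_symm (r := r) (fun a b ⟨B', h1, h2⟩ => ⟨B', h1, by rwa [Finset.pair_comm b a]⟩)
    (two x hx y hy hxy xu dxy ?_) (two x hx z hz hxz xu dxz ?_) (one x hx v hv xv u ?_)
    (one x hx u hu xu v ?_) (two y hy z hz hyz yu dyz ?_) (one y hy v hv yv u ?_)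
    (one y hy u hu yu v ?_) (one z hz v hv zv u ?_) (one z hz u hu zu v ?_) zero hp hq hpq
  all_goals
    intro t
    simp only [Finset.mem_union, Finset.mem_erase, Finset.mem_insert, Finset.mem_singleton,
      Finset.mem_sdiff, mem_swap]
    grind

end PivotSystem

lemma noUniform_of_noLargeUniformMinors [Fintype β] {M : Matroid α} (hM : NoLargeUniformMinors M)
    {f : β → α} (hf : Function.Injective f) (hfE : ∀ b, f b ∈ M.E) {φ : β → V}
    (h : ∀ J : Finset β, M.Indep (f '' J) ↔ LinearIndepOn K φ (J : Set β)) :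
    (vectorSystem K φ).NoUniform := by
  constructor
  · intro B hB x y u v w hx hy hu hv hw xu xv xw yu yv yw
    by_contra! hdet
    obtain ⟨duv, duw, dvw⟩ := hdet
    have hxy : x ≠ y := by rintro rfl; exact duv (mul_comm _ _)
    have huv : u ≠ v := by rintro rfl; exact duv rfl
    have huw : u ≠ w := by rintro rfl; exact duw rfl
    have hvw : v ≠ w := by rintro rfl; exact dvw rfl
    have m : ∀ e ∉ B, x ≠ e ∧ y ≠ e := fun e he => ⟨by grind, by grind⟩
    have mu := m u hu
    have mv := m v hv
    have mw := m w hw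
    have hE : ({x, y, u, v, w} : Finset β).card = 5 := by
      simp [Finset.card_insert_of_notMem, *]
    refine hM.1 (hasUniformMinor_of_isVectorBase hf hfE h (C := (B.erase x).erase y)
      (E := {x, y, u, v, w}) ?_ hE (by norm_num) fun J hJ hJ2 =>
      PivotSystem.isBase_of_row_pair hB hx hy hu hv hw xu xv xw yu yv yw duv duw dvw hJ hJ2)
    rw [Finset.disjoint_left]
    intro t
    simp only [Finset.mem_erase, Finset.mem_insert, Finset.mem_singleton]
    grind
  · intro B hB x y z u v hx hy hz hu hv xu yu zu xv yv zv
    by_contra! hdet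
    obtain ⟨dxy, dxz, dyz⟩ := hdet
    have huv : u ≠ v := by rintro rfl; exact dxy rfl
    have hxy : x ≠ y := by rintro rfl; exact dxy (mul_comm _ _)
    have hxz : x ≠ z := by rintro rfl; exact dxz (mul_comm _ _)
    have hyz : y ≠ z := by rintro rfl; exact dyz (mul_comm _ _)
    have m : ∀ e ∉ B, x ≠ e ∧ y ≠ e ∧ z ≠ e := fun e he => ⟨by grind, by grind, by grind⟩
    have mu := m u hu
    have mv := m v hv
    have hE : ({x, y, z, u, v} : Finset β).card = 5 := by
      simp [Finset.card_insert_of_notMem, *]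
    refine hM.2 (hasUniformMinor_of_isVectorBase hf hfE h (C := ((B.erase x).erase y).erase z)
      (E := {x, y, z, u, v}) ?_ hE (by norm_num) fun J hJ hJ3 =>
      PivotSystem.isBase_of_row_triple hB hx hy hz hu hv xu yu zu xv yv zv dxy dxz dyz hJ hE hJ3)
    rw [Finset.disjoint_left]
    intro t
    simp only [Finset.mem_erase, Finset.mem_insert, Finset.mem_singleton]
    grind

end Minors

section Compactness

open Filter

/-- Over a finite field, linear independence of a finite family in an ultrapower of vector spaces
is linear independence almost everywhere. -/
lemma linearIndependent_germ_iff {F W ι T : Type*} [Field F] [Finite F] [AddCommGroup W]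
    [Module F W] [Finite ι] (U : Ultrafilter T) (v : T → ι → W) :
    LinearIndependent F (fun i => ((fun X => v X i : T → W) : Germ (U : Filter T) W)) ↔
      ∀ᶠ X in (U : Filter T), LinearIndependent F (v X) := by
  have : Fintype ι := Fintype.ofFinite ι
  have key : ∀ c : ι → F, ∑ i, c i • ((fun X => v X i : T → W) : Germ (U : Filter T) W) = 0 ↔
      ∀ᶠ X in (U : Filter T), ∑ i, c i • v X i = 0 := by
    intro c
    have h : ∑ i, c i • ((fun X => v X i : T → W) : Germ (U : Filter T) W) =
        ((fun X => ∑ i, c i • v X i : T → W) : Germ (U : Filter T) W) := by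
      have := map_sum (Germ.coeAddHom (U : Filter T) (M := W)) (fun i => c i • fun X => v X i)
        Finset.univ
      simp only [Germ.coe_coeAddHom, Germ.coe_smul] at this
      rw [← this]
      congr 1
      ext X
      simp
    rw [h, ← Germ.coe_zero, Germ.coe_eq]
    rfl
  rw [← not_iff_not, ← Ultrafilter.eventually_not]
  simp only [Fintype.not_linearIndependent_iff, key]
  rw [Ultrafilter.eventually_exists_iff]
  refine exists_congr fun c => ?_
  rw [eventually_and]
  simp

/-- If the finite independent sets can be represented over a finite field on every finite subset,
then they have a common representation over that field. -/
lemma exists_linearIndepOn_iff_of_finset {F : Type*} {W : Type u} {α : Type v} [Field F] [Finite F]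
    [AddCommGroup W] [Module F W] {E : Set α} {P : Finset α → Prop}
    (h : ∀ X : Finset α, ∃ ψ : α → W, ∀ I ⊆ X, (I : Set α) ⊆ E →
      (P I ↔ LinearIndepOn F ψ (I : Set α))) :
    ∃ (V : Type (max u v)) (_ : AddCommGroup V) (_ : Module F V) (ψ : α → V),
      ∀ I : Finset α, (I : Set α) ⊆ E → (P I ↔ LinearIndepOn F ψ (I : Set α)) := by
  classical
  choose ψ hψ using h
  obtain ⟨U, hle⟩ : ∃ U : Ultrafilter (Finset α), (U : Filter (Finset α)) ≤ atTop :=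
    ⟨_, Ultrafilter.of_le atTop⟩
  refine ⟨Germ (U : Filter (Finset α)) W, inferInstance, inferInstance,
    fun e => (fun X => ψ X e : Finset α → W), fun I hI => ?_⟩
  have hU : ∀ᶠ X in (U : Filter (Finset α)), I ⊆ X :=
    (eventually_ge_atTop I).filter_mono hle
  have h1 := linearIndependent_germ_iff (F := F) U
    (fun X (i : (I : Set α)) => ψ X i)
  rw [LinearIndepOn, h1]
  constructor
  · intro hP
    filter_upwards [hU] with X hX using (hψ X I hX hI).1 hP
  · intro hP
    obtain ⟨X, hX, hX'⟩ := (hU.and hP).exists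
    exact (hψ X I hX hI).2 hX'

end Compactness

section Finite

variable {K V F : Type*} {α : Type u} [Field K] [AddCommGroup V] [Module K V] [Field F]

lemma linearIndepOn_comp_iff {β : Type*} {f : β → α} (hf : Function.Injective f) {φ : α → V}
    {s : Set β} : LinearIndepOn K (φ ∘ f) s ↔ LinearIndepOn K φ (f '' s) :=
  linearIndependent_equiv' (Equiv.Set.image f s hf) (by ext; rfl)

lemma exists_linearIndepOn_iff {M : Matroid α} (hM : NoLargeUniformMinors M) {φ : α → V}
    (hφ : ∀ I ⊆ M.E, (M.Indep I ↔ LinearIndepOn K φ I)) {lam : K → F}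
    (hlam : IsCrossRatioMap lam) (X : Finset α) :
    ∃ ψ : α → α → F, ∀ I ⊆ X, (I : Set α) ⊆ M.E →
      (LinearIndepOn K φ (I : Set α) ↔ LinearIndepOn F ψ (I : Set α)) := by
  classical
  let β := {x // x ∈ X ∧ x ∈ M.E}
  have : Fintype β := Fintype.ofInjective (fun b => (⟨b.1, b.2.1⟩ : X))
    fun a b hab => Subtype.ext (Subtype.mk.inj hab)
  let f : β → α := Subtype.val
  have hf : Function.Injective f := Subtype.val_injective
  have h : ∀ J : Finset β, M.Indep (f '' J) ↔ LinearIndepOn K (φ ∘ f) (J : Set β) := fun J => by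
    rw [linearIndepOn_comp_iff hf, hφ]
    rintro _ ⟨b, -, rfl⟩
    exact b.2.2
  have hN := noUniform_of_noLargeUniformMinors hM hf (fun b => b.2.2) h
  obtain ⟨B₀, -, hB₀⟩ := exists_isVectorBase (K := K) (φ := φ ∘ f) (I := ∅) (by simp)
  obtain ⟨A, hA⟩ := PivotSystem.exists_matrix hlam hN (B₀ := B₀) hB₀
  have hA' : ∀ J : Finset β, LinearIndepOn K (φ ∘ f) (J : Set β) ↔
      LinearIndepOn F (matrixVector B₀ A) (J : Set β) := fun J => by
    rw [linearIndepOn_iff_exists_isVectorBase, linearIndepOn_iff_exists_isVectorBase]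
    exact exists_congr fun B => and_congr_right fun _ => hA B
  let ι : (β → F) →ₗ[F] (α → F) := Function.ExtendByZero.linearMap F f
  have hι : Function.Injective ι := fun x y hxy => by
    ext b
    have := congr_fun hxy (f b)
    simpa [ι, hf.extend_apply] using this
  refine ⟨fun e => if he : e ∈ X ∧ e ∈ M.E then ι (matrixVector B₀ A ⟨e, he⟩) else 0,
    fun I hI hIE => ?_⟩
  obtain ⟨J, rfl⟩ : ∃ J : Finset β, J.image f = I := by
    refine ⟨Finset.univ.filter fun b => f b ∈ I, ?_⟩
    ext e
    simp only [Finset.mem_image, Finset.mem_filter, Finset.mem_univ, true_and]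
    exact ⟨by rintro ⟨b, hb, rfl⟩; exact hb, fun he => ⟨⟨e, hI he, hIE he⟩, he, rfl⟩⟩
  rw [Finset.coe_image, ← linearIndepOn_comp_iff hf, ← linearIndepOn_comp_iff hf, hA']
  have : (fun e => if he : e ∈ X ∧ e ∈ M.E then ι (matrixVector B₀ A ⟨e, he⟩) else 0) ∘ f =
      ι ∘ matrixVector B₀ A := by
    ext b
    simp [f, b.2.1, b.2.2]
  rw [this]
  exact (ι.linearIndepOn_iff_of_injOn hι.injOn).symm

end Finite

lemma Representable.of_isCrossRatioMap {α : Type u} {M : Matroid α} (hM : NoLargeUniformMinors M)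
    {K : Type v} [Field K] {F : Type} [Field F] [Finite F] {lam : K → F}
    (hlam : IsCrossRatioMap lam) (h : Representable M K) : Representable M F := by
  obtain ⟨V, _, _, φ, hφ⟩ := h
  have hfin := exists_linearIndepOn_iff hM hφ hlam
  obtain ⟨V', _, _, ψ, hψ⟩ := exists_linearIndepOn_iff_of_finset (F := F) (W := α → F)
    (P := fun I : Finset α => LinearIndepOn K φ (I : Set α)) hfin
  refine ⟨V', inferInstance, inferInstance, ψ, fun I hI => ?_⟩
  rw [hφ I hI]
  change LinearIndepOn K φ I ↔ LinearIndepOn F ψ I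
  constructor
  all_goals
    refine fun h => linearIndepOn_of_finite I fun t ht hfin => ?_
    have := hψ hfin.toFinset (by simpa using ht.trans hI)
    rw [hfin.coe_toFinset] at this
    simpa only [this] using h.mono ht

/-- Representability over a field does not depend on the universe. -/
lemma Representable.uLift {α : Type u} {M : Matroid α} {F : Type} [Field F]
    (h : Representable M F) : Representable M (ULift.{v} F) := by
  obtain ⟨V, _, _, φ, hφ⟩ := h
  refine ⟨ULift.{max u v} V, inferInstance, inferInstance, fun e => ⟨φ e⟩, fun I hI => ?_⟩
  rw [hφ I hI]
  have h1 : LinearIndependent (ULift.{v} F) (fun x : I => (⟨φ x⟩ : ULift.{max u v} V)) ↔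
      LinearIndependent (ULift.{v} F) (fun x : I => φ x) :=
    ((ULift.moduleEquiv (R := ULift.{v} F) (M := V)).toLinearMap.linearIndependent_iff
      (LinearEquiv.ker _)).symm
  rw [h1, linearIndependent_iff', linearIndependent_iff']
  refine forall_congr' fun s => ⟨fun h g hg i hi => ?_, fun h g hg i hi => ?_⟩
  · exact ULift.ext _ _ (h (fun i => (g i).down) hg i hi)
  · exact congrArg ULift.down (h (fun i => ⟨g i⟩) hg i hi)

lemma Representable.exists_field {α : Type u} {M : Matroid α} {F : Type} [Field F]
    (h : Representable M F) : ∃ (K : Type v) (_ : Field K), Representable M K :=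
  ⟨ULift.{v} F, inferInstance, h.uLift⟩

end Paper

/-- Let `M` be a matroid without large uniform minors. Then `M` is
representable over some field if and only if `M` is representable over `𝔽₃` or
representable over `𝔽₄`. -/
theorem representable_iff_representable_F3_or_F4
    {α : Type u} (M : Matroid α) (hM : Paper.NoLargeUniformMinors M) :
    (∃ (K : Type v) (_ : Field K), Paper.Representable M K) ↔
      (Paper.Representable M (ZMod 3) ∨ Paper.Representable M (GaloisField 2 2)) := by
  constructor
  · rintro ⟨K, _, h⟩
    by_cases h2 : (2 : K) = 0
    · obtain ⟨ω, hω⟩ := Paper.exists_galoisField_sq_eq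
      obtain ⟨lam, hlam⟩ := Paper.exists_isCrossRatioMap_of_two_eq_zero h2 CharTwo.two_eq_zero hω
      exact Or.inr (h.of_isCrossRatioMap hM hlam)
    · obtain ⟨lam, hlam⟩ := Paper.exists_isCrossRatioMap_zmod_three h2
      exact Or.inl (h.of_isCrossRatioMap hM hlam)
  · rintro (h | h)
    · exact h.exists_field
    · exact h.exists_field
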